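/- arXiv:1410.3149 — 2 statements merged into one kernel-verified Lean document; each statement's English description precedes it below -/
import Mathlib

section
/- (Klyachko's theorem / Thompson conjecture) Fix a positive integer n. The multiplicative Horn cone coincides with the Horn cone: C_B = C_Horn. -/
open Matrix

/-- The eigenvalues of a Hermitian matrix, listed in decreasing order:
`eigsDesc hA 0 = λ₁ ≥ eigsDesc hA 1 = λ₂ ≥ …`. -/
noncomputable def eigsDesc {n : ℕ} {A : Matrix (Fin n) (Fin n) ℂ} (hA : A.IsHermitian) :
    Fin n → ℝ :=
  fun i => hA.eigenvalues (Tuple.sort hA.eigenvalues i.rev)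

/-- `lMap hA i = λ₁ + … + λ_{i+1}`, the partial sums of the decreasingly ordered
eigenvalues of a Hermitian matrix (`i : Fin n` represents the index `i+1`). -/
noncomputable def lMap {n : ℕ} {A : Matrix (Fin n) (Fin n) ℂ} (hA : A.IsHermitian) :
    Fin n → ℝ :=
  fun i => ∑ j ∈ Finset.Iic i, eigsDesc hA j

/-- The Horn cone: triples `(a, b, c)` such that there are Hermitian matrices `K₁, K₂`
with `l(K₁) = a`, `l(K₂) = b`, `l(K₁ + K₂) = c`. -/
def HornCone (n : ℕ) : Set ((Fin n → ℝ) × (Fin n → ℝ) × (Fin n → ℝ)) :=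
  {abc | ∃ (K₁ K₂ : Matrix (Fin n) (Fin n) ℂ) (h₁ : K₁.IsHermitian) (h₂ : K₂.IsHermitian),
    lMap h₁ = abc.1 ∧ lMap h₂ = abc.2.1 ∧ lMap (h₁.add h₂) = abc.2.2}


/-- The set `B` of upper-triangular complex matrices with positive real diagonal
entries. -/
def UpperTriPos (n : ℕ) : Set (Matrix (Fin n) (Fin n) ℂ) :=
  {A | (∀ i j : Fin n, j < i → A i j = 0) ∧ ∀ i : Fin n, 0 < (A i i).re ∧ (A i i).im = 0}

/-- `lB A i = (1/2)(log λ₁(AA*) + … + log λ_{i+1}(AA*))`, where the `λ`'s are the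
decreasingly ordered eigenvalues of `A * Aᴴ` (`i : Fin n` represents the index `i+1`). -/
noncomputable def lB {n : ℕ} (A : Matrix (Fin n) (Fin n) ℂ) : Fin n → ℝ :=
  fun i => (1 / 2) * ∑ j ∈ Finset.Iic i,
    Real.log (eigsDesc (Matrix.isHermitian_mul_conjTranspose_self A) j)

/-- The multiplicative Horn cone: triples `(r, s, t)` such that there exist
`A, C ∈ B` with `lB A = r`, `lB C = s`, `lB (A * C) = t`. -/
def HornConeB (n : ℕ) : Set ((Fin n → ℝ) × (Fin n → ℝ) × (Fin n → ℝ)) :=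
  {rst | ∃ A C : Matrix (Fin n) (Fin n) ℂ, A ∈ UpperTriPos n ∧ C ∈ UpperTriPos n ∧
    lB A = rst.1 ∧ lB C = rst.2.1 ∧ lB (A * C) = rst.2.2}


section Horn

open Matrix Filter Topology

/-- Square complex matrices. -/
abbrev HMat (n : ℕ) := Matrix (Fin n) (Fin n) ℂ

attribute [local instance] Matrix.linftyOpNormedRing Matrix.linftyOpNormedAlgebra

/-- Hermitian matrices with eigenvalues `α`. -/
def Orb {n : ℕ} (α : Fin n → ℝ) : Set (HMat n) :=
  {X | ∃ U ∈ Matrix.unitaryGroup (Fin n) ℂ, X = U * diagonal (fun i => (α i : ℂ)) * Uᴴ}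

theorem unit_mul {n : ℕ} {U : HMat n} (hU : U ∈ Matrix.unitaryGroup (Fin n) ℂ) :
    U * Uᴴ = 1 := Matrix.mem_unitaryGroup_iff.1 hU

theorem unit_mul' {n : ℕ} {U : HMat n} (hU : U ∈ Matrix.unitaryGroup (Fin n) ℂ) :
    Uᴴ * U = 1 := Matrix.mem_unitaryGroup_iff'.1 hU

theorem diag_herm {n : ℕ} (α : Fin n → ℝ) :
    (diagonal (fun i => (α i : ℂ)) : HMat n)ᴴ = diagonal (fun i => (α i : ℂ)) := by
  rw [diagonal_conjTranspose]; congr 1; ext i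
  exact Complex.conj_ofReal _

theorem orb_herm {n : ℕ} {α : Fin n → ℝ} {X : HMat n} (h : X ∈ Orb α) : X.IsHermitian := by
  obtain ⟨U, hU, rfl⟩ := h
  rw [Matrix.IsHermitian, conjTranspose_mul, conjTranspose_mul, diag_herm,
    conjTranspose_conjTranspose, Matrix.mul_assoc]

theorem orb_trace {n : ℕ} {α : Fin n → ℝ} {X : HMat n} (h : X ∈ Orb α) :
    X.trace = ((∑ i, α i : ℝ) : ℂ) := by
  obtain ⟨U, hU, rfl⟩ := h
  rw [trace_mul_comm, ← Matrix.mul_assoc, unit_mul' hU, Matrix.one_mul, trace_diagonal]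
  simp

theorem mem_orb_eigenvalues {n : ℕ} {A : HMat n} (hA : A.IsHermitian) :
    A ∈ Orb hA.eigenvalues := by
  refine ⟨hA.eigenvectorUnitary, hA.eigenvectorUnitary.2, ?_⟩
  have := hA.spectral_theorem
  rw [Unitary.conjStarAlgAut_apply] at this
  exact this

/-- conjugation by unitary -/
theorem orb_conj {n : ℕ} {α : Fin n → ℝ} {X U : HMat n} (h : X ∈ Orb α)
    (hU : U ∈ Matrix.unitaryGroup (Fin n) ℂ) : U * X * Uᴴ ∈ Orb α := by
  obtain ⟨V, hV, rfl⟩ := h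
  refine ⟨U * V, mul_mem hU hV, ?_⟩
  simp [conjTranspose_mul, Matrix.mul_assoc]

theorem orb_perm {n : ℕ} {α : Fin n → ℝ} (σ : Equiv.Perm (Fin n)) {X : HMat n} (h : X ∈ Orb α) :
    X ∈ Orb (α ∘ σ) := by
  obtain ⟨U, hU, rfl⟩ := h
  refine ⟨U.submatrix id σ, ?_, ?_⟩
  · rw [Matrix.mem_unitaryGroup_iff, star_eq_conjTranspose, conjTranspose_submatrix,
      submatrix_mul_equiv, unit_mul hU]; simp
  · have : (diagonal (fun i => (((α ∘ σ) i : ℝ) : ℂ)) : HMat n)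
      = (diagonal (fun i => (α i : ℂ)) : HMat n).submatrix σ σ := by
      ext i j; simp [diagonal_apply]
    rw [this, conjTranspose_submatrix, submatrix_mul_equiv, submatrix_mul_equiv]; simp

theorem eigsDesc_antitone {n : ℕ} {A : HMat n} (hA : A.IsHermitian) : Antitone (eigsDesc hA) := by
  intro i j hij
  exact Tuple.monotone_sort hA.eigenvalues (Fin.rev_le_rev.2 hij)

theorem mem_orb_eigsDesc {n : ℕ} {A : HMat n} (hA : A.IsHermitian) : A ∈ Orb (eigsDesc hA) :=
  orb_perm (Fin.revPerm.trans (Tuple.sort hA.eigenvalues)) (mem_orb_eigenvalues hA)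

theorem orb_charpoly {n : ℕ} {α : Fin n → ℝ} {X : HMat n} (h : X ∈ Orb α) :
    X.charpoly = (diagonal (fun i => (α i : ℂ)) : HMat n).charpoly := by
  obtain ⟨U, hU, rfl⟩ := h
  rw [charpoly_mul_comm, ← Matrix.mul_assoc, unit_mul' hU, Matrix.one_mul]

theorem eigsDesc_congr {n : ℕ} {A B : HMat n} (hA : A.IsHermitian) (hB : B.IsHermitian)
    (h : A.charpoly = B.charpoly) : eigsDesc hA = eigsDesc hB := by
  have := (hA.eigenvalues_eq_eigenvalues_iff hB).2 h
  unfold eigsDesc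
  rw [this]

theorem eq_of_antitone {n : ℕ} {a b : Fin n → ℝ} (ha : Antitone a) (hb : Antitone b)
    (h : (diagonal (fun i => (a i : ℂ)) : HMat n).charpoly
      = (diagonal (fun i => (b i : ℂ)) : HMat n).charpoly) : a = b := by
  have hr : ∀ c : Fin n → ℝ, (diagonal (fun i => (c i : ℂ)) : HMat n).charpoly.roots
      = (Multiset.map c Finset.univ.val).map Complex.ofReal := by
    intro c
    rw [charpoly_diagonal, Polynomial.roots_prod, Multiset.map_map]
    · simp [Function.comp_def]
    · simp [Finset.prod_ne_zero_iff, Polynomial.X_sub_C_ne_zero]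
  have h2 := hr a
  rw [h, hr b] at h2
  have h3 := Multiset.map_injective Complex.ofReal_injective h2
  rw [Fin.univ_val_map, Fin.univ_val_map, Multiset.coe_eq_coe] at h3
  have h4 := List.Perm.eq_of_sortedGE hb.sortedGE_ofFn ha.sortedGE_ofFn h3
  exact (List.ofFn_injective h4).symm

theorem eigsDesc_eq_of_mem_orb {n : ℕ} {A : HMat n} (hA : A.IsHermitian) {α : Fin n → ℝ}
    (hα : Antitone α) (h : A ∈ Orb α) : eigsDesc hA = α := by
  apply eq_of_antitone (eigsDesc_antitone hA) hα
  rw [← orb_charpoly (mem_orb_eigsDesc hA), orb_charpoly h]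

theorem exp_form {n : ℕ} {U : HMat n} (hU : U ∈ Matrix.unitaryGroup (Fin n) ℂ)
    (α : Fin n → ℝ) (t : ℝ) :
    NormedSpace.exp (t • (U * diagonal (fun i => (α i : ℂ)) * Uᴴ))
      = U * diagonal (fun i => ((Real.exp (t * α i) : ℝ) : ℂ)) * Uᴴ := by
  have hinv : U⁻¹ = Uᴴ := Matrix.inv_eq_right_inv (unit_mul hU)
  have hu : IsUnit U := by
    rw [Matrix.isUnit_iff_isUnit_det]
    exact Matrix.isUnit_det_of_right_inverse (unit_mul hU)
  have h1 : t • (U * diagonal (fun i => (α i : ℂ)) * Uᴴ)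
      = U * diagonal (fun i => ((t * α i : ℝ) : ℂ)) * U⁻¹ := by
    rw [hinv]
    have : (diagonal (fun i => ((t * α i : ℝ) : ℂ)) : HMat n)
        = t • diagonal (fun i => (α i : ℂ)) := by
      ext i j
      by_cases h : i = j
      · subst h; simp
      · simp [h]
    rw [this]; simp
  rw [h1, Matrix.exp_conj _ _ hu, Matrix.exp_diagonal, hinv]
  congr 3
  ext i
  rw [Pi.coe_exp, ← Complex.exp_eq_exp_ℂ]
  simp

theorem exp_mem_orb {n : ℕ} {α : Fin n → ℝ} {X : HMat n} (h : X ∈ Orb α) (t : ℝ) :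
    NormedSpace.exp (t • X) ∈ Orb (fun i => Real.exp (t * α i)) := by
  obtain ⟨U, hU, rfl⟩ := h
  exact ⟨U, hU, exp_form hU α t⟩

theorem det_exp_herm {n : ℕ} {X : HMat n} (h : X.IsHermitian) :
    (NormedSpace.exp X).det = Complex.exp X.trace := by
  have h1 := mem_orb_eigenvalues h
  have h2 := exp_mem_orb h1 1
  rw [one_smul] at h2
  rw [orb_trace h1]
  obtain ⟨U, hU, hE⟩ := h2
  have hd : U.det * (Uᴴ).det = 1 := by rw [← det_mul, unit_mul hU, det_one]
  rw [hE, det_mul, det_mul, mul_right_comm, hd, one_mul, det_diagonal]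
  push_cast
  rw [Complex.exp_sum]
  simp

theorem commute_conj {n : ℕ} {U Z : HMat n} (hU : U ∈ Matrix.unitaryGroup (Fin n) ℂ)
    (d g : Fin n → ℂ) (hdg : ∀ i j, d i = d j → g i = g j)
    (h : Commute Z (U * diagonal d * Uᴴ)) : Commute Z (U * diagonal g * Uᴴ) := by
  have key : ∀ f : Fin n → ℂ, Commute Z (U * diagonal f * Uᴴ) ↔
      Commute (Uᴴ * Z * U) (diagonal f) := by
    intro f
    have e1 : Uᴴ * (Z * (U * diagonal f * Uᴴ)) * U = (Uᴴ * Z * U) * diagonal f := by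
      calc _ = (Uᴴ * Z * U) * diagonal f * (Uᴴ * U) := by simp only [Matrix.mul_assoc]
        _ = _ := by rw [unit_mul' hU, Matrix.mul_one]
    have e2 : Uᴴ * ((U * diagonal f * Uᴴ) * Z) * U = diagonal f * (Uᴴ * Z * U) := by
      calc _ = (Uᴴ * U) * diagonal f * (Uᴴ * Z * U) := by simp only [Matrix.mul_assoc]
        _ = _ := by rw [unit_mul' hU, Matrix.one_mul]
    have e3 : ∀ A : HMat n, U * (Uᴴ * A * U) * Uᴴ = A := by
      intro A
      calc _ = (U * Uᴴ) * A * (U * Uᴴ) := by simp only [Matrix.mul_assoc]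
        _ = _ := by rw [unit_mul hU, Matrix.one_mul, Matrix.mul_one]
    constructor
    · intro hc
      have := hc.eq
      show _ * _ = _ * _
      rw [← e1, this, e2]
    · intro hc
      have := hc.eq
      rw [← e1, ← e2] at this
      show _ * _ = _ * _
      rw [← e3 (Z * _), this, e3]
  rw [key] at h ⊢
  have h1 := h.eq
  show _ * _ = _ * _
  ext i j
  have h2 := congrFun (congrFun h1 i) j
  rw [mul_diagonal, diagonal_mul] at h2 ⊢
  by_cases hij : d i = d j
  · rw [hdg i j hij, mul_comm]
  · have : (Uᴴ * Z * U) i j * (d j - d i) = 0 := by rw [mul_sub, h2]; ring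
    rcases mul_eq_zero.1 this with h0 | h0
    · rw [h0]; simp
    · exact absurd (sub_eq_zero.1 h0).symm hij

theorem commute_of_exp {n : ℕ} {X Z : HMat n} (hX : X.IsHermitian) {t : ℝ} (ht : t ≠ 0)
    (h : Commute Z (NormedSpace.exp (t • X))) : Commute Z X := by
  obtain ⟨U, hU, hE⟩ := mem_orb_eigenvalues hX
  rw [hE, exp_form hU] at h
  rw [hE]
  refine commute_conj hU _ _ ?_ h
  intro i j hij
  have := Real.exp_injective (Complex.ofReal_injective hij)
  rw [mul_left_cancel₀ ht this]

theorem proj_exp_aux {n : ℕ} {P A B : HMat n} (hB : Commute P B) (h : P * A = P * B) :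
    P * NormedSpace.exp A = P * NormedSpace.exp B := by
  have hpow : ∀ k : ℕ, P * A ^ k = P * B ^ k := by
    intro k
    induction k with
    | zero => simp
    | succ k ih =>
      calc P * A ^ (k+1) = P * A * A ^ k := by rw [pow_succ', Matrix.mul_assoc]
        _ = B * (P * A ^ k) := by rw [h, hB.eq, Matrix.mul_assoc]
        _ = P * B ^ (k+1) := by
          rw [ih, ← Matrix.mul_assoc, ← hB.eq, pow_succ', Matrix.mul_assoc]
  have h1 := (NormedSpace.exp_series_hasSum_exp' (𝕂 := ℝ) A).mul_left P
  have h2 := (NormedSpace.exp_series_hasSum_exp' (𝕂 := ℝ) B).mul_left P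
  have : (fun k : ℕ => P * ((k.factorial : ℝ)⁻¹ • A ^ k)) =
      fun k : ℕ => P * ((k.factorial : ℝ)⁻¹ • B ^ k) := by
    ext1 k
    rw [mul_smul_comm, mul_smul_comm, hpow]
  rw [this] at h1
  exact h1.unique h2

theorem det_proj_exp {n : ℕ} {P X : HMat n} (hP : P.IsHermitian) (hPP : P * P = P)
    (hX : X.IsHermitian) (hc : Commute P X) :
    (P * NormedSpace.exp X + (1 - P)).det = Complex.exp (P * X).trace := by
  have hPX : (P * X).IsHermitian := by
    rw [Matrix.IsHermitian, conjTranspose_mul, hP.eq, hX.eq, hc.eq]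
  rw [← det_exp_herm hPX]
  congr 1
  have h1 : P * NormedSpace.exp (P * X) = P * NormedSpace.exp X :=
    proj_exp_aux hc (by rw [← Matrix.mul_assoc, hPP])
  have h2 : (1 - P) * NormedSpace.exp (P * X) = (1 - P) * NormedSpace.exp 0 :=
    proj_exp_aux (Commute.zero_right _) (by
      rw [← Matrix.mul_assoc, Matrix.sub_mul, hPP]; simp)
  rw [NormedSpace.exp_zero, Matrix.mul_one] at h2
  rw [← h1, ← h2, ← Matrix.add_mul]; simp

open scoped ComplexOrder

/-- `exp (s X)` -/
noncomputable def Ee {n : ℕ} (s : ℝ) (X : HMat n) : HMat n := NormedSpace.exp (s • X)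

theorem Ee_zero {n : ℕ} (X : HMat n) : Ee 0 X = 1 := by
  simp [Ee, NormedSpace.exp_zero]

theorem Ee_mul {n : ℕ} (s r : ℝ) (X : HMat n) : Ee s X * Ee r X = Ee (s + r) X := by
  unfold Ee
  rw [add_smul, Matrix.exp_add_of_commute]
  exact ((Commute.refl X).smul_left s).smul_right r

theorem smul_herm {n : ℕ} {X : HMat n} (h : X.IsHermitian) (s : ℝ) : (s • X).IsHermitian := by
  rw [Matrix.IsHermitian, conjTranspose_smul, h.eq]; simp

theorem Ee_herm {n : ℕ} {X : HMat n} (h : X.IsHermitian) (s : ℝ) : (Ee s X).IsHermitian :=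
  (smul_herm h s).exp

theorem Ee_inv {n : ℕ} (s : ℝ) (X : HMat n) : Ee s X * Ee (-s) X = 1 := by
  rw [Ee_mul, add_neg_cancel, Ee_zero]

theorem Ee_inv' {n : ℕ} (s : ℝ) (X : HMat n) : Ee (-s) X * Ee s X = 1 := by
  rw [Ee_mul, neg_add_cancel, Ee_zero]

theorem Ee_unit {n : ℕ} (s : ℝ) (X : HMat n) : IsUnit (Ee s X) :=
  IsUnit.of_mul_eq_one _ (Ee_inv s X)

theorem Ee_det {n : ℕ} {X : HMat n} (h : X.IsHermitian) (s : ℝ) :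
    (Ee s X).det = Complex.exp (s * X.trace) := by
  unfold Ee
  rw [det_exp_herm (smul_herm h s), trace_smul]; simp

theorem posDef_of_unit {n : ℕ} {R : HMat n} (h : IsUnit R) : (R * Rᴴ).PosDef :=
  Matrix.PosDef.mul_conjTranspose_self _ (Matrix.vecMul_injective_of_isUnit h)

/-- The basic product. -/
noncomputable def Wf {n : ℕ} (t : ℝ) (X Y K : HMat n) : HMat n :=
  Ee (2 * t) X * Ee t Y * Ee (-(2 * t)) K * Ee t Y

/-- Real part of the trace. -/
noncomputable def reTr (n : ℕ) (A : HMat n) : ℝ := A.trace.re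

theorem reTr_apply {n : ℕ} (A : HMat n) : reTr n A = A.trace.re := rfl

theorem reTr_add {n : ℕ} (A B : HMat n) : reTr n (A + B) = reTr n A + reTr n B := by
  simp [reTr_apply]

theorem reTr_sub {n : ℕ} (A B : HMat n) : reTr n (A - B) = reTr n A - reTr n B := by
  simp [reTr_apply]

theorem reTr_neg {n : ℕ} (A : HMat n) : reTr n (-A) = - reTr n A := by
  simp [reTr_apply]

theorem reTr_smul {n : ℕ} (c : ℝ) (A : HMat n) : reTr n (c • A) = c * reTr n A := by
  simp [reTr_apply, trace_smul]

/-- Real part of the trace as a continuous linear map. -/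
noncomputable def reTrL (n : ℕ) : HMat n →L[ℝ] ℝ :=
  LinearMap.toContinuousLinearMap (Complex.reLm ∘ₗ traceLinearMap (Fin n) ℝ ℂ)

theorem reTr_continuous (n : ℕ) : Continuous (reTr n) := (reTrL n).continuous

theorem reTr_deriv {n : ℕ} {f : ℝ → HMat n} {f' : HMat n} {s : ℝ} (h : HasDerivAt f f' s) :
    HasDerivAt (fun s => reTr n (f s)) (reTr n f') s :=
  (reTrL n).hasFDerivAt.comp_hasDerivAt s h

theorem reTr_mul_comm {n : ℕ} (A B : HMat n) : reTr n (A * B) = reTr n (B * A) := by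
  rw [reTr_apply, reTr_apply, trace_mul_comm]

/-- The functional. -/
noncomputable def Gf {n : ℕ} (t : ℝ) (X Y K : HMat n) : ℝ := reTr n (Wf t X Y K)

/-- The square root of the product. -/
noncomputable def Rf {n : ℕ} (t : ℝ) (X Y K : HMat n) : HMat n :=
  Ee t X * Ee t Y * Ee (-t) K

theorem Rf_unit {n : ℕ} (t : ℝ) (X Y K : HMat n) : IsUnit (Rf t X Y K) :=
  ((Ee_unit _ _).mul (Ee_unit _ _)).mul (Ee_unit _ _)

theorem Wf_Rf {n : ℕ} (t : ℝ) {X Y K : HMat n} (hX : X.IsHermitian) (hY : Y.IsHermitian)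
    (hK : K.IsHermitian) :
    Wf t X Y K * Ee t X = Ee t X * (Rf t X Y K * (Rf t X Y K)ᴴ) := by
  unfold Wf Rf
  rw [conjTranspose_mul, conjTranspose_mul, (Ee_herm hX t).eq, (Ee_herm hY t).eq,
    (Ee_herm hK (-t)).eq, show -(2 * t) = -t + -t by ring, show 2 * t = t + t by ring,
    ← Ee_mul, ← Ee_mul]
  simp only [Matrix.mul_assoc]

theorem Wf_det {n : ℕ} (t : ℝ) {X Y K : HMat n} (hX : X.IsHermitian) (hY : Y.IsHermitian)
    (hK : K.IsHermitian) (htr : X.trace + Y.trace = K.trace) : (Wf t X Y K).det = 1 := by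
  unfold Wf
  rw [det_mul, det_mul, det_mul, Ee_det hX, Ee_det hY, Ee_det hK, ← Complex.exp_add,
    ← Complex.exp_add, ← Complex.exp_add, ← htr, ← Complex.exp_zero]
  congr 1
  push_cast
  ring

theorem sum_eigs_posDef {n : ℕ} {N : HMat n} (hN : N.PosDef) (hd : N.det = 1) :
    (n : ℝ) ≤ reTr n N ∧ (reTr n N = n → N = 1) := by
  have hpos := hN.eigenvalues_pos
  have htr : reTr n N = ∑ i, hN.1.eigenvalues i := by
    rw [reTr_apply, hN.1.trace_eq_sum_eigenvalues]; simp
  have hprod : ∏ i, hN.1.eigenvalues i = 1 := by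
    have := hN.1.det_eq_prod_eigenvalues
    rw [hd] at this
    apply Complex.ofReal_injective
    rw [Complex.ofReal_prod]
    exact this.symm
  have hlog : ∑ i, Real.log (hN.1.eigenvalues i) = 0 := by
    rw [← Real.log_prod (fun i _ => (hpos i).ne'), hprod, Real.log_one]
  have hsum : reTr n N - n = ∑ i, (hN.1.eigenvalues i - 1 - Real.log (hN.1.eigenvalues i)) := by
    rw [Finset.sum_sub_distrib, Finset.sum_sub_distrib, hlog, htr]; simp
  have hnn : ∀ i ∈ Finset.univ,
      0 ≤ hN.1.eigenvalues i - 1 - Real.log (hN.1.eigenvalues i) := fun i _ => by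
    linarith [Real.log_le_sub_one_of_pos (hpos i)]
  constructor
  · have := Finset.sum_nonneg hnn
    linarith
  · intro h
    rw [h, sub_self] at hsum
    have h0 := (Finset.sum_eq_zero_iff_of_nonneg hnn).1 hsum.symm
    have h1 : ∀ i, hN.1.eigenvalues i = 1 := by
      intro i
      by_contra hne
      have := Real.log_lt_sub_one_of_pos (hpos i) hne
      have := h0 i (Finset.mem_univ i)
      linarith
    obtain ⟨U, hU, hE⟩ := mem_orb_eigenvalues hN.1
    rw [hE]
    have : (diagonal (fun i => (hN.1.eigenvalues i : ℂ)) : HMat n) = 1 := by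
      simp [h1]
    rw [this, Matrix.mul_one, unit_mul hU]

theorem RR_det {n : ℕ} (t : ℝ) {X Y K : HMat n} (hX : X.IsHermitian) (hY : Y.IsHermitian)
    (hK : K.IsHermitian) (htr : X.trace + Y.trace = K.trace) :
    (Rf t X Y K * (Rf t X Y K)ᴴ).det = 1 := by
  have h := congrArg Matrix.det (Wf_Rf t hX hY hK)
  rw [det_mul, det_mul, Wf_det t hX hY hK htr, one_mul] at h
  have h0 : (Ee t X).det ≠ 0 := by
    have := (Matrix.isUnit_iff_isUnit_det _).1 (Ee_unit t X)
    exact this.ne_zero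
  have h2 : (Ee t X).det * 1 = (Ee t X).det * (Rf t X Y K * (Rf t X Y K)ᴴ).det := by
    rw [mul_one]; exact h
  exact (mul_left_cancel₀ h0 h2).symm

theorem Wf_eq {n : ℕ} (t : ℝ) {X Y K : HMat n} (hX : X.IsHermitian) (hY : Y.IsHermitian)
    (hK : K.IsHermitian) :
    Wf t X Y K = Ee t X * (Rf t X Y K * (Rf t X Y K)ᴴ) * Ee (-t) X := by
  rw [← Wf_Rf t hX hY hK, Matrix.mul_assoc, Ee_inv, Matrix.mul_one]

theorem Gf_RR {n : ℕ} (t : ℝ) {X Y K : HMat n} (hX : X.IsHermitian) (hY : Y.IsHermitian)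
    (hK : K.IsHermitian) :
    Gf t X Y K = reTr n (Rf t X Y K * (Rf t X Y K)ᴴ) := by
  rw [Gf, Wf_eq t hX hY hK, reTr_mul_comm, ← Matrix.mul_assoc, Ee_inv', Matrix.one_mul]

theorem Gf_ge {n : ℕ} (t : ℝ) {X Y K : HMat n} (hX : X.IsHermitian) (hY : Y.IsHermitian)
    (hK : K.IsHermitian) (htr : X.trace + Y.trace = K.trace) :
    (n : ℝ) ≤ Gf t X Y K ∧ (Gf t X Y K = n → Wf t X Y K = 1) := by
  have h := sum_eigs_posDef (posDef_of_unit (Rf_unit t X Y K)) (RR_det t hX hY hK htr)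
  rw [Gf_RR t hX hY hK]
  refine ⟨h.1, fun he => ?_⟩
  rw [Wf_eq t hX hY hK, h.2 he, Matrix.mul_one, Ee_inv]

theorem Ee_deriv {n : ℕ} (X : HMat n) (s : ℝ) :
    HasDerivAt (fun s : ℝ => Ee s X) (Ee s X * X) s :=
  hasDerivAt_exp_smul_const X s

theorem crit {n : ℕ} {A N : HMat n} (hA : A.IsHermitian) (hN : N.IsHermitian)
    (h : ∀ ξ : HMat n, ξᴴ = -ξ → ∀ s : ℝ,
      reTr n (A * N) ≤ reTr n (Ee s ξ * A * Ee (-s) ξ * N)) : Commute A N := by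
  set ξ := A * N - N * A with hξ
  have hsk : ξᴴ = -ξ := by
    rw [hξ, conjTranspose_sub, conjTranspose_mul, conjTranspose_mul, hA.eq, hN.eq]; abel
  have hneg : ∀ s : ℝ, Ee (-s) ξ = Ee s (-ξ) := by
    intro s; unfold Ee; simp
  have hd := reTr_deriv ((((Ee_deriv ξ 0).mul_const A).mul (Ee_deriv (-ξ) 0)).mul_const N)
  have hmin : IsLocalMin (fun s => reTr n (((fun y => Ee y ξ * A) * fun s => Ee s (-ξ)) s * N))
      (0:ℝ) := by
    refine Filter.Eventually.of_forall fun s => ?_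
    have := h ξ hsk s
    rw [hneg] at this
    simpa [Ee_zero] using this
  have h0 := hmin.hasDerivAt_eq_zero hd
  simp only [Ee_zero, Matrix.one_mul, Matrix.mul_one] at h0
  have h1 : reTr n (ξ * ξᴴ) = 0 := by
    rw [hsk, Matrix.mul_neg, reTr_neg, neg_eq_zero]
    have e : (ξ * A + A * -ξ) * N = ξ * (A * N) - A * ξ * N := by
      simp only [Matrix.add_mul, Matrix.mul_neg, Matrix.neg_mul, Matrix.mul_assoc]; abel
    rw [e, reTr_sub, reTr_mul_comm (A * ξ) N, ← Matrix.mul_assoc N A ξ, reTr_mul_comm (N * A) ξ,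
      ← reTr_sub, ← Matrix.mul_sub] at h0
    exact h0
  have h2 : (ξ * ξᴴ).trace = 0 := by
    have hps := (Matrix.posSemidef_self_mul_conjTranspose ξ).trace_nonneg
    rw [Complex.le_def] at hps
    apply Complex.ext
    · exact h1
    · exact hps.2.symm
  rw [Matrix.trace_mul_conjTranspose_self_eq_zero_iff] at h2
  exact sub_eq_zero.1 h2

open scoped ComplexOrder

theorem commute_all {n : ℕ} {t : ℝ} (ht : t ≠ 0) {X Y K : HMat n} (hX : X.IsHermitian)
    (hY : Y.IsHermitian) (hK : K.IsHermitian)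
    (h1 : Commute (Ee (2 * t) X) (Ee t Y * Ee (-(2 * t)) K * Ee t Y))
    (h2 : Commute (Ee (-(2 * t)) K) (Ee t Y * Ee (2 * t) X * Ee t Y)) :
    (Wf t X Y K).IsHermitian ∧ Commute (Wf t X Y K) X ∧ Commute (Wf t X Y K) Y ∧
    Commute (Wf t X Y K) K ∧
    Ee t Y * Ee (-(2 * t)) K * Ee t Y * Ee (2 * t) X = Wf t X Y K ∧
    Ee (-(2 * t)) K * Ee t Y * Ee (2 * t) X * Ee t Y = Wf t X Y K ∧
    Ee t Y * Ee (2 * t) X * Ee t Y * Ee (-(2 * t)) K = Wf t X Y K := by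
  have ha := (Ee_herm hX (2 * t)).eq
  have hb := (Ee_herm hY t).eq
  have hc := (Ee_herm hK (-(2 * t))).eq
  have hZ : Wf t X Y K = Ee (2 * t) X * Ee t Y * Ee (-(2 * t)) K * Ee t Y := rfl
  have hbb : Ee t Y * Ee t Y = NormedSpace.exp ((2 * t) • Y) := by
    rw [Ee_mul, ← two_mul]; rfl
  have hca : Commute (Wf t X Y K) (Ee (2 * t) X) → Commute (Wf t X Y K) X := by
    intro h
    exact commute_of_exp hX (by simpa using ht) h
  have hcc : Commute (Wf t X Y K) (Ee (-(2 * t)) K) → Commute (Wf t X Y K) K := by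
    intro h
    exact commute_of_exp hK (by simpa using ht) h
  have hcb : Commute (Wf t X Y K) (Ee t Y * Ee t Y) → Commute (Wf t X Y K) Y := by
    intro h
    rw [hbb] at h
    exact commute_of_exp hY (by simpa using ht) h
  have hYb : Commute (Wf t X Y K) Y → Commute (Wf t X Y K) (Ee t Y) := by
    intro h
    exact (h.smul_right t).exp_right
  have hbu := Ee_inv t Y
  generalize Wf t X Y K = Z at *
  generalize Ee (2 * t) X = a at *
  generalize Ee (-(2 * t)) K = c at *
  generalize Ee t Y = b at *
  have hZa : b * c * b * a = Z := by
    rw [hZ, ← h1.eq]; simp only [Matrix.mul_assoc]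
  have hZH : Zᴴ = Z := by
    rw [← hZa, conjTranspose_mul, conjTranspose_mul, conjTranspose_mul, ha, hb, hc, hZa, hZ]
    simp only [Matrix.mul_assoc]
  have hZ' : (b * a * b * c)ᴴ = b * a * b * c := by
    rw [← h2.eq]
    simp only [conjTranspose_mul, ha, hb, hc]
    rw [h2.eq]; simp only [Matrix.mul_assoc]
  have e1 : b * a * b * c * b = b * Z := by rw [hZ]; simp only [Matrix.mul_assoc]
  have e2 : b * (b * a * b * c) = Z * b := by
    have := congrArg conjTranspose e1
    rw [conjTranspose_mul (b * a * b * c) b, conjTranspose_mul b Z, hZ', hb, hZH] at this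
    exact this
  have hbb2 : Commute Z (b * b) := by
    show Z * (b * b) = b * b * Z
    rw [← Matrix.mul_assoc, ← e2, Matrix.mul_assoc b b, ← e1]
    simp only [Matrix.mul_assoc]
  have hZY := hcb hbb2
  have hZb := hYb hZY
  have e3 : b * a * b * c = Z := by
    have : b * a * b * c * b = Z * b := by rw [e1, hZb.eq]
    calc b * a * b * c = b * a * b * c * (b * Ee (-t) Y) := by rw [hbu, Matrix.mul_one]
      _ = (b * a * b * c * b) * Ee (-t) Y := by simp only [Matrix.mul_assoc]
      _ = Z := by rw [this, Matrix.mul_assoc, hbu, Matrix.mul_one]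
  have e4 : c * b * a * b = Z := by
    rw [← e3, ← h2.eq]; simp only [Matrix.mul_assoc]
  refine ⟨hZH, hca ?_, hZY, hcc ?_, hZa, e4, e3⟩
  · show Z * a = a * Z
    conv_rhs => rw [← hZa]
    rw [hZ]; simp only [Matrix.mul_assoc]
  · show Z * c = c * Z
    conv_rhs => rw [← e3]
    rw [← e4]; simp only [Matrix.mul_assoc]

theorem Wf_deriv {n : ℕ} (t : ℝ) (X Y K : HMat n) :
    HasDerivAt (fun t => Wf t X Y K)
      (((Ee (2 * t) X * ((2:ℝ) • X) * Ee t Y + Ee (2 * t) X * (Ee t Y * Y)) * Ee (-(2 * t)) K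
        + Ee (2 * t) X * Ee t Y * (Ee (-(2 * t)) K * ((-2:ℝ) • K))) * Ee t Y
        + Ee (2 * t) X * Ee t Y * Ee (-(2 * t)) K * (Ee t Y * Y)) t := by
  have e1 : ∀ t, Ee (2 * t) X = Ee t ((2:ℝ) • X) := by
    intro t; unfold Ee; rw [smul_smul, mul_comm]
  have e2 : ∀ t, Ee (-(2 * t)) K = Ee t ((-2:ℝ) • K) := by
    intro t; unfold Ee; rw [smul_smul]; congr 2; ring
  unfold Wf
  simp only [e1, e2]
  exact ((((Ee_deriv _ t).mul (Ee_deriv _ t)).mul (Ee_deriv _ t)).mul (Ee_deriv _ t))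

theorem Gf_deriv_crit {n : ℕ} {t : ℝ} (ht : t ≠ 0) {X Y K : HMat n} (hX : X.IsHermitian)
    (hY : Y.IsHermitian) (hK : K.IsHermitian)
    (h1 : Commute (Ee (2 * t) X) (Ee t Y * Ee (-(2 * t)) K * Ee t Y))
    (h2 : Commute (Ee (-(2 * t)) K) (Ee t Y * Ee (2 * t) X * Ee t Y)) :
    HasDerivAt (fun t => Gf t X Y K) (2 * reTr n ((X + Y - K) * Wf t X Y K)) t := by
  obtain ⟨-, -, -, -, ea, ec, eb⟩ := commute_all ht hX hY hK h1 h2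
  have hd := reTr_deriv (Wf_deriv t X Y K)
  refine HasDerivAt.congr_deriv (f := fun t => Gf t X Y K) hd ?_
  simp only [Matrix.add_mul, reTr_add]
  have hZ : Wf t X Y K = Ee (2 * t) X * Ee t Y * Ee (-(2 * t)) K * Ee t Y := rfl
  have r1 : reTr n (Ee (2 * t) X * ((2:ℝ) • X) * Ee t Y * Ee (-(2 * t)) K * Ee t Y)
      = 2 * reTr n (X * Wf t X Y K) := by
    rw [← reTr_smul, ← ea]
    simp only [Matrix.mul_assoc, Matrix.mul_smul, Matrix.smul_mul]
    rw [reTr_smul, reTr_smul, reTr_mul_comm]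
    simp only [Matrix.mul_assoc]
  have r2 : reTr n (Ee (2 * t) X * (Ee t Y * Y) * Ee (-(2 * t)) K * Ee t Y)
      = reTr n (Y * Wf t X Y K) := by
    rw [← ec, show Ee (2 * t) X * (Ee t Y * Y) * Ee (-(2 * t)) K * Ee t Y
      = (Ee (2 * t) X * Ee t Y) * (Y * Ee (-(2 * t)) K * Ee t Y) by
        simp only [Matrix.mul_assoc], reTr_mul_comm]
    simp only [Matrix.mul_assoc]
  have r3 : reTr n (Ee (2 * t) X * Ee t Y * (Ee (-(2 * t)) K * ((-2:ℝ) • K)) * Ee t Y)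
      = -2 * reTr n (K * Wf t X Y K) := by
    rw [← eb, show Ee (2 * t) X * Ee t Y * (Ee (-(2 * t)) K * ((-2:ℝ) • K)) * Ee t Y
      = (Ee (2 * t) X * Ee t Y * Ee (-(2 * t)) K) * (((-2:ℝ) • K) * Ee t Y) by
        simp only [Matrix.mul_assoc], reTr_mul_comm]
    rw [← reTr_smul]
    simp only [Matrix.mul_assoc, Matrix.smul_mul]
  have r4 : reTr n (Ee (2 * t) X * Ee t Y * Ee (-(2 * t)) K * (Ee t Y * Y))
      = reTr n (Y * Wf t X Y K) := by
    rw [← Matrix.mul_assoc, ← hZ, reTr_mul_comm]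
  rw [r1, r2, r3, r4, Matrix.sub_mul, Matrix.add_mul, reTr_sub, reTr_add]
  ring

theorem proj_mul {n : ℕ} {P A B : HMat n} (hPP : P * P = P) (hA : Commute P A) :
    (P * A + (1 - P)) * (P * B + (1 - P)) = P * (A * B) + (1 - P) := by
  have h1 : P * A * (P * B) = P * (A * B) := by
    rw [hA.eq, Matrix.mul_assoc, ← Matrix.mul_assoc P P, hPP, ← Matrix.mul_assoc, ← hA.eq,
      Matrix.mul_assoc]
  have h2 : P * A * (1 - P) = 0 := by
    rw [hA.eq, Matrix.mul_assoc, Matrix.mul_sub, hPP]; simp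
  have h3 : (1 - P) * (P * B) = 0 := by
    rw [← Matrix.mul_assoc, Matrix.sub_mul, hPP]; simp
  have h4 : (1 - P) * (1 - P) = 1 - P := by
    rw [Matrix.mul_sub, Matrix.mul_one, Matrix.sub_mul, hPP]; simp
  rw [Matrix.add_mul, Matrix.mul_add, Matrix.mul_add, h1, h2, h3, h4]; simp

theorem block {n : ℕ} {t : ℝ} {X Y K V : HMat n} (hX : X.IsHermitian)
    (hY : Y.IsHermitian) (hK : K.IsHermitian) (hV : V ∈ Matrix.unitaryGroup (Fin n) ℂ)
    {z : Fin n → ℝ} (hz : ∀ i, 0 < z i)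
    (hZ : Wf t X Y K = V * diagonal (fun i => (z i : ℂ)) * Vᴴ)
    (cX : Commute (Wf t X Y K) X) (cY : Commute (Wf t X Y K) Y) (cK : Commute (Wf t X Y K) K)
    (z0 : ℝ) :
    ∑ i with z i = z0, 2 * t * ((Vᴴ * (X + Y - K) * V) i i).re
      = ∑ i with z i = z0, Real.log (z i) := by
  classical
  set g : Fin n → ℂ := fun i => if z i = z0 then 1 else 0 with hg
  set P : HMat n := V * diagonal g * Vᴴ with hP
  have hdg : ∀ i j, (z i : ℂ) = (z j : ℂ) → g i = g j := by
    intro i j hij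
    have : z i = z j := Complex.ofReal_injective hij
    simp [hg, this]
  have hPX : Commute P X := (commute_conj hV _ g hdg (hZ ▸ cX.symm)).symm
  have hPY : Commute P Y := (commute_conj hV _ g hdg (hZ ▸ cY.symm)).symm
  have hPK : Commute P K := (commute_conj hV _ g hdg (hZ ▸ cK.symm)).symm
  have hPH : P.IsHermitian := by
    have : g = fun i => (((if z i = z0 then 1 else 0 : ℝ)) : ℂ) := by
      ext i; simp only [hg]; split_ifs <;> simp
    exact orb_herm ⟨V, hV, by rw [hP, this]⟩
  have hmm : ∀ d e : Fin n → ℂ, (V * diagonal d * Vᴴ) * (V * diagonal e * Vᴴ)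
      = V * diagonal (fun i => d i * e i) * Vᴴ := by
    intro d e
    calc _ = V * diagonal d * (Vᴴ * V) * diagonal e * Vᴴ := by simp only [Matrix.mul_assoc]
      _ = V * (diagonal d * diagonal e) * Vᴴ := by
        rw [unit_mul' hV, Matrix.mul_one]; simp only [Matrix.mul_assoc]
      _ = _ := by rw [diagonal_mul_diagonal]
  have hPP : P * P = P := by
    rw [hP, hmm]
    congr 3
    ext i; simp [hg]
  have hdet : ∀ (s : ℝ) {A : HMat n}, A.IsHermitian → Commute P A →
      (P * Ee s A + (1 - P)).det = Complex.exp (s * (P * A).trace) := by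
    intro s A hA hPA
    unfold Ee
    rw [det_proj_exp hPH hPP (smul_herm hA s) (hPA.smul_right s), Matrix.mul_smul, trace_smul]
    simp
  have hPE : ∀ (s : ℝ) {A : HMat n}, Commute P A → Commute P (Ee s A) := fun s A h =>
    (h.smul_right s).exp_right
  have hD1 : (P * Wf t X Y K + (1 - P)).det
      = Complex.exp (2 * t * (P * (X + Y - K)).trace) := by
    unfold Wf
    rw [← proj_mul hPP (((hPE _ hPX).mul_right (hPE _ hPY)).mul_right (hPE _ hPK)),
      ← proj_mul hPP ((hPE _ hPX).mul_right (hPE _ hPY)), ← proj_mul hPP (hPE _ hPX),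
      det_mul, det_mul, det_mul, hdet _ hX hPX, hdet _ hY hPY, hdet _ hK hPK,
      ← Complex.exp_add, ← Complex.exp_add, ← Complex.exp_add]
    congr 1
    rw [Matrix.mul_sub, Matrix.mul_add, trace_sub, trace_add]
    push_cast
    ring
  have hD2 : (P * Wf t X Y K + (1 - P)).det
      = ((∏ i with z i = z0, z i : ℝ) : ℂ) := by
    have e1 : P * Wf t X Y K + (1 - P)
        = V * diagonal (fun i => if z i = z0 then (z i : ℂ) else 1) * Vᴴ := by
      have e2 : (1 : HMat n) = V * diagonal (fun _ => 1) * Vᴴ := by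
        rw [diagonal_one, Matrix.mul_one, unit_mul hV]
      rw [hZ, hP, hmm]
      conv_lhs => rw [e2]
      rw [← Matrix.sub_mul, ← Matrix.add_mul, ← Matrix.mul_sub, ← Matrix.mul_add, diagonal_sub,
        diagonal_add]
      congr 3
      ext i
      simp only [hg]
      split_ifs <;> simp
    have hd : V.det * (Vᴴ).det = 1 := by rw [← det_mul, unit_mul hV, det_one]
    rw [e1, det_mul, det_mul, mul_right_comm, hd, one_mul, det_diagonal, Finset.prod_filter]
    push_cast
    apply Finset.prod_congr rfl
    intro i _
    split_ifs <;> simp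
  have htr : (P * (X + Y - K)).trace.re
      = ∑ i with z i = z0, ((Vᴴ * (X + Y - K) * V) i i).re := by
    rw [hP, Matrix.mul_assoc, Matrix.mul_assoc, trace_mul_comm, Matrix.mul_assoc]
    rw [Finset.sum_filter]
    simp only [Matrix.trace, Complex.re_sum, diag_apply, diagonal_mul]
    apply Finset.sum_congr rfl
    intro i _
    simp only [hg]
    split_ifs <;> simp
  have hfin := congrArg norm (hD1.symm.trans hD2)
  rw [Complex.norm_exp, Complex.norm_real, Real.norm_eq_abs,
    abs_of_pos (Finset.prod_pos fun i _ => hz i)] at hfin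
  have hre : (2 * t * (P * (X + Y - K)).trace : ℂ).re = 2 * t * (P * (X + Y - K)).trace.re := by
    rw [show (2 * t : ℂ) = ((2 * t : ℝ) : ℂ) by push_cast; ring, Complex.re_ofReal_mul]
  rw [← Finset.mul_sum, ← htr, ← hre, ← Real.log_exp (Complex.re _), hfin,
    Real.log_prod (fun i _ => (hz i).ne')]

theorem real_ineq {w M : ℝ} (hM : 0 ≤ M) (hw : w ≤ M) :
    w * (Real.exp w - 1) ≤ (2 + M) * (Real.exp w - 1 - w) := by
  have hnn : 0 ≤ Real.exp w - 1 - w := by linarith [Real.add_one_le_exp w]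
  rcases le_total 0 w with h | h
  · have := Real.quadratic_le_exp_of_nonneg h
    nlinarith
  · have key : w * (Real.exp w - 1) ≤ 2 * (Real.exp w - 1 - w) := by
      have hd : ∀ x : ℝ, HasDerivAt (fun x : ℝ => (2 - x) * Real.exp x - 2 - x)
          (((-1) * Real.exp x + (2 - x) * Real.exp x) - 1) x := by
        intro x
        have := (((hasDerivAt_id x).const_sub 2).mul (Real.hasDerivAt_exp x)).sub_const 2
        exact this.sub (hasDerivAt_id x)
      have hanti : Antitone (fun x : ℝ => (2 - x) * Real.exp x - 2 - x) := by
        apply antitone_of_hasDerivAt_nonpos hd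
        intro x
        show ((-1) * Real.exp x + (2 - x) * Real.exp x) - 1 ≤ 0
        have h1 := Real.add_one_le_exp (-x)
        have h2 : Real.exp (-x) * Real.exp x = 1 := by rw [← Real.exp_add]; simp
        have h3 := Real.exp_pos x
        nlinarith
      have := hanti h
      simp at this
      nlinarith
    nlinarith

theorem crit_main {n : ℕ} {t : ℝ} (ht : 0 < t) {X Y K : HMat n} (hX : X.IsHermitian)
    (hY : Y.IsHermitian) (hK : K.IsHermitian) (htr : X.trace + Y.trace = K.trace)
    {m : ℝ} (hm0 : 0 ≤ m)
    (hm : ∀ V ∈ Matrix.unitaryGroup (Fin n) ℂ, ∀ i, ((Vᴴ * (X + Y - K) * V) i i).re ≤ m)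
    (h1 : Commute (Ee (2 * t) X) (Ee t Y * Ee (-(2 * t)) K * Ee t Y))
    (h2 : Commute (Ee (-(2 * t)) K) (Ee t Y * Ee (2 * t) X * Ee t Y)) :
    ∃ d, HasDerivAt (fun t => Gf t X Y K) d t ∧ 0 ≤ d ∧
      t * d ≤ (2 + 2 * t * m) * (Gf t X Y K - n) := by
  have hd := Gf_deriv_crit ht.ne' hX hY hK h1 h2
  refine ⟨_, hd, ?_⟩
  obtain ⟨hH, cX, cY, cK, -, -, -⟩ := commute_all ht.ne' hX hY hK h1 h2
  have hWR : Wf t X Y K = Rf t X Y K * (Rf t X Y K)ᴴ := by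
    have c1 : Commute (Wf t X Y K) (Ee t X) := (cX.smul_right t).exp_right
    have := Wf_Rf t hX hY hK
    rw [c1.eq] at this
    exact (Ee_unit t X).mul_left_cancel this
  have hpd : (Wf t X Y K).PosDef := by
    rw [hWR]; exact posDef_of_unit (Rf_unit t X Y K)
  have hz := hpd.eigenvalues_pos
  obtain ⟨V, hV, hVZ⟩ := mem_orb_eigenvalues hpd.1
  set z := hpd.1.eigenvalues with hzdef
  have hb := block hX hY hK hV hz hVZ cX cY cK
  set l : Fin n → ℝ := fun i => ((Vᴴ * (X + Y - K) * V) i i).re with hl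
  have hG : Gf t X Y K = ∑ i, z i := by
    rw [Gf, reTr_apply, hpd.1.trace_eq_sum_eigenvalues]; simp [hzdef]
  have hlog0 : ∑ i, Real.log (z i) = 0 := by
    rw [← Real.log_prod (fun i _ => (hz i).ne')]
    have h3 : ∏ i, z i = 1 := by
      apply Complex.ofReal_injective
      rw [Complex.ofReal_prod]
      exact hpd.1.det_eq_prod_eigenvalues.symm.trans (Wf_det t hX hY hK htr)
    rw [h3, Real.log_one]
  have hlogm : ∀ i, Real.log (z i) ≤ 2 * t * m := by
    intro i
    have h3 := hb (z i)
    have h4 : ∑ j with z j = z i, Real.log (z j) = ∑ j with z j = z i, Real.log (z i) := by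
      apply Finset.sum_congr rfl
      intro j hj
      rw [(Finset.mem_filter.1 hj).2]
    have h5 : ∑ j with z j = z i, 2 * t * ((Vᴴ * (X + Y - K) * V) j j).re
        ≤ ∑ j with z j = z i, 2 * t * m := by
      apply Finset.sum_le_sum
      intro j _
      exact mul_le_mul_of_nonneg_left (hm V hV j) (by positivity)
    rw [h3, h4, Finset.sum_const, Finset.sum_const, nsmul_eq_mul, nsmul_eq_mul] at h5
    have h6 : (0:ℝ) < ((Finset.univ.filter (fun j => z j = z i)).card : ℝ) := by
      exact_mod_cast Finset.card_pos.2 ⟨i, by simp⟩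
    exact le_of_mul_le_mul_left h5 h6
  have hsum : t * (2 * reTr n ((X + Y - K) * Wf t X Y K)) = ∑ i, z i * Real.log (z i) := by
    have h3 : reTr n ((X + Y - K) * Wf t X Y K) = ∑ i, l i * z i := by
      rw [hVZ, ← Matrix.mul_assoc, reTr_mul_comm, reTr_apply, ← Matrix.mul_assoc,
        ← Matrix.mul_assoc]
      simp only [Matrix.trace, Complex.re_sum, diag_apply, mul_diagonal, hl, Complex.re_mul_ofReal]
    have h4 : t * (2 * reTr n ((X + Y - K) * Wf t X Y K)) = ∑ i, z i * (2 * t * l i) := by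
      rw [h3, Finset.mul_sum, Finset.mul_sum]
      apply Finset.sum_congr rfl
      intro i _
      ring
    rw [h4]
    rw [← Finset.sum_fiberwise_of_maps_to (g := z) (t := Finset.univ.image z)
      (fun i _ => Finset.mem_image_of_mem _ (Finset.mem_univ i)),
      ← Finset.sum_fiberwise_of_maps_to (g := z) (t := Finset.univ.image z)
      (f := fun i => z i * Real.log (z i))
      (fun i _ => Finset.mem_image_of_mem _ (Finset.mem_univ i))]
    apply Finset.sum_congr rfl
    intro z0 _
    have h5 : ∀ f : Fin n → ℝ, ∑ i with z i = z0, z i * f i = z0 * ∑ i with z i = z0, f i := by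
      intro f
      rw [Finset.mul_sum]
      apply Finset.sum_congr rfl
      intro j hj
      rw [(Finset.mem_filter.1 hj).2]
    rw [h5, h5, hb z0]
  have hsum2 : ∑ i, z i * Real.log (z i)
      = ∑ i, Real.log (z i) * (Real.exp (Real.log (z i)) - 1) := by
    have : ∀ i, Real.log (z i) * (Real.exp (Real.log (z i)) - 1)
        = z i * Real.log (z i) - Real.log (z i) := by
      intro i; rw [Real.exp_log (hz i)]; ring
    simp only [this]
    rw [Finset.sum_sub_distrib, hlog0, sub_zero]
  have hsum3 : Gf t X Y K - n
      = ∑ i, (Real.exp (Real.log (z i)) - 1 - Real.log (z i)) := by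
    have : ∀ i, Real.exp (Real.log (z i)) = z i := fun i => Real.exp_log (hz i)
    simp only [this]
    rw [Finset.sum_sub_distrib, Finset.sum_sub_distrib, hlog0, hG]; simp
  have hpos : 0 ≤ t * (2 * reTr n ((X + Y - K) * Wf t X Y K)) := by
    rw [hsum, hsum2]
    apply Finset.sum_nonneg
    intro i _
    rcases le_total 0 (Real.log (z i)) with h | h
    · exact mul_nonneg h (by linarith [Real.one_le_exp h])
    · exact mul_nonneg_of_nonpos_of_nonpos h (by linarith [Real.exp_le_one_iff.2 h])
  refine ⟨nonneg_of_mul_nonneg_right hpos ht, ?_⟩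
  rw [hsum, hsum2, hsum3, Finset.mul_sum]
  apply Finset.sum_le_sum
  intro i _
  exact real_ineq (by positivity) (hlogm i)

open scoped ComplexOrder

theorem compact_unitary (n : ℕ) : IsCompact {U : HMat n | U ∈ Matrix.unitaryGroup (Fin n) ℂ} := by
  have h1 : IsCompact (Set.pi Set.univ (fun _ : Fin n => Set.pi Set.univ
      (fun _ : Fin n => Metric.closedBall (0:ℂ) 1))) :=
    isCompact_univ_pi fun _ => isCompact_univ_pi fun _ => isCompact_closedBall _ _
  refine IsCompact.of_isClosed_subset h1 ?_ ?_
  · have : {U : HMat n | U ∈ Matrix.unitaryGroup (Fin n) ℂ} = {U : HMat n | U * Uᴴ = 1} := by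
      ext U; exact Matrix.mem_unitaryGroup_iff
    rw [this]
    apply isClosed_eq _ continuous_const
    exact Continuous.matrix_mul continuous_id continuous_id.matrix_conjTranspose
  · intro U hU i _ j _
    rw [mem_closedBall_zero_iff]
    exact entry_norm_bound_of_unitary hU i j

theorem compact_orb {n : ℕ} (α : Fin n → ℝ) : IsCompact (Orb α) := by
  have : Orb α = (fun U : HMat n => U * diagonal (fun i => (α i : ℂ)) * Uᴴ) ''
      {U : HMat n | U ∈ Matrix.unitaryGroup (Fin n) ℂ} := by
    ext X
    constructor
    · rintro ⟨U, hU, rfl⟩; exact ⟨U, hU, rfl⟩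
    · rintro ⟨U, hU, rfl⟩; exact ⟨U, hU, rfl⟩
  rw [this]
  apply (compact_unitary n).image
  exact (continuous_id.matrix_mul continuous_const).matrix_mul continuous_id.matrix_conjTranspose

/-- The product of three orbits. -/
def OrbS {n : ℕ} (α β γ : Fin n → ℝ) : Set (HMat n × HMat n × HMat n) :=
  Orb α ×ˢ (Orb β ×ˢ Orb γ)

theorem compact_orbS {n : ℕ} (α β γ : Fin n → ℝ) : IsCompact (OrbS α β γ) :=
  (compact_orb α).prod ((compact_orb β).prod (compact_orb γ))

theorem orb_nonempty {n : ℕ} (α : Fin n → ℝ) : (Orb α).Nonempty :=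
  ⟨_, 1, one_mem _, rfl⟩

theorem orbS_nonempty {n : ℕ} (α β γ : Fin n → ℝ) : (OrbS α β γ).Nonempty :=
  (orb_nonempty α).prod ((orb_nonempty β).prod (orb_nonempty γ))

theorem exists_m {n : ℕ} (α β γ : Fin n → ℝ) : ∃ m : ℝ, 0 ≤ m ∧ ∀ x ∈ OrbS α β γ,
    ∀ V ∈ Matrix.unitaryGroup (Fin n) ℂ, ∀ i, ((Vᴴ * (x.1 + x.2.1 - x.2.2) * V) i i).re ≤ m := by
  have hc := (compact_orbS α β γ).prod (compact_unitary n)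
  have hb : ∀ i : Fin n, ∃ m : ℝ, ∀ x ∈ OrbS α β γ ×ˢ
      {U : HMat n | U ∈ Matrix.unitaryGroup (Fin n) ℂ},
      ((x.2ᴴ * (x.1.1 + x.1.2.1 - x.1.2.2) * x.2) i i).re ≤ m := by
    intro i
    have hcont : Continuous (fun x : (HMat n × HMat n × HMat n) × HMat n =>
        ((x.2ᴴ * (x.1.1 + x.1.2.1 - x.1.2.2) * x.2) i i).re) := by
      apply Complex.continuous_re.comp
      apply Continuous.matrix_elem
      apply Continuous.matrix_mul _ continuous_snd
      apply Continuous.matrix_mul continuous_snd.matrix_conjTranspose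
      fun_prop
    obtain ⟨m, hm⟩ := (hc.image hcont).bddAbove
    exact ⟨m, fun x hx => hm ⟨x, hx, rfl⟩⟩
  choose m hm using hb
  refine ⟨∑ i, |m i|, Finset.sum_nonneg fun i _ => abs_nonneg _, ?_⟩
  intro x hx V hV i
  calc _ ≤ m i := hm i (x, V) ⟨hx, hV⟩
    _ ≤ |m i| := le_abs_self _
    _ ≤ _ := Finset.single_le_sum (f := fun i => |m i|) (fun i _ => abs_nonneg _)
      (Finset.mem_univ i)

theorem fence {F : ℝ → ℝ} {a b : ℝ} (hab : a ≤ b) (hc : ContinuousOn F (Set.Icc a b))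
    (h : ∀ t0 ∈ Set.Ico a b, ∃ (g : ℝ → ℝ) (d : ℝ), HasDerivAt g d t0 ∧ d ≤ 0 ∧ g t0 = F t0 ∧
      ∀ t ∈ Set.Ioc t0 b, F t ≤ g t) : F b ≤ F a := by
  refine image_le_of_liminf_slope_right_le_deriv_boundary hc (B := fun _ => F a) (B' := fun _ => 0)
    le_rfl continuousOn_const (fun x _ => hasDerivWithinAt_const _ _ _) ?_
    (Set.right_mem_Icc.2 hab)
  intro x hx r hr
  obtain ⟨g, d, hg, hd, hgx, hle⟩ := h x hx
  apply Eventually.frequently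
  have h1 : ∀ᶠ z in 𝓝[>] x, slope g x z < r := by
    have h2 := (hasDerivAt_iff_tendsto_slope.1 hg).mono_left
      (nhdsWithin_mono x (fun y (hy : x < y) => hy.ne'))
    exact h2.eventually (gt_mem_nhds (lt_of_le_of_lt hd hr))
  filter_upwards [h1, Ioc_mem_nhdsGT hx.2] with z hz hz2
  refine lt_of_le_of_lt ?_ hz
  rw [slope_def_field, slope_def_field, hgx]
  apply div_le_div_of_nonneg_right _ (by linarith [hz2.1])
  linarith [hle z hz2]

theorem exp_cont (n : ℕ) : Continuous (NormedSpace.exp : HMat n → HMat n) := by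
  letI : NormedAlgebra ℚ (HMat n) := NormedAlgebra.restrictScalars ℚ ℝ (HMat n)
  exact NormedSpace.exp_continuous

theorem Ee_cont {n : ℕ} {E : Type*} [TopologicalSpace E] {f : E → ℝ} {g : E → HMat n}
    (hf : Continuous f) (hg : Continuous g) : Continuous (fun x => Ee (f x) (g x)) :=
  (exp_cont n).comp (hf.smul hg)

theorem Gf_cont (n : ℕ) :
    Continuous (fun p : ℝ × (HMat n × HMat n × HMat n) => Gf p.1 p.2.1 p.2.2.1 p.2.2.2) := by
  apply (reTr_continuous n).comp
  unfold Wf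
  refine ((Continuous.matrix_mul (Ee_cont ?_ ?_) (Ee_cont ?_ ?_)).matrix_mul
    (Ee_cont ?_ ?_)).matrix_mul (Ee_cont ?_ ?_) <;> fun_prop

/-- The minimum. -/
noncomputable def Fm {n : ℕ} (α β γ : Fin n → ℝ) (t : ℝ) : ℝ :=
  sInf ((fun x : HMat n × HMat n × HMat n => Gf t x.1 x.2.1 x.2.2) '' OrbS α β γ)

theorem Fm_cont {n : ℕ} (α β γ : Fin n → ℝ) : Continuous (Fm α β γ) :=
  IsCompact.continuous_sInf (f := fun t (x : HMat n × HMat n × HMat n) => Gf t x.1 x.2.1 x.2.2)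
    (compact_orbS α β γ) (Gf_cont n)

theorem Fm_min {n : ℕ} (α β γ : Fin n → ℝ) (t : ℝ) : ∃ x ∈ OrbS α β γ,
    Fm α β γ t = Gf t x.1 x.2.1 x.2.2 ∧
      ∀ y ∈ OrbS α β γ, Gf t x.1 x.2.1 x.2.2 ≤ Gf t y.1 y.2.1 y.2.2 := by
  have := IsCompact.exists_sInf_image_eq_and_le (compact_orbS α β γ) (orbS_nonempty α β γ)
    (f := fun x : HMat n × HMat n × HMat n => Gf t x.1 x.2.1 x.2.2)
    ((Gf_cont n).comp (by fun_prop : Continuous fun x : HMat n × HMat n × HMat n =>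
      (t, x))).continuousOn
  exact this

theorem Fm_le {n : ℕ} {α β γ : Fin n → ℝ} (t : ℝ) {y : HMat n × HMat n × HMat n}
    (hy : y ∈ OrbS α β γ) : Fm α β γ t ≤ Gf t y.1 y.2.1 y.2.2 := by
  obtain ⟨x, -, h1, h2⟩ := Fm_min α β γ t
  rw [h1]; exact h2 y hy

theorem skew_Ee {n : ℕ} {ξ : HMat n} (h : ξᴴ = -ξ) (s : ℝ) : (Ee s ξ)ᴴ = Ee (-s) ξ := by
  unfold Ee
  rw [← Matrix.exp_conjTranspose, conjTranspose_smul, h]; simp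

theorem skew_unitary {n : ℕ} {ξ : HMat n} (h : ξᴴ = -ξ) (s : ℝ) :
    Ee s ξ ∈ Matrix.unitaryGroup (Fin n) ℂ := by
  rw [Matrix.mem_unitaryGroup_iff, star_eq_conjTranspose, skew_Ee h, Ee_inv]

theorem Ee_conj {n : ℕ} {U : HMat n} (hU : U ∈ Matrix.unitaryGroup (Fin n) ℂ) (s : ℝ)
    (X : HMat n) : Ee s (U * X * Uᴴ) = U * Ee s X * Uᴴ := by
  have hinv : U⁻¹ = Uᴴ := Matrix.inv_eq_right_inv (unit_mul hU)
  have hun : IsUnit U := IsUnit.of_mul_eq_one _ (unit_mul hU)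
  unfold Ee
  rw [← hinv, ← Matrix.exp_conj _ _ hun, Matrix.mul_smul, Matrix.smul_mul]

theorem min_crit {n : ℕ} {α β γ : Fin n → ℝ} {t : ℝ} {x : HMat n × HMat n × HMat n}
    (hx : x ∈ OrbS α β γ)
    (hmin : ∀ y ∈ OrbS α β γ, Gf t x.1 x.2.1 x.2.2 ≤ Gf t y.1 y.2.1 y.2.2) :
    Commute (Ee (2 * t) x.1) (Ee t x.2.1 * Ee (-(2 * t)) x.2.2 * Ee t x.2.1) ∧
    Commute (Ee (-(2 * t)) x.2.2) (Ee t x.2.1 * Ee (2 * t) x.1 * Ee t x.2.1) := by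
  obtain ⟨X, Y, K⟩ := x
  obtain ⟨hX, hY, hK⟩ := hx
  simp only at hX hY hK hmin ⊢
  have hs : ∀ {a b : HMat n}, a.IsHermitian → b.IsHermitian → (b * a * b).IsHermitian := by
    intro a b ha hb
    rw [Matrix.IsHermitian, conjTranspose_mul, conjTranspose_mul, ha.eq, hb.eq, Matrix.mul_assoc]
  have hHX := Ee_herm (orb_herm hX) (2 * t)
  have hHY := Ee_herm (orb_herm hY) t
  have hHK := Ee_herm (orb_herm hK) (-(2 * t))
  constructor
  · apply crit hHX (hs hHK hHY)
    intro ξ hξ s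
    have := hmin (Ee s ξ * X * (Ee s ξ)ᴴ, Y, K) ⟨orb_conj hX (skew_unitary hξ s), hY, hK⟩
    simp only [Gf, Wf, Ee_conj (skew_unitary hξ s)] at this
    simp only [skew_Ee hξ] at this
    simpa only [Matrix.mul_assoc] using this
  · apply crit hHK (hs hHX hHY)
    intro ξ hξ s
    have := hmin (X, Y, Ee s ξ * K * (Ee s ξ)ᴴ) ⟨hX, hY, orb_conj hK (skew_unitary hξ s)⟩
    simp only [Gf, Wf, Ee_conj (skew_unitary hξ s)] at this
    simp only [skew_Ee hξ] at this
    have r : ∀ c : HMat n, reTr n (Ee (2 * t) X * Ee t Y * c * Ee t Y)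
        = reTr n (c * (Ee t Y * Ee (2 * t) X * Ee t Y)) := by
      intro c
      rw [show Ee (2 * t) X * Ee t Y * c * Ee t Y = (Ee (2 * t) X * Ee t Y) * (c * Ee t Y) by
        simp only [Matrix.mul_assoc], reTr_mul_comm]
      simp only [Matrix.mul_assoc]
    rw [r, r] at this
    exact this

theorem min_deriv {n : ℕ} {α β γ : Fin n → ℝ} (htr : ∑ i, α i + ∑ i, β i = ∑ i, γ i) {m : ℝ}
    (hm0 : 0 ≤ m) (hm : ∀ x ∈ OrbS α β γ,
    ∀ V ∈ Matrix.unitaryGroup (Fin n) ℂ, ∀ i, ((Vᴴ * (x.1 + x.2.1 - x.2.2) * V) i i).re ≤ m)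
    {t : ℝ} (ht : 0 < t) : ∃ x ∈ OrbS α β γ, Fm α β γ t = Gf t x.1 x.2.1 x.2.2 ∧
    ∃ d, HasDerivAt (fun t => Gf t x.1 x.2.1 x.2.2) d t ∧ 0 ≤ d ∧
      t * d ≤ (2 + 2 * t * m) * (Gf t x.1 x.2.1 x.2.2 - n) := by
  obtain ⟨x, hx, h1, h2⟩ := Fm_min α β γ t
  refine ⟨x, hx, h1, ?_⟩
  obtain ⟨c1, c2⟩ := min_crit hx h2
  refine crit_main ht (orb_herm hx.1) (orb_herm hx.2.1) (orb_herm hx.2.2) ?_ hm0 (hm x hx) c1 c2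
  rw [orb_trace hx.1, orb_trace hx.2.1, orb_trace hx.2.2, ← htr]; simp

theorem Fm_ge {n : ℕ} {α β γ : Fin n → ℝ} (htr : ∑ i, α i + ∑ i, β i = ∑ i, γ i) (t : ℝ) :
    ∃ x ∈ OrbS α β γ, (n : ℝ) ≤ Fm α β γ t ∧
      (Fm α β γ t = n → Wf t x.1 x.2.1 x.2.2 = 1) := by
  obtain ⟨x, hx, h1, -⟩ := Fm_min α β γ t
  have := Gf_ge t (orb_herm hx.1) (orb_herm hx.2.1) (orb_herm hx.2.2)
    (by rw [orb_trace hx.1, orb_trace hx.2.1, orb_trace hx.2.2, ← htr]; simp)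
  refine ⟨x, hx, ?_⟩
  rw [h1]; exact this

theorem Fm_mono {n : ℕ} {α β γ : Fin n → ℝ} (htr : ∑ i, α i + ∑ i, β i = ∑ i, γ i)
    {t : ℝ} (ht : 0 < t) (ht1 : t ≤ 1) : Fm α β γ t ≤ Fm α β γ 1 := by
  obtain ⟨m, hm0, hm⟩ := exists_m α β γ
  have := fence (F := fun s => Fm α β γ (-s)) (a := -1) (b := -t) (by linarith)
    ((Fm_cont α β γ).comp continuous_neg).continuousOn ?_
  · simpa using this
  intro s hs
  obtain ⟨x, hx, h1, d, hd, hd0, -⟩ := min_deriv htr hm0 hm (t := -s) (by linarith [hs.2])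
  refine ⟨fun s => Gf (-s) x.1 x.2.1 x.2.2, d * (-1), ?_, by linarith, h1.symm,
    fun t _ => Fm_le _ hx⟩
  exact HasDerivAt.comp (h₂ := fun t => Gf t x.1 x.2.1 x.2.2) s hd (hasDerivAt_neg s)

theorem Fm_anti {n : ℕ} {α β γ : Fin n → ℝ} (htr : ∑ i, α i + ∑ i, β i = ∑ i, γ i) {m : ℝ}
    (hm0 : 0 ≤ m) (hm : ∀ x ∈ OrbS α β γ,
    ∀ V ∈ Matrix.unitaryGroup (Fin n) ℂ, ∀ i, ((Vᴴ * (x.1 + x.2.1 - x.2.2) * V) i i).re ≤ m)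
    {t : ℝ} (ht : 0 < t) (ht1 : t ≤ 1) :
    (Fm α β γ 1 - n) * (Real.exp (-(2 * m) * 1) * ((1:ℝ) ^ 2)⁻¹)
      ≤ (Fm α β γ t - n) * (Real.exp (-(2 * m) * t) * (t ^ 2)⁻¹) := by
  refine fence (F := fun t => (Fm α β γ t - n) * (Real.exp (-(2 * m) * t) * (t ^ 2)⁻¹)) ht1 ?_ ?_
  · apply ContinuousOn.mul ((Fm_cont α β γ).sub continuous_const).continuousOn
    apply ContinuousOn.mul (by fun_prop)
    apply ContinuousOn.inv₀ (by fun_prop)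
    intro x hx
    have : 0 < x := lt_of_lt_of_le ht hx.1
    positivity
  · intro s hs
    have hs0 : 0 < s := lt_of_lt_of_le ht hs.1
    obtain ⟨x, hx, h1, d, hd, hd0, hd1⟩ := min_deriv htr hm0 hm hs0
    have hφ : HasDerivAt (fun t : ℝ => Real.exp (-(2 * m) * t) * (t ^ 2)⁻¹)
        (Real.exp (-(2 * m) * s) * (-(2 * m) * 1) * (s ^ 2)⁻¹
          + Real.exp (-(2 * m) * s) * (-(((2:ℕ):ℝ) * s ^ (2 - 1)) / (s ^ 2) ^ 2)) s := by
      have e1 := ((hasDerivAt_id s).const_mul (-(2 * m))).exp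
      have e2 := (hasDerivAt_pow 2 s).inv (by positivity)
      exact e1.mul e2
    refine ⟨_, _, (hd.sub_const (n:ℝ)).mul hφ, ?_, ?_, ?_⟩
    · have e : d * (Real.exp (-(2 * m) * s) * (s ^ 2)⁻¹) + (Gf s x.1 x.2.1 x.2.2 - n) *
        (Real.exp (-(2 * m) * s) * (-(2 * m) * 1) * (s ^ 2)⁻¹
          + Real.exp (-(2 * m) * s) * (-(((2:ℕ):ℝ) * s ^ (2 - 1)) / (s ^ 2) ^ 2))
        = Real.exp (-(2 * m) * s) * (s ^ 3)⁻¹ *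
          (s * d - (2 + 2 * s * m) * (Gf s x.1 x.2.1 x.2.2 - n)) := by
        field_simp
        push_cast
        ring
      refine e.trans_le ?_
      apply mul_nonpos_of_nonneg_of_nonpos (by positivity) (by linarith)
    · simp only [h1, Pi.mul_apply]
    · intro r hr
      have hr0 : 0 < r := hs0.trans hr.1
      apply mul_le_mul_of_nonneg_right _ (by positivity)
      linarith [Fm_le (α := α) (β := β) (γ := γ) r hx]

open scoped ComplexOrder

theorem Wf_one_iff {n : ℕ} {t : ℝ} {X Y K : HMat n} (h : Wf t X Y K = 1) :
    Ee (2 * t) X * Ee t Y = Ee (-t) Y * Ee (2 * t) K := by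
  have h1 : Ee (2 * t) X * Ee t Y * Ee (-(2 * t)) K * Ee t Y = 1 := h
  have h2 : Ee (2 * t) X * Ee t Y * Ee (-(2 * t)) K = Ee (-t) Y := by
    calc _ = (Ee (2 * t) X * Ee t Y * Ee (-(2 * t)) K * Ee t Y) * Ee (-t) Y := by
          rw [Matrix.mul_assoc _ (Ee t Y) (Ee (-t) Y), Ee_inv, Matrix.mul_one]
      _ = _ := by rw [h1, Matrix.one_mul]
  rw [← h2, Matrix.mul_assoc _ (Ee (-(2 * t)) K), Ee_inv', Matrix.mul_one]

theorem first_order {n : ℕ} (S : Set (HMat n × HMat n × HMat n)) (hS : IsCompact S)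
    (h : ∀ t : ℝ, 0 < t → t ≤ 1 → ∃ x ∈ S, Wf t x.1 x.2.1 x.2.2 = 1) :
    ∃ x ∈ S, x.1 + x.2.1 = x.2.2 := by
  obtain ⟨x1, hx1, -⟩ := h 1 one_pos le_rfl
  have hcont : Continuous (fun x : HMat n × HMat n × HMat n => ‖x.1 + x.2.1 - x.2.2‖) := by
    fun_prop
  obtain ⟨x0, hx0, hmin⟩ := hS.exists_isMinOn ⟨x1, hx1⟩ hcont.continuousOn
  refine ⟨x0, hx0, ?_⟩
  rw [← sub_eq_zero, ← norm_le_zero_iff]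
  obtain ⟨M, hM⟩ := hS.isBounded.exists_norm_le
  have hM0 : 0 ≤ M := (norm_nonneg _).trans (hM x1 hx1)
  -- the differentiable function
  let E := HMat n × HMat n × HMat n
  have hex : HasFDerivAt (NormedSpace.exp : HMat n → HMat n) (1 : HMat n →L[ℝ] HMat n) 0 :=
    hasFDerivAt_exp_zero
  have hlin : ∀ L : E →L[ℝ] HMat n,
      HasFDerivAt (fun v : E => NormedSpace.exp (L v)) L 0 := by
    intro L
    have h1 : HasFDerivAt (NormedSpace.exp : HMat n → HMat n) (1 : HMat n →L[ℝ] HMat n) (L 0) := by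
      rw [map_zero]; exact hex
    exact h1.comp (0:E) L.hasFDerivAt
  let pX : E →L[ℝ] HMat n := ContinuousLinearMap.fst ℝ _ _
  let pY : E →L[ℝ] HMat n := (ContinuousLinearMap.fst ℝ _ _).comp (ContinuousLinearMap.snd ℝ _ _)
  let pK : E →L[ℝ] HMat n := (ContinuousLinearMap.snd ℝ _ _).comp (ContinuousLinearMap.snd ℝ _ _)
  have hΦ := ((hlin ((2:ℝ) • pX)).mul' (hlin pY)).sub ((hlin (-pY)).mul' (hlin ((2:ℝ) • pK)))
  have hΦ' := hΦ.congr_fderiv (g' := (2:ℝ) • (pX + pY - pK)) (by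
    refine ContinuousLinearMap.ext fun v => ?_
    rw [map_zero, map_zero, map_zero, map_zero, NormedSpace.exp_zero]
    show (1 : HMat n) * v.2.1 + ((2:ℝ) • v.1) * 1 - (1 * ((2:ℝ) • v.2.2) + (-v.2.1) * 1)
      = (2:ℝ) • (v.1 + v.2.1 - v.2.2)
    rw [Matrix.one_mul, Matrix.one_mul, Matrix.mul_one, Matrix.mul_one]
    module)
  have hlo := hΦ'.isLittleO
  apply le_of_forall_pos_le_add
  intro ε hε
  rw [zero_add]
  have hev := hlo.def (c := 2 * ε / (M + 1)) (by positivity)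
  rw [Metric.eventually_nhds_iff] at hev
  obtain ⟨δ, hδ, hev⟩ := hev
  obtain ⟨t, ht0, ht1, htδ⟩ : ∃ t : ℝ, 0 < t ∧ t ≤ 1 ∧ t * M < δ := by
    refine ⟨min 1 (δ / (M + 1)), by positivity, min_le_left _ _, ?_⟩
    calc min 1 (δ / (M + 1)) * M ≤ δ / (M + 1) * M := by
          apply mul_le_mul_of_nonneg_right (min_le_right _ _) hM0
      _ < δ := by
        rw [div_mul_eq_mul_div, div_lt_iff₀ (by positivity)]; nlinarith
  obtain ⟨x, hx, hW⟩ := h t ht0 ht1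
  have hnv : ‖t • x‖ ≤ t * M := by
    rw [norm_smul, Real.norm_eq_abs, abs_of_pos ht0]
    exact mul_le_mul_of_nonneg_left (hM x hx) ht0.le
  have key := hev (y := t • x) (by rw [dist_zero_right]; linarith)
  have hw1 := Wf_one_iff hW
  have hz : NormedSpace.exp (((2:ℝ) • pX) (t • x)) * NormedSpace.exp (pY (t • x))
      - NormedSpace.exp ((-pY) (t • x)) * NormedSpace.exp (((2:ℝ) • pK) (t • x)) = 0 := by
    rw [sub_eq_zero]
    have a1 : ((2:ℝ) • pX) (t • x) = (2 * t) • x.1 := by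
      show (2:ℝ) • (t • x.1) = _
      rw [smul_smul]
    have a2 : ((2:ℝ) • pK) (t • x) = (2 * t) • x.2.2 := by
      show (2:ℝ) • (t • x.2.2) = _
      rw [smul_smul]
    have a3 : pY (t • x) = t • x.2.1 := rfl
    have a4 : (-pY) (t • x) = (-t) • x.2.1 := by
      show -(t • x.2.1) = _
      rw [neg_smul]
    rw [a1, a2, a3, a4]
    exact hw1
  have hL : ‖(2 * t) • (x.1 + x.2.1 - x.2.2)‖ ≤ 2 * ε / (M + 1) * ‖t • x‖ := by
    have h0 : NormedSpace.exp (((2:ℝ) • pX) 0) * NormedSpace.exp (pY 0)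
      - NormedSpace.exp ((-pY) 0) * NormedSpace.exp (((2:ℝ) • pK) 0) = 0 := by
      rw [map_zero, map_zero, map_zero, map_zero]; exact sub_self _
    simp only [Pi.sub_apply, Pi.mul_apply, hz, h0, sub_zero, zero_sub, norm_neg] at key
    refine le_trans (le_of_eq ?_) key
    congr 1
    show _ = (2:ℝ) • (t • x.1 + t • x.2.1 - t • x.2.2)
    module
  rw [norm_smul, Real.norm_eq_abs, abs_of_pos (by positivity)] at hL
  have h5 : ‖x.1 + x.2.1 - x.2.2‖ ≤ ε := by
    have h6 : 2 * ε / (M + 1) * ‖t • x‖ ≤ 2 * ε / (M + 1) * (t * (M + 1)) := by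
      apply mul_le_mul_of_nonneg_left _ (by positivity)
      nlinarith
    have h7 : 2 * ε / (M + 1) * (t * (M + 1)) = 2 * t * ε := by field_simp
    rw [h7] at h6
    exact le_of_mul_le_mul_left (hL.trans h6) (by positivity)
  exact (hmin hx).trans h5

theorem core_add {n : ℕ} {α β γ : Fin n → ℝ} (htr : ∑ i, α i + ∑ i, β i = ∑ i, γ i)
    (h : ∃ x ∈ OrbS α β γ, Wf 1 x.1 x.2.1 x.2.2 = 1) :
    ∃ x ∈ OrbS α β γ, x.1 + x.2.1 = x.2.2 := by
  apply first_order _ (compact_orbS α β γ)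
  intro t ht ht1
  obtain ⟨x1, hx1, hW⟩ := h
  have h1 : Fm α β γ 1 ≤ n := by
    have := Fm_le 1 hx1
    simpa [Gf, hW, reTr] using this
  obtain ⟨x, hx, hge, heq⟩ := Fm_ge htr t
  exact ⟨x, hx, heq (le_antisymm ((Fm_mono htr ht ht1).trans h1) hge)⟩

theorem second_order {n : ℕ} (X Y K : HMat n) (h : X + Y = K) :
    Tendsto (fun t => (Gf t X Y K - n) / t ^ 2) (𝓝[>] 0) (𝓝 0) := by
  let W' : ℝ → HMat n := fun t =>
      (((Ee (2 * t) X * ((2:ℝ) • X) * Ee t Y + Ee (2 * t) X * (Ee t Y * Y)) * Ee (-(2 * t)) K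
        + Ee (2 * t) X * Ee t Y * (Ee (-(2 * t)) K * ((-2:ℝ) • K))) * Ee t Y
        + Ee (2 * t) X * Ee t Y * Ee (-(2 * t)) K * (Ee t Y * Y))
  have hg : ∀ t, HasDerivAt (fun t => Gf t X Y K - n) (reTr n (W' t)) t := fun t =>
    (reTr_deriv (Wf_deriv t X Y K)).sub_const _
  have hG0 : Gf 0 X Y K = n := by
    simp [Gf, Wf, Ee_zero, reTr]
  have hW0 : reTr n (W' 0) = 0 := by
    simp only [W', mul_zero, neg_zero, Ee_zero, one_mul, mul_one]
    rw [← h]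
    have : (2:ℝ) • X + Y + (-2:ℝ) • (X + Y) + Y = 0 := by module
    rw [this]; simp [reTr]
  have e1 : ∀ t, Ee (2 * t) X = Ee t ((2:ℝ) • X) := by
    intro t; unfold Ee; rw [smul_smul, mul_comm]
  have e2 : ∀ t, Ee (-(2 * t)) K = Ee t ((-2:ℝ) • K) := by
    intro t; unfold Ee; rw [smul_smul]; congr 2; ring
  have hW'd : HasDerivAt (fun t => reTr n (W' t)) 0 0 := by
    have dX := Ee_deriv ((2:ℝ) • X) 0
    have dY := Ee_deriv Y 0
    have dK := Ee_deriv ((-2:ℝ) • K) 0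
    have hd := reTr_deriv ((((((dX.mul_const ((2:ℝ) • X)).mul dY).add
      (dX.mul (dY.mul_const Y))).mul dK).add ((dX.mul dY).mul (dK.mul_const ((-2:ℝ) • K)))).mul dY
      |>.add (((dX.mul dY).mul dK).mul (dY.mul_const Y)))
    refine (hd.congr_deriv ?_).congr_of_eventuallyEq (Eventually.of_forall fun t => ?_)
    rotate_left
    · show reTr n (W' t) = _
      simp only [W', e1, e2]
      rfl
    simp only [Pi.mul_apply, Pi.add_apply, Ee_zero, one_mul, mul_one]
    rw [← h]
    simp only [Matrix.mul_add, Matrix.add_mul, Matrix.mul_smul, Matrix.smul_mul, smul_add,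
      smul_smul, reTr_add, reTr_smul]
    rw [reTr_mul_comm Y X]
    ring
  refine HasDerivAt.lhopital_zero_nhdsGT (f' := fun t => reTr n (W' t)) (g' := fun t => 2 * t)
    (Eventually.of_forall hg) (Eventually.of_forall fun t => ?_) ?_ ?_ ?_ ?_
  · simpa using hasDerivAt_pow 2 t
  · filter_upwards [self_mem_nhdsWithin] with t ht
    have : (0:ℝ) < t := ht
    positivity
  · have := (hg 0).continuousAt.tendsto
    simp only [hG0, sub_self] at this
    exact this.mono_left nhdsWithin_le_nhds
  · have : Tendsto (fun t : ℝ => t ^ 2) (𝓝 0) (𝓝 (0 ^ 2)) := (continuous_pow 2).tendsto 0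
    simp only [ne_eq, OfNat.ofNat_ne_zero, not_false_eq_true, zero_pow] at this
    exact this.mono_left nhdsWithin_le_nhds
  · have := (hasDerivAt_iff_tendsto_slope.1 hW'd).mono_left
      (nhdsWithin_mono (0:ℝ) (fun y (hy : 0 < y) => hy.ne'))
    have h2 := this.div_const 2
    rw [zero_div] at h2
    refine h2.congr fun t => ?_
    rw [slope_def_field, hW0, sub_zero, sub_zero, div_div, mul_comm]

theorem core_mult {n : ℕ} {α β γ : Fin n → ℝ} (htr : ∑ i, α i + ∑ i, β i = ∑ i, γ i)
    (h : ∃ x ∈ OrbS α β γ, x.1 + x.2.1 = x.2.2) :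
    ∃ x ∈ OrbS α β γ, Wf 1 x.1 x.2.1 x.2.2 = 1 := by
  obtain ⟨x0, hx0, hadd⟩ := h
  obtain ⟨m, hm0, hm⟩ := exists_m α β γ
  obtain ⟨x, hx, hge, heq⟩ := Fm_ge htr 1
  refine ⟨x, hx, heq (le_antisymm ?_ hge)⟩
  have hlim := second_order _ _ _ hadd
  have hle : (Fm α β γ 1 - n) * (Real.exp (-(2 * m) * 1) * ((1:ℝ) ^ 2)⁻¹) ≤ 0 := by
    apply ge_of_tendsto hlim
    filter_upwards [Ioc_mem_nhdsGT (zero_lt_one (α := ℝ))] with t ht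
    have ht0 : 0 < t := ht.1
    refine (Fm_anti htr hm0 hm ht.1 ht.2).trans ?_
    obtain ⟨-, -, hge', -⟩ := Fm_ge htr t
    have h1 := Fm_le t hx0
    have h2 : Real.exp (-(2 * m) * t) ≤ 1 := by
      rw [Real.exp_le_one_iff]; nlinarith
    rw [div_eq_mul_inv, ← mul_assoc]
    apply mul_le_mul_of_nonneg_right _ (by positivity)
    nlinarith [Real.exp_pos (-(2 * m) * t)]
  have hpos : 0 < Real.exp (-(2 * m) * 1) * ((1:ℝ) ^ 2)⁻¹ := by positivity
  have := nonpos_of_mul_nonpos_left hle hpos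
  linarith

open scoped ComplexOrder

theorem cholesky {n : ℕ} {S : HMat n} (hS : S.PosDef) : ∃ C ∈ UpperTriPos n, C * Cᴴ = S := by
  have hQ : S⁻¹.PosDef := hS.inv
  set L := LDL.lowerInv hQ with hL
  have hLu : IsUnit L := by
    letI := LDL.invertibleLowerInv hQ
    exact isUnit_of_invertible L
  have hLdet : IsUnit L.det := (Matrix.isUnit_iff_isUnit_det L).1 hLu
  have hLHdet : IsUnit (Lᴴ).det := by rw [det_conjTranspose]; exact hLdet.star
  have hSdet : IsUnit S.det := (Matrix.isUnit_iff_isUnit_det S).1 hS.isUnit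
  have hD : LDL.diag hQ = L * S⁻¹ * Lᴴ := LDL.diag_eq_lowerInv_conj hQ
  have hDpd : (LDL.diag hQ).PosDef := by
    rw [hD]
    exact hQ.mul_mul_conjTranspose_same (Matrix.vecMul_injective_of_isUnit hLu)
  have htri : ∀ i j, i < j → L i j = 0 := fun i j h => LDL.lowerInv_triangular hQ h
  have hLii : ∀ i, L i i ≠ 0 := by
    have h1 : L.det = ∏ i, L i i := Matrix.det_of_isLowerTriangular L (fun i j h => htri i j h)
    rw [h1] at hLdet
    intro i
    exact Finset.prod_ne_zero_iff.1 hLdet.ne_zero i (Finset.mem_univ i)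
  have hSL : S = Lᴴ * (LDL.diag hQ)⁻¹ * L := by
    rw [hD, Matrix.mul_inv_rev, Matrix.mul_inv_rev, Matrix.nonsing_inv_nonsing_inv _ hSdet]
    rw [Matrix.mul_assoc, Matrix.mul_assoc, Matrix.mul_assoc, Matrix.nonsing_inv_mul _ hLdet,
      Matrix.mul_one, ← Matrix.mul_assoc, Matrix.mul_nonsing_inv _ hLHdet, Matrix.one_mul]
  obtain ⟨d, hd0, hd⟩ : ∃ d : Fin n → ℝ, (∀ i, 0 < d i) ∧
      LDL.diag hQ = diagonal (fun i => (d i : ℂ)) := by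
    have h1 : ∀ i, 0 < LDL.diagEntries hQ i := by
      intro i
      have := hDpd.diag_pos (i := i)
      simpa [LDL.diag] using this
    refine ⟨fun i => (LDL.diagEntries hQ i).re, fun i => (Complex.pos_iff.1 (h1 i)).1, ?_⟩
    unfold LDL.diag
    congr 1
    ext1 i
    apply Complex.ext
    · simp
    · simp [← (Complex.pos_iff.1 (h1 i)).2]
  have hdinv : (LDL.diag hQ)⁻¹ = diagonal (fun i => ((d i : ℂ))⁻¹) := by
    rw [hd]
    apply Matrix.inv_eq_right_inv
    rw [diagonal_mul_diagonal, ← diagonal_one]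
    congr 1
    ext i
    exact mul_inv_cancel₀ (by exact_mod_cast (hd0 i).ne')
  let e : Fin n → ℂ := fun i => L i i * (((‖L i i‖ * Real.sqrt (d i))⁻¹ : ℝ) : ℂ)
  have hnorm : ∀ i, L i i * star (L i i) = ((‖L i i‖ ^ 2 : ℝ) : ℂ) := by
    intro i
    rw [Complex.star_def, Complex.mul_conj, Complex.normSq_eq_norm_sq]
  have hnp : ∀ i, 0 < ‖L i i‖ := fun i => norm_pos_iff.2 (hLii i)
  refine ⟨Lᴴ * diagonal e, ⟨?_, ?_⟩, ?_⟩
  · intro i j hij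
    rw [mul_diagonal, conjTranspose_apply, htri j i hij]; simp
  · intro i
    have : (Lᴴ * diagonal e) i i = ((‖L i i‖ ^ 2 * (‖L i i‖ * Real.sqrt (d i))⁻¹ : ℝ) : ℂ) := by
      rw [mul_diagonal, conjTranspose_apply, Complex.ofReal_mul, ← hnorm]
      simp only [e]
      ring
    rw [this]
    have h1 := hnp i
    have h2 := Real.sqrt_pos.2 (hd0 i)
    exact ⟨by rw [Complex.ofReal_re]; positivity, Complex.ofReal_im _⟩
  · rw [conjTranspose_mul, conjTranspose_conjTranspose, hSL, hdinv]
    rw [Matrix.mul_assoc, ← Matrix.mul_assoc (diagonal e), diagonal_conjTranspose,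
      diagonal_mul_diagonal, Matrix.mul_assoc]
    congr 3
    ext1 i
    have h3 : e i * star e i = ((‖L i i‖ ^ 2 * ((‖L i i‖ * Real.sqrt (d i))⁻¹) ^ 2 : ℝ) : ℂ) := by
      rw [Complex.ofReal_mul, ← hnorm]
      simp only [e, Pi.star_apply, star_mul']
      rw [Complex.star_def, Complex.conj_ofReal]
      push_cast
      ring
    rw [h3, ← Complex.ofReal_inv]
    congr 1
    have h1 := hnp i
    rw [mul_inv, mul_pow, inv_pow, inv_pow, Real.sq_sqrt (hd0 i).le]
    field_simp

theorem eigsDesc_pos {n : ℕ} {P : HMat n} (hP : P.PosDef) (i : Fin n) : 0 < eigsDesc hP.1 i :=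
  hP.eigenvalues_pos _

theorem exists_log {n : ℕ} {P : HMat n} (hP : P.PosDef) :
    ∃ X ∈ Orb (fun i => (1 / 2) * Real.log (eigsDesc hP.1 i)), Ee 2 X = P := by
  obtain ⟨U, hU, h⟩ := mem_orb_eigsDesc hP.1
  refine ⟨_, ⟨U, hU, rfl⟩, ?_⟩
  unfold Ee
  rw [exp_form hU]
  conv_rhs => rw [h]
  congr 3
  ext i
  rw [← mul_assoc, show (2:ℝ) * (1 / 2) = 1 by norm_num, one_mul,
    Real.exp_log (eigsDesc_pos hP i)]

theorem log_antitone {n : ℕ} {P : HMat n} (hP : P.PosDef) :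
    Antitone (fun i => (1 / 2) * Real.log (eigsDesc hP.1 i)) := by
  intro i j hij
  have := Real.log_le_log (eigsDesc_pos hP j) (eigsDesc_antitone hP.1 hij)
  simp only
  linarith

theorem lB_of {n : ℕ} {A X : HMat n} {α : Fin n → ℝ} (hα : Antitone α) (hX : X ∈ Orb α)
    (h : (A * Aᴴ).charpoly = (Ee 2 X).charpoly) : lB A = fun i => ∑ j ∈ Finset.Iic i, α j := by
  have h1 := eigsDesc_congr (Matrix.isHermitian_mul_conjTranspose_self A)
    (Ee_herm (orb_herm hX) 2) h
  have h2 := eigsDesc_eq_of_mem_orb (Ee_herm (orb_herm hX) 2) (α := fun i => Real.exp (2 * α i))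
    (fun i j hij => Real.exp_le_exp.2 (by linarith [hα hij])) (exp_mem_orb hX 2)
  funext i
  unfold lB
  rw [h1, h2, Finset.mul_sum]
  apply Finset.sum_congr rfl
  intro j _
  rw [Real.log_exp]; ring

theorem lMap_of {n : ℕ} {X : HMat n} {α : Fin n → ℝ} (hα : Antitone α) (hX : X ∈ Orb α)
    (h : X.IsHermitian) : lMap h = fun i => ∑ j ∈ Finset.Iic i, α j := by
  unfold lMap
  rw [eigsDesc_eq_of_mem_orb h hα hX]

theorem upper_unit {n : ℕ} {A : HMat n} (hA : A ∈ UpperTriPos n) : IsUnit A := by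
  rw [Matrix.isUnit_iff_isUnit_det,
    Matrix.det_of_isUpperTriangular (fun i j h => hA.1 i j h), isUnit_iff_ne_zero]
  apply Finset.prod_ne_zero_iff.2
  intro i _ h0
  have := (hA.2 i).1
  rw [h0] at this
  simp at this

theorem Ee_half {n : ℕ} (X : HMat n) : Ee 1 X * Ee 1 X = Ee 2 X := by
  rw [Ee_mul]; norm_num

theorem hornB_sub (n : ℕ) : HornConeB n ⊆ HornCone n := by
  rintro ⟨r, s, t⟩ ⟨A, C, hA, hC, h1, h2, h3⟩
  simp only at h1 h2 h3
  have uA := upper_unit hA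
  have uC := upper_unit hC
  have pA : (Aᴴ * A).PosDef := by
    have := posDef_of_unit (R := Aᴴ) uA.star
    rwa [conjTranspose_conjTranspose] at this
  have pC : (C * Cᴴ).PosDef := posDef_of_unit uC
  obtain ⟨X, hX, eX⟩ := exists_log pA
  obtain ⟨Y, hY, eY⟩ := exists_log pC
  have pK : (Ee 1 Y * Ee 2 X * Ee 1 Y).PosDef := by
    have := posDef_of_unit ((Ee_unit 1 Y).mul (Ee_unit 1 X))
    rw [conjTranspose_mul, (Ee_herm (orb_herm hX) 1).eq, (Ee_herm (orb_herm hY) 1).eq,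
      ← Matrix.mul_assoc, Matrix.mul_assoc (Ee 1 Y), Ee_half] at this
    exact this
  obtain ⟨K, hK, eK⟩ := exists_log pK
  have aA := log_antitone pA
  have aC := log_antitone pC
  have aK := log_antitone pK
  have lA := lB_of (A := A) aA hX (by rw [eX, charpoly_mul_comm])
  have lC := lB_of (A := C) aC hY (by rw [eY])
  have lK := lB_of (A := A * C) aK hK (by
    rw [eK, Matrix.mul_assoc (Ee 1 Y), charpoly_mul_comm (Ee 1 Y),
      Matrix.mul_assoc (Ee 2 X), Ee_half, eX, eY,
      conjTranspose_mul, Matrix.mul_assoc A, charpoly_mul_comm A, charpoly_mul_comm (Aᴴ * A)]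
    simp only [Matrix.mul_assoc])
  generalize (fun i => (1 / 2) * Real.log (eigsDesc pA.1 i)) = α at *
  generalize (fun i => (1 / 2) * Real.log (eigsDesc pC.1 i)) = β at *
  generalize (fun i => (1 / 2) * Real.log (eigsDesc pK.1 i)) = γ at *
  have htr : ∑ i, α i + ∑ i, β i = ∑ i, γ i := by
    have hd := congrArg (fun M : HMat n => ‖M.det‖) eK
    simp only [det_mul, Ee_det (orb_herm hX), Ee_det (orb_herm hY), Ee_det (orb_herm hK),
      orb_trace hX, orb_trace hY, orb_trace hK, ← Complex.exp_add, Complex.norm_exp,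
      ← Complex.ofReal_mul, ← Complex.ofReal_add, Complex.ofReal_re] at hd
    have := Real.exp_injective hd
    linarith
  have hinv : Ee (-(2 * 1)) K = Ee (-1) Y * Ee (-2) X * Ee (-1) Y := by
    have e1 : (Ee (-1) Y * Ee (-2) X * Ee (-1) Y) * Ee 2 K = 1 := by
      rw [eK]
      calc _ = Ee (-1) Y * (Ee (-2) X * ((Ee (-1) Y * Ee 1 Y) * Ee 2 X)) * Ee 1 Y := by
            simp only [Matrix.mul_assoc]
        _ = 1 := by
          rw [Ee_inv', Matrix.one_mul, Ee_inv', Matrix.mul_one, Ee_inv']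
    calc _ = ((Ee (-1) Y * Ee (-2) X * Ee (-1) Y) * Ee 2 K) * Ee (-(2 * 1)) K := by
          rw [e1, Matrix.one_mul]
      _ = _ := by rw [Matrix.mul_assoc, mul_one, Ee_inv, Matrix.mul_one]
  have hW : Wf 1 X Y K = 1 := by
    unfold Wf
    rw [hinv, mul_one]
    calc _ = Ee 2 X * ((Ee 1 Y * Ee (-1) Y) * Ee (-2) X) * (Ee (-1) Y * Ee 1 Y) := by
          simp only [Matrix.mul_assoc]
      _ = 1 := by rw [Ee_inv, Ee_inv', Matrix.one_mul, Matrix.mul_one, Ee_inv]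
  obtain ⟨⟨X', Y', K'⟩, ⟨hX', hY', hK'⟩, hadd⟩ := core_add htr ⟨(X, Y, K), ⟨hX, hY, hK⟩, hW⟩
  simp only at hX' hY' hK' hadd
  refine ⟨X', Y', orb_herm hX', orb_herm hY', ?_, ?_, ?_⟩
  · rw [lMap_of aA hX', ← h1, lA]
  · rw [lMap_of aC hY', ← h2, lC]
  · rw [lMap_of aK (by rw [hadd]; exact hK'), ← h3, lK]

theorem horn_sub (n : ℕ) : HornCone n ⊆ HornConeB n := by
  rintro ⟨a, b, c⟩ ⟨K₁, K₂, h₁, h₂, e1, e2, e3⟩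
  simp only at e1 e2 e3
  have m1 := mem_orb_eigsDesc h₁
  have m2 := mem_orb_eigsDesc h₂
  have m3 := mem_orb_eigsDesc (h₁.add h₂)
  have aA := eigsDesc_antitone h₁
  have aC := eigsDesc_antitone h₂
  have aK := eigsDesc_antitone (h₁.add h₂)
  have htr : ∑ i, eigsDesc h₁ i + ∑ i, eigsDesc h₂ i = ∑ i, eigsDesc (h₁.add h₂) i := by
    apply Complex.ofReal_injective
    rw [Complex.ofReal_add, ← orb_trace m1, ← orb_trace m2, ← orb_trace m3, trace_add]
  obtain ⟨⟨X, Y, K⟩, ⟨hX, hY, hK⟩, hW⟩ := core_mult htr ⟨(K₁, K₂, K₁ + K₂), ⟨m1, m2, m3⟩, rfl⟩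
  simp only at hX hY hK hW
  have hXh := orb_herm hX
  have hYh := orb_herm hY
  have hEK : Ee 1 Y * (Ee 2 X * Ee 1 Y) = Ee 2 K := by
    have := Wf_one_iff hW
    rw [mul_one] at this
    rw [this, ← Matrix.mul_assoc, Ee_inv, Matrix.one_mul]
  have pX : (Ee 2 X).PosDef := by
    have := posDef_of_unit (Ee_unit 1 X)
    rwa [(Ee_herm hXh 1).eq, Ee_half] at this
  obtain ⟨A, hA, hAA⟩ := cholesky pX
  set V := Ee (-1) X * A with hV
  have hVV : V * Vᴴ = 1 := by
    rw [hV, conjTranspose_mul, (Ee_herm hXh (-1)).eq]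
    calc _ = Ee (-1) X * (A * Aᴴ) * Ee (-1) X := by simp only [Matrix.mul_assoc]
      _ = 1 := by
        rw [hAA, ← Ee_half, ← Matrix.mul_assoc, Ee_inv', Matrix.one_mul, Ee_inv]
  have hVu : V ∈ Matrix.unitaryGroup (Fin n) ℂ := Matrix.mem_unitaryGroup_iff.2 hVV
  have hA' : A = Ee 1 X * V := by
    rw [hV, ← Matrix.mul_assoc, Ee_inv, Matrix.one_mul]
  clear_value V
  have pY : (Vᴴ * Ee 2 Y * V).PosDef := by
    have hu : IsUnit Vᴴ := IsUnit.of_mul_eq_one _ (unit_mul' hVu)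
    have := posDef_of_unit (hu.mul (Ee_unit 1 Y))
    rw [conjTranspose_mul, (Ee_herm hYh 1).eq, conjTranspose_conjTranspose,
      ← Matrix.mul_assoc, Matrix.mul_assoc Vᴴ, Ee_half] at this
    exact this
  obtain ⟨C, hC, hCC⟩ := cholesky pY
  have lA := lB_of (A := A) aA hX (by rw [hAA])
  have lC := lB_of (A := C) aC hY (by
    rw [hCC, charpoly_mul_comm, ← Matrix.mul_assoc, hVV, Matrix.one_mul])
  have lK := lB_of (A := A * C) aK hK (by
    have : A * C * (A * C)ᴴ = Ee 1 X * Ee 2 Y * Ee 1 X := by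
      calc _ = A * (C * Cᴴ) * Aᴴ := by
            rw [conjTranspose_mul]; simp only [Matrix.mul_assoc]
        _ = Ee 1 X * ((V * Vᴴ) * Ee 2 Y * (V * Vᴴ)) * Ee 1 X := by
            rw [hCC, hA', conjTranspose_mul, (Ee_herm hXh 1).eq]
            simp only [Matrix.mul_assoc]
        _ = _ := by rw [hVV, Matrix.one_mul, Matrix.mul_one, Matrix.mul_assoc]
    rw [this, ← hEK, charpoly_mul_comm (Ee 1 Y), Matrix.mul_assoc (Ee 2 X), Ee_half,
      charpoly_mul_comm, ← Matrix.mul_assoc, Ee_half])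
  refine ⟨A, C, hA, hC, ?_, ?_, ?_⟩
  · rw [lA, ← e1]; rfl
  · rw [lC, ← e2]; rfl
  · rw [lK, ← e3]; rfl

end Horn

/-- Klyachko's theorem (Thompson conjecture): the multiplicative Horn cone coincides
with the Horn cone. -/
theorem hornConeB_eq_hornCone (n : ℕ) (hn : 0 < n) : HornConeB n = HornCone n := by
  exact Set.Subset.antisymm (hornB_sub n) (horn_sub n)
end

section
/- Fix a positive integer n and vectors r, s ∈ ℝ^n. Then the multiplicative and additive Horn polytopes coincide: {l^B(AC) : A, C ∈ B, l^B(A) = r, l^B(C) = s} = {l(K_1 + K_2) : K_1, K_2 n×n Hermitian, l(K_1) = r, l(K_2) = s} as subsets of ℝ^n. -/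
open Matrix

namespace MH

/-! ### the scalar function -/

noncomputable def phi : ℝ → ℝ := dslope (fun y => Real.exp (2 * y) / 2) 0

lemma phi_mul (y : ℝ) : 1 + 2 * (y * phi y) = Real.exp (2 * y) := by
  have h := sub_smul_dslope (fun y => Real.exp (2 * y) / 2) 0 y
  simp only [sub_zero, smul_eq_mul, mul_zero, Real.exp_zero] at h
  unfold phi
  rw [h]; ring

lemma phi_zero : phi 0 = 1 := by
  unfold phi
  rw [dslope_same]
  have : HasDerivAt (fun y : ℝ => Real.exp (2 * y) / 2) (Real.exp (2 * 0) * (2 * 1) / 2) 0 :=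
    (((hasDerivAt_id (0:ℝ)).const_mul 2).exp).div_const 2
  rw [this.deriv]; simp

lemma phi_contDiff : ContDiff ℝ 1 phi := by
  rw [contDiff_iff_contDiffAt]
  intro x
  have han : AnalyticAt ℝ (fun y : ℝ => Real.exp (2 * y) / 2) 0 := by fun_prop
  by_cases hx : x = 0
  · subst hx
    obtain ⟨p, hp⟩ := han
    have := hp.has_fpower_series_dslope_fslope
    exact this.analyticAt.contDiffAt
  · have : phi =ᶠ[nhds x] fun y => (Real.exp (2 * y) - 1) / (2 * y) := by
      filter_upwards [isOpen_ne.mem_nhds hx] with y hy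
      have := phi_mul y
      have hy' : y ≠ 0 := hy
      field_simp
      linarith
    refine ContDiffAt.congr_of_eventuallyEq ?_ this
    refine ContDiffAt.div (by fun_prop) (by fun_prop) (by simpa using hx)

noncomputable def ee (t x : ℝ) : ℝ := x * phi (t * x)

lemma ee_exp (t x : ℝ) : 1 + 2 * t * ee t x = Real.exp (2 * t * x) := by
  have := phi_mul (t * x)
  unfold ee
  rw [show 2 * t * x = 2 * (t * x) by ring, ← this]; ring

lemma ee_zero (x : ℝ) : ee 0 x = x := by simp [ee, phi_zero]

lemma ee_zero' (t : ℝ) : ee t 0 = 0 := by simp [ee]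

lemma ee_contDiff : ContDiff ℝ 1 (fun p : ℝ × ℝ => ee p.1 p.2) := by
  unfold ee
  exact contDiff_snd.mul (phi_contDiff.comp (contDiff_fst.mul contDiff_snd))

lemma ee_continuous : Continuous (fun p : ℝ × ℝ => ee p.1 p.2) := ee_contDiff.continuous

lemma ee_inj (t : ℝ) {x y : ℝ} (h : ee t x = ee t y) : x = y := by
  by_cases ht : t = 0
  · subst ht; simpa [ee_zero] using h
  · have h1 := ee_exp t x
    rw [h, ee_exp] at h1
    have := Real.exp_injective h1
    have h2 : (2 * t) ≠ 0 := by simpa using ht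
    exact (mul_left_cancel₀ h2 this).symm

lemma ee_hasDerivAt_zero (t : ℝ) : HasDerivAt (fun s => ee t s) 1 0 := by
  have h : DifferentiableAt ℝ (fun s => phi (t * s)) 0 := by
    have : ContDiff ℝ 1 (fun s => phi (t * s)) := phi_contDiff.comp (by fun_prop)
    exact (this.differentiable (by norm_num)).differentiableAt
  have := (hasDerivAt_id (0:ℝ)).mul h.hasDerivAt
  exact (show HasDerivAt (fun s => ee t s) _ 0 from this).congr_deriv (by simp [phi_zero])

/-- inverse of `ee t` -/
noncomputable def ll (t x : ℝ) : ℝ := if t = 0 then x else Real.log (1 + 2 * t * x) / (2 * t)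

lemma ee_ll (t x : ℝ) (h : 0 < 1 + 2 * t * x) : ee t (ll t x) = x := by
  by_cases ht : t = 0
  · subst ht; simp [ll, ee_zero]
  · have h1 := ee_exp t (ll t x)
    have h2 : (2 * t) ≠ 0 := by simpa using ht
    have h3 : 2 * t * ll t x = Real.log (1 + 2 * t * x) := by
      simp only [ll, if_neg ht]; field_simp
    rw [h3, Real.exp_log h] at h1
    exact mul_left_cancel₀ h2 (by linarith)

lemma ll_continuousAt (t x : ℝ) (h : 0 < 1 + 2 * t * x) : ContinuousAt (ll t) x := by
  by_cases ht : t = 0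
  · have : ll t = id := by funext y; simp [ll, ht]
    rw [this]; exact continuousAt_id
  · have : ll t = fun x => Real.log (1 + 2 * t * x) / (2 * t) := by
      funext y; simp [ll, ht]
    rw [this]
    have h1 : ContinuousAt (fun x : ℝ => 1 + 2 * t * x) x := by fun_prop
    exact (h1.log h.ne').div_const _

/-! ### matrices -/

variable {n : ℕ}

abbrev Mat (n : ℕ) := Matrix (Fin n) (Fin n) ℂ

/-- real diagonal matrix -/
noncomputable def dg (f : Fin n → ℝ) : Mat n := diagonal (fun i => (f i : ℂ))

lemma dg_mul (f g : Fin n → ℝ) : dg f * dg g = dg (fun i => f i * g i) := by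
  simp [dg]

lemma dg_add (f g : Fin n → ℝ) : dg f + dg g = dg (fun i => f i + g i) := by
  simp [dg]

lemma dg_smul (r : ℝ) (f : Fin n → ℝ) : (r : ℂ) • dg f = dg (fun i => r * f i) := by
  ext i j; by_cases h : i = j <;> simp [dg, h]

lemma dg_one : dg (fun _ : Fin n => (1 : ℝ)) = 1 := by simp [dg]

lemma dg_conjTranspose (f : Fin n → ℝ) : (dg f)ᴴ = dg f := by
  simp only [dg, diagonal_conjTranspose]
  congr 1; funext i; simp

lemma dg_isHermitian (f : Fin n → ℝ) : (dg f).IsHermitian := dg_conjTranspose f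

lemma dg_det (f : Fin n → ℝ) : (dg f).det = ((∏ i, f i : ℝ) : ℂ) := by simp [dg]

lemma dg_trace (f : Fin n → ℝ) : (dg f).trace = ((∑ i, f i : ℝ) : ℂ) := by
  simp [dg, Matrix.trace]

lemma dg_injective {f g : Fin n → ℝ} (h : dg f = dg g) : f = g := by
  funext i
  have := congrFun (congrFun h i) i
  simpa [dg] using this

/-- functional calculus transfer -/
lemma dg_transfer {x y : Fin n → ℝ} {W : Mat n} (h : W * dg x = dg y * W) (f g : Fin n → ℝ)
    (hfg : ∀ i j, y i = x j → g i = f j) : W * dg f = dg g * W := by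
  ext i j
  have h1 := congrFun (congrFun h i) j
  simp only [dg, mul_diagonal, diagonal_mul] at h1 ⊢
  by_cases hW : W i j = 0
  · simp [hW]
  · rw [mul_comm] at h1
    have h2 := mul_right_cancel₀ hW h1
    have h3 : y i = x j := by exact_mod_cast h2.symm
    rw [hfg i j h3, mul_comm]

lemma dg_transfer_fun {x y : Fin n → ℝ} {W : Mat n} (h : W * dg x = dg y * W) (f : ℝ → ℝ) :
    W * dg (fun i => f (x i)) = dg (fun i => f (y i)) * W :=
  dg_transfer h _ _ (fun i j hij => by rw [hij])

lemma dg_comm_diag {x : Fin n → ℝ} (hx : Function.Injective x) {Z : Mat n}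
    (h : Z * dg x = dg x * Z) : Z = diagonal (fun i => Z i i) := by
  ext i j
  by_cases hij : i = j
  · subst hij; simp
  · have h1 := congrFun (congrFun h i) j
    simp only [dg, mul_diagonal, diagonal_mul] at h1
    rw [diagonal_apply_ne _ hij]
    by_contra hW
    rw [mul_comm] at h1
    have h2 := mul_right_cancel₀ hW h1
    exact hij (hx (by exact_mod_cast h2.symm))

noncomputable def Et (t : ℝ) (a : Fin n → ℝ) : Mat n := dg (fun i => ee t (a i))
noncomputable def Pt (t : ℝ) (a : Fin n → ℝ) : Mat n := dg (fun i => Real.exp (t * a i))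
noncomputable def Pi' (t : ℝ) (a : Fin n → ℝ) : Mat n := dg (fun i => Real.exp (-(t * a i)))

noncomputable def Hm (t : ℝ) (a : Fin n → ℝ) (B : Mat n) : Mat n :=
  Et t a + Pt t a * B * Pt t a

def Sol (t : ℝ) (a b c : Fin n → ℝ) : Prop :=
  ∃ U V : Mat n, Uᴴ * U = 1 ∧ Vᴴ * V = 1 ∧ Hm t a (U * Et t b * Uᴴ) = V * Et t c * Vᴴ

lemma Pt_sq (t : ℝ) (a : Fin n → ℝ) : Pt t a * Pt t a = 1 + ((2 * t : ℝ) : ℂ) • Et t a := by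
  rw [Pt, Et, dg_mul, dg_smul, ← dg_one, dg_add]
  congr 1; funext i
  rw [ee_exp, ← Real.exp_add]; congr 1; ring

lemma Pt_mul_Pi (t : ℝ) (a : Fin n → ℝ) : Pt t a * Pi' t a = 1 := by
  rw [Pt, Pi', dg_mul, ← dg_one]
  congr 1; funext i
  rw [← Real.exp_add]; simp

lemma Pi_mul_Pt (t : ℝ) (a : Fin n → ℝ) : Pi' t a * Pt t a = 1 := by
  rw [Pt, Pi', dg_mul, ← dg_one]
  congr 1; funext i
  rw [← Real.exp_add]; simp

lemma one_add_Et (t : ℝ) (a : Fin n → ℝ) :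
    1 + ((2 * t : ℝ) : ℂ) • Et t a = dg (fun i => Real.exp (2 * t * a i)) := by
  rw [Et, dg_smul, ← dg_one, dg_add]
  congr 1; funext i
  rw [ee_exp]

lemma one_add_Hm (t : ℝ) (a : Fin n → ℝ) (B : Mat n) :
    1 + ((2 * t : ℝ) : ℂ) • Hm t a B = Pt t a * (1 + ((2 * t : ℝ) : ℂ) • B) * Pt t a := by
  rw [Hm, smul_add, ← add_assoc, ← Pt_sq]
  simp only [mul_add, add_mul, mul_one, Algebra.mul_smul_comm, Algebra.smul_mul_assoc]

lemma Hm_isHermitian (t : ℝ) (a : Fin n → ℝ) {B : Mat n} (hB : B.IsHermitian) :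
    (Hm t a B).IsHermitian := by
  unfold Hm Matrix.IsHermitian
  rw [conjTranspose_add, conjTranspose_mul, conjTranspose_mul, hB]
  simp only [Et, Pt, dg_conjTranspose, mul_assoc]

lemma uu {U : Mat n} (h : Uᴴ * U = 1) : U * Uᴴ = 1 := mul_eq_one_comm.mp h

end MH

namespace MH
variable {n : ℕ}

lemma comm_algebra {A P B H W : Mat n} {τ : ℂ} (hH : H = A + P * B * P)
    (hP : P * P = 1 + τ • A) (hWH : W * H = H * W) (hB : (P * W * P) * B = B * (P * W * P)) :
    ((1 + τ • H) * W) * A = A * ((1 + τ • H) * W) := by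
  have h0 : (P * B * P) * W * (P * P) = (P * P) * W * (P * B * P) := by
    calc (P * B * P) * W * (P * P) = P * (B * (P * W * P)) * P := by simp only [mul_assoc]
      _ = P * ((P * W * P) * B) * P := by rw [hB]
      _ = _ := by simp only [mul_assoc]
  have h1 : P * B * P = H - A := by rw [hH]; abel
  rw [h1, hP] at h0
  have h2 : A * W * H = A * H * W := by rw [mul_assoc, hWH, mul_assoc]
  simp only [mul_add, add_mul, sub_mul, mul_sub, mul_one, one_mul, Algebra.mul_smul_comm,
    Algebra.smul_mul_assoc, smul_sub, hWH, h2, ← mul_assoc] at h0 ⊢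
  linear_combination (norm := module) h0

/-- irreducibility of the pair `(diag a, B)` -/
def Irr (a : Fin n → ℝ) (B : Mat n) : Prop :=
  ∀ Z : Mat n, Z * dg a = dg a * Z → Z * B = B * Z → ∃ μ : ℂ, Z = μ • (1 : Mat n)

lemma cd_transfer {z z' : Fin n → ℂ} {U : Mat n} (h : diagonal z * U = U * diagonal z')
    (f g : Fin n → ℝ) (hfg : ∀ i j, z i = z' j → g i = f j) : dg g * U = U * dg f := by
  ext i j
  have h1 := congrFun (congrFun h i) j
  simp only [dg, mul_diagonal, diagonal_mul] at h1 ⊢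
  by_cases hW : U i j = 0
  · simp [hW]
  · rw [mul_comm (U i j)] at h1
    have h2 := mul_right_cancel₀ hW h1
    rw [hfg i j h2, mul_comm]

/-- indicator-like vector -/
noncomputable def ind (I : Finset (Fin n)) (x y : Fin n → ℝ) : Fin n → ℝ :=
  fun i => if i ∈ I then x i else y i

lemma conj_diag {x : Fin n → ℝ} (hx : Function.Injective x) {U Z : Mat n} (hU : Uᴴ * U = 1)
    (hZ : Z * (U * dg x * Uᴴ) = (U * dg x * Uᴴ) * Z) :
    ∃ z' : Fin n → ℂ, Z * U = U * diagonal z' := by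
  have hU' := uu hU
  have h1 : (Uᴴ * Z * U) * dg x = dg x * (Uᴴ * Z * U) := by
    calc (Uᴴ * Z * U) * dg x = Uᴴ * (Z * (U * dg x * Uᴴ)) * U := by
          simp only [mul_assoc, hU, mul_one]
      _ = Uᴴ * ((U * dg x * Uᴴ) * Z) * U := by rw [hZ]
      _ = (Uᴴ * U) * dg x * (Uᴴ * Z * U) := by simp only [mul_assoc]
      _ = _ := by rw [hU, one_mul]
  refine ⟨fun i => (Uᴴ * Z * U) i i, ?_⟩
  rw [← dg_comm_diag hx h1, mul_assoc, ← mul_assoc, hU', one_mul]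

lemma det_conj {U X : Mat n} (hU : Uᴴ * U = 1) : (U * X * Uᴴ).det = X.det := by
  rw [det_mul, det_mul, mul_comm, ← mul_assoc, ← det_mul, hU, det_one, one_mul]

lemma trace_conj {U X : Mat n} (hU : Uᴴ * U = 1) : (U * X * Uᴴ).trace = X.trace := by
  rw [trace_mul_comm, ← mul_assoc, hU, one_mul]

lemma sum_ind (I : Finset (Fin n)) (x : Fin n → ℝ) :
    ∑ i, ind I x 0 i = ∑ i ∈ I, x i := by
  simp [ind, Finset.sum_ite_mem]

lemma prod_ind (I : Finset (Fin n)) (x : Fin n → ℝ) :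
    ∏ i, ind I (fun i => Real.exp (x i)) 1 i = Real.exp (∑ i ∈ I, x i) := by
  simp [ind, Finset.prod_ite_mem, Real.exp_sum]

lemma ind_dg (I : Finset (Fin n)) (x : Fin n → ℝ) :
    dg (ind I 1 0) * dg x + (1 - dg (ind I 1 0)) = dg (ind I x 1) := by
  ext i j
  by_cases h : i = j
  · subst h
    by_cases hi : i ∈ I <;> simp [dg, ind, hi]
  · simp [dg, h]

lemma ind_dg_conj (I J : Finset (Fin n)) {U : Mat n} (hU : Uᴴ * U = 1) (x : Fin n → ℝ)
    (h : dg (ind I 1 0) * U = U * dg (ind J 1 0)) :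
    dg (ind I 1 0) * (U * dg x * Uᴴ) + (1 - dg (ind I 1 0)) = U * dg (ind J x 1) * Uᴴ := by
  have hU' := uu hU
  have h1 : dg (ind I 1 0) = U * dg (ind J 1 0) * Uᴴ := by
    rw [← h, mul_assoc, hU', mul_one]
  calc dg (ind I 1 0) * (U * dg x * Uᴴ) + (1 - dg (ind I 1 0))
      = (dg (ind I 1 0) * U) * dg x * Uᴴ + (U * Uᴴ - U * dg (ind J 1 0) * Uᴴ) := by
        rw [hU', ← h1]; simp only [mul_assoc]
    _ = U * (dg (ind J 1 0) * dg x + (1 - dg (ind J 1 0))) * Uᴴ := by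
        rw [h]; noncomm_ring
    _ = _ := by rw [ind_dg]

lemma trace_ind_conj (I J : Finset (Fin n)) {U : Mat n} (hU : Uᴴ * U = 1) (x : Fin n → ℝ)
    (h : dg (ind I 1 0) * U = U * dg (ind J 1 0)) :
    (dg (ind I 1 0) * (U * dg x * Uᴴ)).trace = ((∑ j ∈ J, x j : ℝ) : ℂ) := by
  have : dg (ind I 1 0) * (U * dg x * Uᴴ) = U * dg (ind J x 0) * Uᴴ := by
    rw [← mul_assoc, ← mul_assoc, h, mul_assoc U, dg_mul]
    congr 3
    funext i; by_cases hi : i ∈ J <;> simp [ind, hi]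
  rw [this, trace_conj hU, dg_trace, sum_ind]

theorem irr_of_generic {t : ℝ} {a b c : Fin n → ℝ} (ha : Function.Injective a)
    (hb : Function.Injective b) (hc : Function.Injective c)
    (hT : ∀ I J K : Finset (Fin n), I.card = K.card → J.card = K.card → K.Nonempty →
      K ≠ Finset.univ → ∑ i ∈ I, a i + ∑ j ∈ J, b j ≠ ∑ k ∈ K, c k)
    {U V : Mat n} (hU : Uᴴ * U = 1) (hV : Vᴴ * V = 1)
    (hEq : Hm t a (U * Et t b * Uᴴ) = V * Et t c * Vᴴ) : Irr a (U * Et t b * Uᴴ) := by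
  intro Z hZa hZB
  have hZE : Z * Et t a = Et t a * Z := dg_transfer_fun hZa (ee t)
  have hZP : Z * Pt t a = Pt t a * Z := dg_transfer_fun hZa (fun x => Real.exp (t * x))
  have hZH : Z * (V * Et t c * Vᴴ) = (V * Et t c * Vᴴ) * Z := by
    rw [← hEq, Hm, mul_add, add_mul, hZE]
    congr 1
    rw [← mul_assoc, ← mul_assoc, hZP, mul_assoc (Pt t a) Z, hZB, mul_assoc, mul_assoc, hZP]
    simp only [mul_assoc]
  have hbi : Function.Injective (fun i => ee t (b i)) := fun i j h => hb (ee_inj t h)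
  have hci : Function.Injective (fun i => ee t (c i)) := fun i j h => hc (ee_inj t h)
  obtain ⟨z', hz'⟩ := conj_diag hbi hU hZB
  obtain ⟨z'', hz''⟩ := conj_diag hci hV hZH
  have hZd := dg_comm_diag ha hZa
  set z : Fin n → ℂ := fun i => Z i i with hz
  by_cases hconst : ∀ i j, z i = z j
  · rcases Nat.eq_zero_or_pos n with h0 | h0
    · subst h0; exact ⟨0, Subsingleton.elim _ _⟩
    · refine ⟨z ⟨0, h0⟩, ?_⟩
      rw [hZd]; ext i j
      by_cases hij : i = j
      · subst hij; simp; exact hconst _ _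
      · simp [hij]
  exfalso
  push Not at hconst
  obtain ⟨i0, i1, hne⟩ := hconst
  let I : Finset (Fin n) := Finset.univ.filter (fun i => z i = z i0)
  let J : Finset (Fin n) := Finset.univ.filter (fun i => z' i = z i0)
  let K : Finset (Fin n) := Finset.univ.filter (fun i => z'' i = z i0)
  rw [hZd] at hz' hz''
  have hIU : dg (ind I 1 0) * U = U * dg (ind J 1 0) := by
    refine cd_transfer hz' _ _ (fun i j hij => ?_)
    simp [ind, I, J, hij]
  have hIV : dg (ind I 1 0) * V = V * dg (ind K 1 0) := by
    refine cd_transfer hz'' _ _ (fun i j hij => ?_)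
    simp [ind, I, K, hij]
  have cardEq : ∀ (J : Finset (Fin n)) (U : Mat n), Uᴴ * U = 1 →
      dg (ind I 1 0) * U = U * dg (ind J 1 0) → I.card = J.card := by
    intro J U hU h
    have h1 := trace_ind_conj I J hU 1 h
    have h2 := trace_ind_conj I I (U := (1 : Mat n)) (by simp) 1 (by simp)
    have : (dg (1 : Fin n → ℝ)) = 1 := dg_one
    simp only [this, mul_one, uu hU, conjTranspose_one] at h1 h2
    rw [h1] at h2
    have h3 : (∑ j ∈ J, (1 : Fin n → ℝ) j) = ∑ j ∈ I, (1 : Fin n → ℝ) j := by exact_mod_cast h2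
    simp at h3
    exact h3.symm
  have hIJ := cardEq J U hU hIU
  have hIK := cardEq K V hV hIV
  have hIne : I.Nonempty := ⟨i0, by simp [I]⟩
  have hIun : I.card < n := by
    have : I ⊂ Finset.univ := by
      rw [Finset.ssubset_univ_iff]
      intro h
      have : i1 ∈ I := by rw [h]; simp
      simp [I] at this
      exact hne this.symm
    simpa using Finset.card_lt_card this
  refine hT I J K hIK (hIJ.symm.trans hIK) ?_ ?_ ?_
  · rw [← Finset.card_pos, ← hIK]; exact Finset.card_pos.mpr hIne
  · intro h
    rw [h] at hIK; simp at hIK; omega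
  by_cases ht : t = 0
  · subst ht
    have e0 : ∀ x : Fin n → ℝ, Et 0 x = dg x := fun x => by simp [Et, ee_zero]
    have p0 : Pt 0 a = 1 := by rw [Pt, ← dg_one]; simp
    have h1 := congrArg (fun X => (dg (ind I 1 0) * X).trace) hEq
    simp only [Hm, e0, p0, one_mul, mul_one, mul_add, trace_add] at h1
    rw [trace_ind_conj I J hU b hIU, trace_ind_conj I K hV c hIV] at h1
    have h2 := trace_ind_conj I I (U := (1 : Mat n)) (by simp) a (by simp)
    simp only [one_mul, mul_one, conjTranspose_one] at h2
    rw [h2] at h1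
    exact_mod_cast h1
  · have h1 := one_add_Hm t a (U * Et t b * Uᴴ)
    have key : ∀ (U : Mat n) (b : Fin n → ℝ), Uᴴ * U = 1 → 1 + ((2 * t : ℝ) : ℂ) • (U * Et t b * Uᴴ)
        = U * dg (fun i => Real.exp (2 * t * b i)) * Uᴴ := by
      intro U b hU
      rw [← one_add_Et, mul_add, add_mul, mul_one, uu hU]
      simp
    rw [hEq, key U b hU, key V c hV] at h1
    set Q := dg (ind I (1 : Fin n → ℝ) 0) with hQ
    have hQQ : Q * Q = Q := by
      rw [hQ, dg_mul]; congr 1; funext i; by_cases hi : i ∈ I <;> simp [ind, hi]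
    have hQP : Q * Pt t a = Pt t a * Q := by
      rw [hQ, Pt, dg_mul, dg_mul]; congr 1; funext i; ring
    have gm : ∀ X Y : Mat n, Q * X = X * Q →
        (Q * X + (1 - Q)) * (Q * Y + (1 - Q)) = Q * (X * Y) + (1 - Q) := by
      intro X Y hX
      have a2 : Q * X * Q = Q * X := by rw [mul_assoc, ← hX, ← mul_assoc, hQQ]
      simp only [mul_add, add_mul, mul_sub, sub_mul, mul_one, one_mul, ← mul_assoc, a2, hQQ]
      abel
    have h2 : (Q * Pt t a + (1 - Q)) * (Q * (U * dg (fun i => Real.exp (2 * t * b i)) * Uᴴ) + (1 - Q))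
        * (Q * Pt t a + (1 - Q)) = Q * (V * dg (fun i => Real.exp (2 * t * c i)) * Vᴴ) + (1 - Q) := by
      rw [gm _ _ hQP, gm _ _ ?_, h1]
      have : Q * (U * dg (fun i => Real.exp (2 * t * b i)) * Uᴴ)
          = (U * dg (fun i => Real.exp (2 * t * b i)) * Uᴴ) * Q := by
        have hQU : Q = U * dg (ind J 1 0) * Uᴴ := by rw [← hIU, mul_assoc, uu hU, mul_one]
        rw [hQU]
        calc U * dg (ind J 1 0) * Uᴴ * (U * dg (fun i => Real.exp (2 * t * b i)) * Uᴴ)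
            = U * (dg (ind J 1 0) * (Uᴴ * U) * dg (fun i => Real.exp (2 * t * b i))) * Uᴴ := by
              simp only [mul_assoc]
          _ = U * (dg (fun i => Real.exp (2 * t * b i)) * (Uᴴ * U) * dg (ind J 1 0)) * Uᴴ := by
              rw [hU, mul_one, mul_one, dg_mul, dg_mul]; congr 3; funext i; ring
          _ = _ := by simp only [mul_assoc]
      rw [← mul_assoc, hQP, mul_assoc, this]
      simp only [mul_assoc]
    rw [ind_dg_conj I J hU _ hIU, ind_dg_conj I K hV _ hIV, Pt, ind_dg] at h2
    have h3 := congrArg Matrix.det h2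
    rw [det_mul, det_mul, det_conj hU, det_conj hV, dg_det, dg_det, dg_det, prod_ind, prod_ind,
      prod_ind] at h3
    have h4 : Real.exp (∑ i ∈ I, t * a i) * Real.exp (∑ i ∈ J, 2 * t * b i)
      * Real.exp (∑ i ∈ I, t * a i) = Real.exp (∑ i ∈ K, 2 * t * c i) := by exact_mod_cast h3
    rw [← Real.exp_add, ← Real.exp_add] at h4
    have h5 := Real.exp_injective h4
    rw [← Finset.mul_sum, ← Finset.mul_sum, ← Finset.mul_sum] at h5
    have h6 : 2 * t * (∑ i ∈ I, a i + ∑ j ∈ J, b j) = 2 * t * ∑ k ∈ K, c k := by linarith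
    exact mul_left_cancel₀ (by simpa using ht) h6

lemma isCompact_unitary : IsCompact {U : Mat n | Uᴴ * U = 1} := by
  refine IsCompact.of_isClosed_subset
    (isCompact_univ_pi fun _ : Fin n => isCompact_univ_pi fun _ : Fin n =>
      isCompact_closedBall (0 : ℂ) 1) ?_ ?_
  · exact isClosed_eq (by fun_prop) continuous_const
  · intro U hU i _ j _
    simp only [Metric.mem_closedBall, dist_zero_right]
    exact entry_norm_bound_of_unitary (mem_unitaryGroup_iff'.mpr hU) i j

lemma continuous_dg : Continuous (fun f : Fin n → ℝ => dg f) := by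
  unfold dg; fun_prop

lemma continuous_Et : Continuous (fun p : ℝ × (Fin n → ℝ) => Et p.1 p.2) := by
  unfold Et
  refine continuous_dg.comp (continuous_pi fun i => ?_)
  exact ee_continuous.comp (by fun_prop : Continuous fun p : ℝ × (Fin n → ℝ) => (p.1, p.2 i))

lemma continuous_Pt : Continuous (fun p : ℝ × (Fin n → ℝ) => Pt p.1 p.2) := by
  unfold Pt
  exact continuous_dg.comp (continuous_pi fun i => by fun_prop)

lemma continuous_Hm : Continuous (fun p : ℝ × (Fin n → ℝ) × Mat n => Hm p.1 p.2.1 p.2.2) := by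
  unfold Hm
  have h1 : Continuous (fun p : ℝ × (Fin n → ℝ) × Mat n => Et p.1 p.2.1) :=
    continuous_Et.comp (by fun_prop : Continuous fun p : ℝ × (Fin n → ℝ) × Mat n => (p.1, p.2.1))
  have h2 : Continuous (fun p : ℝ × (Fin n → ℝ) × Mat n => Pt p.1 p.2.1) :=
    continuous_Pt.comp (by fun_prop : Continuous fun p : ℝ × (Fin n → ℝ) × Mat n => (p.1, p.2.1))
  fun_prop

abbrev XX (n : ℕ) := ℝ × (Fin n → ℝ) × (Fin n → ℝ) × (Fin n → ℝ)

theorem isClosed_sol : IsClosed {p : ℝ × (Fin n → ℝ) × (Fin n → ℝ) × (Fin n → ℝ) |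
    Sol p.1 p.2.1 p.2.2.1 p.2.2.2} := by
  let S := {U : Mat n | Uᴴ * U = 1}
  have : CompactSpace S := isCompact_iff_compactSpace.mp isCompact_unitary
  let C : Set ((S × S) × XX n) := {q | Hm q.2.1 q.2.2.1 ((q.1.1 : Mat n) * Et q.2.1 q.2.2.2.1 *
    (q.1.1 : Mat n)ᴴ) = (q.1.2 : Mat n) * Et q.2.1 q.2.2.2.2 * (q.1.2 : Mat n)ᴴ}
  have hC : IsClosed C := by
    have hb : Continuous (fun q : (S × S) × XX n => Et q.2.1 q.2.2.2.1) :=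
      continuous_Et.comp (by fun_prop : Continuous fun q : (S × S) × XX n => (q.2.1, q.2.2.2.1))
    have hc : Continuous (fun q : (S × S) × XX n => Et q.2.1 q.2.2.2.2) :=
      continuous_Et.comp (by fun_prop : Continuous fun q : (S × S) × XX n => (q.2.1, q.2.2.2.2))
    have h1 : Continuous (fun q : (S × S) × XX n => ((q.2.1, q.2.2.1, (q.1.1 : Mat n) *
      Et q.2.1 q.2.2.2.1 * (q.1.1 : Mat n)ᴴ) : ℝ × (Fin n → ℝ) × Mat n)) := by fun_prop
    refine isClosed_eq (continuous_Hm.comp h1) ?_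
    fun_prop
  have := isClosedMap_snd_of_compactSpace (X := S × S) (Y := XX n) C hC
  convert this using 1
  ext p
  constructor
  · rintro ⟨U, V, hU, hV, h⟩
    exact ⟨((⟨U, hU⟩, ⟨V, hV⟩), p), h, rfl⟩
  · rintro ⟨⟨⟨U, V⟩, q⟩, h, rfl⟩
    exact ⟨U, V, U.2, V.2, h⟩

end MH

namespace MH
variable {n : ℕ}

lemma re_trace_mul (W N : Mat n) :
    (W * N).trace.re = ∑ i, ∑ j, (W j i * N i j).re := by
  rw [trace_mul_comm]
  simp only [Matrix.trace, Matrix.diag, mul_apply, Complex.re_sum]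
  refine Finset.sum_congr rfl fun i _ => Finset.sum_congr rfl fun j _ => ?_
  rw [mul_comm]

lemma functional_rep (f : Mat n →ₗ[ℝ] ℝ) : ∃ W : Mat n, ∀ N, f N = (W * N).trace.re := by
  refine ⟨Matrix.of fun j i => (f (Matrix.single i j 1) : ℂ) - Complex.I * f (Matrix.single i j Complex.I),
    fun N => ?_⟩
  rw [re_trace_mul]
  conv_lhs => rw [matrix_eq_sum_single N]
  rw [map_sum]
  refine Finset.sum_congr rfl fun i _ => ?_
  rw [map_sum]
  refine Finset.sum_congr rfl fun j _ => ?_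
  have : Matrix.single i j (N i j) = (N i j).re • Matrix.single i j (1 : ℂ)
      + (N i j).im • Matrix.single i j Complex.I := by
    rw [Matrix.smul_single, Matrix.smul_single, ← Matrix.single_add]
    congr 1
    simp
  rw [this, map_add, map_smul, map_smul]
  simp
  ring

lemma eq_zero_of_re_trace {D : Mat n} (h : (D * Dᴴ).trace.re = 0) : D = 0 := by
  rw [re_trace_mul] at h
  have h0 : ∀ i j, (D j i * Dᴴ i j).re = Complex.normSq (D j i) := by
    intro i j
    rw [conjTranspose_apply, Complex.star_def, Complex.mul_conj]; simp
  simp only [h0] at h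
  rw [Finset.sum_eq_zero_iff_of_nonneg
    (fun i _ => Finset.sum_nonneg fun j _ => Complex.normSq_nonneg _)] at h
  ext j i
  have h1 := h i (Finset.mem_univ _)
  rw [Finset.sum_eq_zero_iff_of_nonneg (fun j _ => Complex.normSq_nonneg _)] at h1
  simpa using h1 j (Finset.mem_univ _)

lemma comm_of_trace {W C : Mat n} (hW : Wᴴ = W) (hC : Cᴴ = C)
    (h : ∀ Y : Mat n, (W * ((Y - Yᴴ) * C - C * (Y - Yᴴ))).trace.re = 0) : W * C = C * W := by
  set D := C * W - W * C with hD
  have hDD : Dᴴ = -D := by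
    rw [hD, conjTranspose_sub, conjTranspose_mul, conjTranspose_mul, hW, hC]; abel
  have h1 := h Dᴴ
  have h2 : Dᴴ - Dᴴᴴ = (2 : ℝ) • Dᴴ := by
    rw [conjTranspose_conjTranspose, hDD, two_smul]; abel
  rw [h2] at h1
  have h3 : (W * ((2 : ℝ) • Dᴴ * C - C * (2 : ℝ) • Dᴴ)).trace = (2 : ℝ) • (D * Dᴴ).trace := by
    rw [← trace_smul, mul_sub, trace_sub, ← mul_assoc, trace_mul_comm, ← mul_assoc, ← mul_assoc,
      ← trace_sub, ← sub_mul, ← hD, Algebra.mul_smul_comm]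
  rw [h3] at h1
  have h4 : (D * Dᴴ).trace.re = 0 := by simpa using h1
  have := eq_zero_of_re_trace h4
  rw [hD, sub_eq_zero] at this
  exact this.symm

theorem surj_of_irr {t : ℝ} {a : Fin n → ℝ} {B H : Mat n} (hB : Bᴴ = B) (hirr : Irr a B)
    (hH : H = Hm t a B) (hM : IsUnit (1 + ((2 * t : ℝ) : ℂ) • H))
    (L : (Mat n × Mat n × ℝ × Mat n) →ₗ[ℝ] Mat n)
    (hL : ∀ X Y z S, L (X, Y, z, S) = Pt t a * ((X - Xᴴ) * B - B * (X - Xᴴ)) * Pt t a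
      + z • (1 + ((2 * t : ℝ) : ℂ) • H) - ((Y - Yᴴ) * H - H * (Y - Yᴴ)) + (S - Sᴴ)) :
    LinearMap.range L = ⊤ := by
  by_contra hne
  obtain ⟨f, hf0, hf⟩ := Submodule.exists_le_ker_of_lt_top _ (lt_top_iff_ne_top.mpr hne)
  obtain ⟨W, hW⟩ := functional_rep f
  have hfz : ∀ X Y z S, (W * L (X, Y, z, S)).trace.re = 0 := by
    intro X Y z S
    rw [← hW]
    exact hf ⟨_, rfl⟩
  have hHh : Hᴴ = H := by rw [hH]; exact Hm_isHermitian t a hB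
  have hPh : (Pt t a)ᴴ = Pt t a := dg_conjTranspose _
  -- W hermitian
  have hWh : Wᴴ = W := by
    have h1 : ∀ S : Mat n, (W * (S - Sᴴ)).trace.re = 0 := by
      intro S
      have := hfz 0 0 0 S
      rw [hL] at this
      simpa using this
    have h2 := h1 ((W - Wᴴ)ᴴ)
    have h3 : ((W - Wᴴ) * (W - Wᴴ)ᴴ).trace.re = 0 := by
      have e1 : (Wᴴ * (W - Wᴴ)ᴴ).trace.re = (W * (W - Wᴴ)).trace.re := by
        rw [← conjTranspose_mul, trace_conjTranspose, trace_mul_comm]; simp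
      rw [conjTranspose_conjTranspose, mul_sub, trace_sub, Complex.sub_re] at h2
      rw [sub_mul, trace_sub, Complex.sub_re, e1]
      exact h2
    have := eq_zero_of_re_trace h3
    exact (sub_eq_zero.mp this).symm
  have hWH : W * H = H * W := by
    refine comm_of_trace hWh hHh fun Y => ?_
    have := hfz 0 Y 0 0
    rw [hL] at this
    simp only [conjTranspose_zero, sub_zero, zero_mul, mul_zero, zero_smul, add_zero, zero_sub,
      mul_neg, trace_neg, Complex.neg_re, neg_eq_zero] at this
    exact this
  have hPWP : (Pt t a * W * Pt t a) * B = B * (Pt t a * W * Pt t a) := by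
    refine comm_of_trace ?_ hB fun X => ?_
    · rw [conjTranspose_mul, conjTranspose_mul, hPh, hWh, mul_assoc]
    · have := hfz X 0 0 0
      rw [hL] at this
      simp only [conjTranspose_zero, sub_zero, zero_mul, mul_zero, zero_smul, add_zero] at this
      rw [← this]
      congr 1
      rw [mul_assoc (Pt t a * W), mul_assoc (Pt t a), trace_mul_comm]
      simp only [mul_assoc]
  have htr : (W * (1 + ((2 * t : ℝ) : ℂ) • H)).trace.re = 0 := by
    have := hfz 0 0 1 0
    rw [hL] at this
    simpa using this
  set M := 1 + ((2 * t : ℝ) : ℂ) • H with hMdef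
  have hMW : M * W = W * M := by
    rw [hMdef, add_mul, mul_add, one_mul, mul_one, Algebra.smul_mul_assoc, Algebra.mul_smul_comm,
      hWH]
  have hZA : (M * W) * Et t a = Et t a * (M * W) :=
    comm_algebra hH (Pt_sq t a) hWH hPWP
  have hZa : (M * W) * dg a = dg a * (M * W) :=
    dg_transfer hZA _ _ (fun i j h => ee_inj t h)
  have hZP : (M * W) * Pt t a = Pt t a * (M * W) :=
    dg_transfer_fun hZa (fun x => Real.exp (t * x))
  have hMH : M * H = H * M := by
    rw [hMdef, add_mul, mul_add, one_mul, mul_one, Algebra.smul_mul_assoc, Algebra.mul_smul_comm]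
  have hZH : (M * W) * H = H * (M * W) := by
    rw [mul_assoc, hWH, ← mul_assoc, hMH, mul_assoc]
  have hPBP : Pt t a * B * Pt t a = H - Et t a := by rw [hH, Hm]; abel
  have hBe : B = Pi' t a * (H - Et t a) * Pi' t a := by
    rw [← hPBP]
    calc B = (Pi' t a * Pt t a) * B * (Pt t a * Pi' t a) := by
          rw [Pi_mul_Pt, Pt_mul_Pi, one_mul, mul_one]
      _ = _ := by simp only [mul_assoc]
  have hZPi : (M * W) * Pi' t a = Pi' t a * (M * W) :=
    dg_transfer_fun hZa (fun x => Real.exp (-(t * x)))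
  have hZB : (M * W) * B = B * (M * W) := by
    have h1 : (M * W) * (H - Et t a) = (H - Et t a) * (M * W) := by
      rw [mul_sub, sub_mul, hZH, hZA]
    rw [hBe]
    calc M * W * (Pi' t a * (H - Et t a) * Pi' t a)
        = ((M * W) * Pi' t a) * (H - Et t a) * Pi' t a := by simp only [mul_assoc]
      _ = Pi' t a * ((M * W) * (H - Et t a)) * Pi' t a := by rw [hZPi]; simp only [mul_assoc]
      _ = Pi' t a * (H - Et t a) * ((M * W) * Pi' t a) := by rw [h1]; simp only [mul_assoc]
      _ = _ := by rw [hZPi]; simp only [mul_assoc]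
  obtain ⟨μ, hμ⟩ := hirr _ hZa hZB
  have hW0 : W = 0 := by
    rcases Nat.eq_zero_or_pos n with h0 | h0
    · subst h0; exact Subsingleton.elim _ _
    have hMh : Mᴴ = M := by
      rw [hMdef, conjTranspose_add, conjTranspose_smul, conjTranspose_one, hHh]
      simp
    have h1 : (M * W)ᴴ = M * W := by rw [conjTranspose_mul, hWh, hMh, hMW]
    rw [hμ] at h1
    have h2 := congrFun (congrFun h1 ⟨0, h0⟩) ⟨0, h0⟩
    simp at h2
    rw [← hMW, hμ] at htr
    simp at htr
    have hre : μ.re = 0 := by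
      rcases htr with h | h
      · exact h
      · omega
    have him : μ.im = 0 := by
      have := congrArg Complex.im h2
      simp at this; linarith
    have hμ0 : μ = 0 := Complex.ext hre him
    rw [hμ0, zero_smul] at hμ
    exact (hM.mul_right_eq_zero).mp hμ
  apply hf0
  ext N
  rw [hW, hW0]; simp

lemma sol_of_scaled {t z : ℝ} {a b c : Fin n → ℝ} {U V : Mat n} (hU : Uᴴ * U = 1)
    (hV : Vᴴ * V = 1) (hs : ∑ i, a i + ∑ i, b i = ∑ i, c i)
    (h : Hm t a (U * Et t b * Uᴴ) + (ee t z) • (1 + ((2 * t : ℝ) : ℂ) • Hm t a (U * Et t b * Uᴴ))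
      = V * Et t c * Vᴴ) : Sol t a b c := by
  refine ⟨U, V, hU, hV, ?_⟩
  rcases Nat.eq_zero_or_pos n with h0 | h0
  · subst h0; exact Subsingleton.elim _ _
  have hn : (n : ℝ) ≠ 0 := by exact_mod_cast h0.ne'
  have hz : z = 0 := by
    by_cases ht : t = 0
    · subst ht
      have e0 : ∀ x : Fin n → ℝ, Et 0 x = dg x := fun x => by simp [Et, ee_zero]
      have p0 : Pt 0 a = 1 := by rw [Pt, ← dg_one]; simp
      have h1 := congrArg (fun X => (Matrix.trace X).re) h
      simp only [trace_add, trace_conj hV, Hm, e0, p0, one_mul, mul_one, trace_conj hU, dg_trace,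
        mul_zero, Complex.ofReal_zero, zero_smul, add_zero, trace_smul, trace_one, ee_zero,
        Complex.add_re, Complex.ofReal_re] at h1
      rw [← hs] at h1
      simp at h1
      rcases h1 with h1 | h1
      · exact h1
      · omega
    · set H := Hm t a (U * Et t b * Uᴴ) with hH
      have key : ∀ (U : Mat n) (b : Fin n → ℝ), Uᴴ * U = 1 →
          1 + ((2 * t : ℝ) : ℂ) • (U * Et t b * Uᴴ)
          = U * dg (fun i => Real.exp (2 * t * b i)) * Uᴴ := by
        intro U b hU
        rw [← one_add_Et, mul_add, add_mul, mul_one, uu hU]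
        simp
      have h1 : 1 + ((2 * t : ℝ) : ℂ) • (H + (ee t z) • (1 + ((2 * t : ℝ) : ℂ) • H))
          = ((Real.exp (2 * t * z) : ℝ) : ℂ) • (1 + ((2 * t : ℝ) : ℂ) • H) := by
        rw [← ee_exp, ← Complex.coe_smul (ee t z)]
        push_cast
        module
      rw [h, key V c hV, hH, one_add_Hm, key U b hU] at h1
      have h2 := congrArg Matrix.det h1
      rw [det_conj hV, det_smul, det_mul, det_mul, det_conj hU, Pt, dg_det, dg_det, dg_det,
        ← Real.exp_sum, ← Real.exp_sum, ← Real.exp_sum, Fintype.card_fin, ← Complex.ofReal_pow,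
        ← Complex.ofReal_mul, ← Complex.ofReal_mul, ← Complex.ofReal_mul, ← Real.exp_nat_mul,
        ← Real.exp_add, ← Real.exp_add, ← Real.exp_add] at h2
      have h3 := Real.exp_injective (Complex.ofReal_injective h2)
      rw [← Finset.mul_sum, ← Finset.mul_sum, ← Finset.mul_sum] at h3
      have h4 : (n : ℝ) * (2 * t * z) = 0 := by rw [← hs] at h3; linarith
      have h5 : (2 * t * z) = 0 := by
        rcases mul_eq_zero.mp h4 with h | h
        · exact absurd h hn
        · exact h
      simpa [ht] using h5
  subst hz
  rw [ee_zero', zero_smul, add_zero] at h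
  exact h

end MH

namespace MH
variable {n : ℕ}

section normed

attribute [local instance] Matrix.linftyOpNormedAddCommGroup Matrix.linftyOpNormedSpace
  Matrix.linftyOpNormedRing Matrix.linftyOpNormedAlgebra

noncomputable def dgL : (Fin n → ℝ) →L[ℝ] Mat n :=
  LinearMap.toContinuousLinearMap
    { toFun := fun f => dg f
      map_add' := fun f g => (dg_add f g).symm
      map_smul' := fun r f => by
        ext i j; by_cases h : i = j <;> simp [dg, h] }

lemma dgL_apply (f : Fin n → ℝ) : dgL f = dg f := rfl

noncomputable def ctL : Mat n →L[ℝ] Mat n :=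
  LinearMap.toContinuousLinearMap
    { toFun := fun f => fᴴ
      map_add' := fun f g => conjTranspose_add f g
      map_smul' := fun r f => by simp }

lemma ctL_apply (f : Mat n) : ctL f = fᴴ := rfl

noncomputable def UX (U0 X : Mat n) : Mat n := NormedSpace.exp (X - Xᴴ) * U0

lemma UX_unitary {U0 : Mat n} (h : U0ᴴ * U0 = 1) (X : Mat n) : (UX U0 X)ᴴ * UX U0 X = 1 := by
  have : @ContinuousStar (Mat n) PseudoMetricSpace.toUniformSpace.toTopologicalSpace _ :=
    @ContinuousStar.mk (Mat n) PseudoMetricSpace.toUniformSpace.toTopologicalSpace _ ctL.continuous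
  have : NormedSpace.exp (X - Xᴴ) ∈ unitary (Mat n) := by
    apply NormedSpace.exp_mem_unitary_of_mem_skewAdjoint
    rw [skewAdjoint.mem_iff]
    simp [star_eq_conjTranspose]
  have h1 := (Unitary.mem_iff.mp this).1
  rw [star_eq_conjTranspose] at h1
  rw [UX, conjTranspose_mul, mul_assoc, ← mul_assoc _ _ U0, h1, one_mul, h]

lemma UX_contDiff (U0 : Mat n) : ContDiff ℝ 1 (UX U0) := by
  have h1 : ContDiff ℝ 1 (fun X : Mat n => NormedSpace.exp X) := by
    rw [contDiff_iff_contDiffAt]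
    intro x
    exact (NormedSpace.exp_analytic (𝕂 := ℝ) x).contDiffAt
  have h2 : ContDiff ℝ 1 (fun X : Mat n => X - Xᴴ) := contDiff_id.sub ctL.contDiff
  exact (h1.comp h2).mul contDiff_const

lemma UX_zero (U0 : Mat n) : UX U0 0 = U0 := by simp [UX]

abbrev QQ (n : ℕ) := ℝ × (Fin n → ℝ)
abbrev VV (n : ℕ) := Mat n × Mat n × ℝ × Mat n

noncomputable def HH (a b : Fin n → ℝ) (U0 : Mat n) (t : ℝ) (X : Mat n) : Mat n :=
  Hm t a (UX U0 X * Et t b * (UX U0 X)ᴴ)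

noncomputable def FF (a b : Fin n → ℝ) (U0 V0 : Mat n) (p : QQ n × VV n) : Mat n :=
  HH a b U0 p.1.1 p.2.1
    + ee p.1.1 p.2.2.2.1 • ((1 : Mat n) + (2 * p.1.1) • HH a b U0 p.1.1 p.2.1)
    - UX V0 p.2.2.1 * Et p.1.1 p.1.2 * (UX V0 p.2.2.1)ᴴ + (p.2.2.2.2 - p.2.2.2.2ᴴ)

lemma Et_contDiff : ContDiff ℝ 1 (fun p : QQ n => Et p.1 p.2) := by
  have : ContDiff ℝ 1 (fun p : QQ n => fun i => ee p.1 (p.2 i)) := by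
    rw [contDiff_pi]
    intro i
    exact ee_contDiff.comp (by fun_prop : ContDiff ℝ 1 (fun p : QQ n => (p.1, p.2 i)))
  exact dgL.contDiff.comp this

lemma Pt_contDiff (a : Fin n → ℝ) : ContDiff ℝ 1 (fun t : ℝ => Pt t a) := by
  have : ContDiff ℝ 1 (fun t : ℝ => fun i => Real.exp (t * a i)) := by
    rw [contDiff_pi]
    intro i
    fun_prop
  exact dgL.contDiff.comp this

lemma HH_contDiff (a b : Fin n → ℝ) (U0 : Mat n) :
    ContDiff ℝ 1 (fun p : ℝ × Mat n => HH a b U0 p.1 p.2) := by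
  have hE : ∀ a : Fin n → ℝ, ContDiff ℝ 1 (fun p : ℝ × Mat n => Et p.1 a) := fun a =>
    Et_contDiff.comp (by fun_prop : ContDiff ℝ 1 (fun p : ℝ × Mat n => ((p.1, a) : QQ n)))
  have hP : ContDiff ℝ 1 (fun p : ℝ × Mat n => Pt p.1 a) := (Pt_contDiff a).comp contDiff_fst
  have hU : ContDiff ℝ 1 (fun p : ℝ × Mat n => UX U0 p.2) := (UX_contDiff U0).comp contDiff_snd
  have hU' : ContDiff ℝ 1 (fun p : ℝ × Mat n => (UX U0 p.2)ᴴ) := ctL.contDiff.comp hU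
  exact (hE a).add ((hP.mul ((hU.mul (hE b)).mul hU')).mul hP)

lemma FF_contDiff (a b : Fin n → ℝ) (U0 V0 : Mat n) : ContDiff ℝ 1 (FF a b U0 V0) := by
  have hH : ContDiff ℝ 1 (fun p : QQ n × VV n => HH a b U0 p.1.1 p.2.1) :=
    (HH_contDiff a b U0).comp
      (by fun_prop : ContDiff ℝ 1 (fun p : QQ n × VV n => (p.1.1, p.2.1)))
  have he : ContDiff ℝ 1 (fun p : QQ n × VV n => ee p.1.1 p.2.2.2.1) :=
    ee_contDiff.comp (by fun_prop : ContDiff ℝ 1 (fun p : QQ n × VV n => (p.1.1, p.2.2.2.1)))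
  have hE : ContDiff ℝ 1 (fun p : QQ n × VV n => Et p.1.1 p.1.2) := Et_contDiff.comp contDiff_fst
  have hV : ContDiff ℝ 1 (fun p : QQ n × VV n => UX V0 p.2.2.1) :=
    (UX_contDiff V0).comp (by fun_prop)
  have hV' : ContDiff ℝ 1 (fun p : QQ n × VV n => (UX V0 p.2.2.1)ᴴ) := ctL.contDiff.comp hV
  have hS : ContDiff ℝ 1 (fun p : QQ n × VV n => p.2.2.2.2) := by fun_prop
  have hS' : ContDiff ℝ 1 (fun p : QQ n × VV n => (p.2.2.2.2)ᴴ) := ctL.contDiff.comp hS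
  have h2 : ContDiff ℝ 1 (fun p : QQ n × VV n => 2 * p.1.1) := by fun_prop
  exact ((hH.add (he.smul (contDiff_const.add (h2.smul hH)))).sub ((hV.mul hE).mul hV')).add
    (hS.sub hS')

lemma UX_hasDerivAt (U0 X : Mat n) :
    HasDerivAt (fun s : ℝ => UX U0 (s • X)) ((X - Xᴴ) * U0) 0 := by
  have h := hasDerivAt_exp_smul_const (𝕂 := ℝ) (X - Xᴴ) (0 : ℝ)
  rw [zero_smul, NormedSpace.exp_zero, one_mul] at h
  have h2 := h.mul_const U0
  refine h2.congr_of_eventuallyEq (Filter.Eventually.of_forall fun s => ?_)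
  have h3 : s • X - (s • X)ᴴ = s • (X - Xᴴ) := by
    rw [conjTranspose_smul, smul_sub]; simp
  change NormedSpace.exp (s • X - (s • X)ᴴ) * U0 = _
  rw [h3]
  rfl

lemma conj_hasDerivAt (U0 X E : Mat n) :
    HasDerivAt (fun s : ℝ => UX U0 (s • X) * E * (UX U0 (s • X))ᴴ)
      ((X - Xᴴ) * (U0 * E * U0ᴴ) - (U0 * E * U0ᴴ) * (X - Xᴴ)) 0 := by
  have h1 := UX_hasDerivAt U0 X
  have h2 : HasDerivAt (fun s : ℝ => (UX U0 (s • X))ᴴ) (((X - Xᴴ) * U0)ᴴ) 0 :=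
    ctL.hasFDerivAt.comp_hasDerivAt (0 : ℝ) h1
  have h3 := (h1.mul_const E).mul h2
  refine h3.congr_deriv ?_
  simp only [zero_smul, UX_zero, conjTranspose_mul, conjTranspose_sub, conjTranspose_conjTranspose]
  noncomm_ring

lemma FF_hasDerivAt (a b c : Fin n → ℝ) (U0 V0 : Mat n) (t : ℝ) (X Y : Mat n) (z : ℝ) (S : Mat n) :
    HasDerivAt (fun s : ℝ => FF a b U0 V0 ((t, c), s • ((X, Y, z, S) : VV n)))
      (Pt t a * ((X - Xᴴ) * (U0 * Et t b * U0ᴴ) - (U0 * Et t b * U0ᴴ) * (X - Xᴴ)) * Pt t a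
        + z • ((1 : Mat n) + (2 * t) • Hm t a (U0 * Et t b * U0ᴴ))
        - ((Y - Yᴴ) * (V0 * Et t c * V0ᴴ) - (V0 * Et t c * V0ᴴ) * (Y - Yᴴ)) + (S - Sᴴ)) 0 := by
  have h1 : HasDerivAt (fun s : ℝ => HH a b U0 t (s • X))
      (Pt t a * ((X - Xᴴ) * (U0 * Et t b * U0ᴴ) - (U0 * Et t b * U0ᴴ) * (X - Xᴴ)) * Pt t a) 0 :=
    (((conj_hasDerivAt U0 X (Et t b)).const_mul (Pt t a)).mul_const (Pt t a)).const_add (Et t a)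
  have h2 : HasDerivAt (fun s : ℝ => ee t (s • z)) z 0 := by
    have h3 : HasDerivAt (fun s : ℝ => s • z) z 0 := by
      simpa using (hasDerivAt_id (0 : ℝ)).smul_const z
    have h4 : HasDerivAt (fun s => ee t s) 1 ((0 : ℝ) • z) := by
      rw [zero_smul]; exact ee_hasDerivAt_zero t
    have := h4.comp (0 : ℝ) h3
    exact (show HasDerivAt (fun s : ℝ => ee t (s • z)) _ 0 from this).congr_deriv (one_mul z)
  have h5 := h2.smul ((h1.const_smul (2 * t)).const_add (1 : Mat n))
  have h6 := conj_hasDerivAt V0 Y (Et t c)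
  have h7 : HasDerivAt (fun s : ℝ => s • S - (s • S)ᴴ) (S - Sᴴ) 0 := by
    have h8 : HasDerivAt (fun s : ℝ => s • S) S 0 := by
      exact ((hasDerivAt_id (0 : ℝ)).smul_const S).congr_deriv (one_smul _ _)
    have h9 : HasDerivAt (fun s : ℝ => (s • S)ᴴ) Sᴴ 0 := ctL.hasFDerivAt.comp_hasDerivAt (0 : ℝ) h8
    exact h8.sub h9
  have h10 := ((h1.add h5).sub h6).add h7
  have h11 := HasDerivAt.congr_of_eventuallyEq h10
    (f₁ := fun s : ℝ => FF a b U0 V0 ((t, c), s • ((X, Y, z, S) : VV n)))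
    (Filter.Eventually.of_forall fun s => rfl)
  refine h11.congr_deriv ?_
  simp only [Pi.smul_apply, zero_smul, ee_zero', zero_add, HH, UX_zero]

theorem open_lemma {t0 : ℝ} {a b c0 : Fin n → ℝ} {U0 V0 : Mat n} (hU : U0ᴴ * U0 = 1)
    (hV : V0ᴴ * V0 = 1) (hEq : Hm t0 a (U0 * Et t0 b * U0ᴴ) = V0 * Et t0 c0 * V0ᴴ)
    (hirr : Irr a (U0 * Et t0 b * U0ᴴ)) :
    ∀ᶠ q : QQ n in nhds (t0, c0), ∑ i, a i + ∑ i, b i = ∑ i, q.2 i → Sol q.1 a b q.2 := by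
  set p0 : QQ n × VV n := ((t0, c0), 0) with hp0
  set F := FF a b U0 V0 with hF
  have hFs : HasStrictFDerivAt F (fderiv ℝ F p0) p0 :=
    (FF_contDiff a b U0 V0).contDiffAt.hasStrictFDerivAt one_ne_zero
  set F' := fderiv ℝ F p0 with hF'
  have hdir : ∀ v : VV n, HasDerivAt (fun s : ℝ => F ((t0, c0), s • v)) (F' (0, v)) 0 := by
    intro v
    have h1 : HasDerivAt (fun s : ℝ => (((t0, c0), s • v) : QQ n × VV n)) (0, v) 0 := by
      refine HasDerivAt.prodMk (hasDerivAt_const _ _) ?_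
      exact ((hasDerivAt_id (0 : ℝ)).smul_const v).congr_deriv (one_smul _ _)
    have h2 : HasFDerivAt F F' ((fun s : ℝ => (((t0, c0), s • v) : QQ n × VV n)) 0) := by
      simp only [zero_smul]
      exact hFs.hasFDerivAt
    exact h2.comp_hasDerivAt (0 : ℝ) h1
  have hF0 : F p0 = 0 := by
    simp only [hF, hp0, FF, HH, Prod.fst_zero, Prod.snd_zero, UX_zero, ee_zero', zero_smul, hEq]
    simp
  have hBh : (U0 * Et t0 b * U0ᴴ)ᴴ = U0 * Et t0 b * U0ᴴ := by
    rw [conjTranspose_mul, conjTranspose_mul, conjTranspose_conjTranspose, Et, dg_conjTranspose,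
      mul_assoc]
  have hM : IsUnit (1 + ((2 * t0 : ℝ) : ℂ) • Hm t0 a (U0 * Et t0 b * U0ᴴ)) := by
    have h1 : 1 + ((2 * t0 : ℝ) : ℂ) • (V0 * Et t0 c0 * V0ᴴ)
        = V0 * dg (fun i => Real.exp (2 * t0 * c0 i)) * V0ᴴ := by
      rw [← one_add_Et, mul_add, add_mul, mul_one, uu hV]
      simp
    rw [hEq, h1, isUnit_iff_isUnit_det, det_conj hV, dg_det, isUnit_iff_ne_zero]
    exact_mod_cast (Finset.prod_pos fun i _ => Real.exp_pos _).ne'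
  have hsurj := surj_of_irr hBh hirr rfl hM
    ((F' : QQ n × VV n →ₗ[ℝ] Mat n).comp (LinearMap.inr ℝ (QQ n) (VV n))) (by
      intro X Y z S
      have h1 := hdir (X, Y, z, S)
      have h2 := FF_hasDerivAt a b c0 U0 V0 t0 X Y z S
      have h3 := h1.unique h2
      rw [← hEq] at h3
      simp only [LinearMap.comp_apply, LinearMap.inr_apply, ContinuousLinearMap.coe_coe]
      rw [h3, Complex.coe_smul])
  let Φ : QQ n × VV n → QQ n × Mat n := fun p => (p.1, F p)
  have hΦ : HasStrictFDerivAt Φ ((ContinuousLinearMap.fst ℝ (QQ n) (VV n)).prod F') p0 :=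
    hasStrictFDerivAt_fst.prodMk hFs
  have hΦs : ((ContinuousLinearMap.fst ℝ (QQ n) (VV n)).prod F').range = ⊤ := by
    rw [LinearMap.range_eq_top]
    rintro ⟨q, N⟩
    obtain ⟨v, hv⟩ := LinearMap.range_eq_top.mp hsurj (N - F' (q, 0))
    refine ⟨(q, v), ?_⟩
    have hv' : F' (0, v) = N - F' (q, 0) := hv
    have : F' (q, v) = N := by
      have : ((q, v) : QQ n × VV n) = (q, 0) + (0, v) := by simp
      rw [this, map_add, hv']; abel
    exact Prod.ext rfl this
  have : @CompleteSpace (Mat n) PseudoMetricSpace.toUniformSpace :=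
    FiniteDimensional.complete ℝ (Mat n)
  have hmap := hΦ.map_nhds_eq_of_surj hΦs
  have hr : Set.range Φ ∈ nhds (Φ p0) := by
    exact (Filter.ext_iff.mp hmap _).mp Filter.range_mem_map
  have hΦ0 : Φ p0 = ((t0, c0), 0) := Prod.ext rfl hF0
  rw [hΦ0] at hr
  have hcont : Filter.Tendsto (fun q : QQ n => ((q, 0) : QQ n × Mat n)) (nhds (t0, c0))
      (nhds ((t0, c0), 0)) := by
    have : Continuous (fun q : QQ n => ((q, 0) : QQ n × Mat n)) := by fun_prop
    exact this.tendsto _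
  filter_upwards [hcont hr] with q hq hs
  obtain ⟨⟨q', X, Y, z, S⟩, hp⟩ := hq
  have hq1 : q' = q := congrArg Prod.fst hp
  have hq2 : F (q', X, Y, z, S) = 0 := congrArg Prod.snd hp
  subst hq1
  have hUX := UX_unitary hU X
  have hVY := UX_unitary hV Y
  refine sol_of_scaled (z := z) hUX hVY hs ?_
  simp only [hF, FF, HH] at hq2
  rw [Complex.coe_smul]
  set H := Hm q'.1 a (UX U0 X * Et q'.1 b * (UX U0 X)ᴴ) with hH
  have hherm : ∀ (U : Mat n) (t : ℝ) (c : Fin n → ℝ), (U * Et t c * Uᴴ)ᴴ = U * Et t c * Uᴴ := by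
    intro U t c
    rw [conjTranspose_mul, conjTranspose_mul, conjTranspose_conjTranspose, Et, dg_conjTranspose,
      mul_assoc]
  have hHh : Hᴴ = H := Hm_isHermitian _ _ (hherm _ _ _)
  set R := H + ee q'.1 z • ((1 : Mat n) + (2 * q'.1) • H)
    - UX V0 Y * Et q'.1 q'.2 * (UX V0 Y)ᴴ with hR
  have hRh : Rᴴ = R := by
    rw [hR, conjTranspose_sub, hherm, conjTranspose_add, conjTranspose_smul, conjTranspose_add,
      conjTranspose_smul, hHh]
    simp
  have h1 := congrArg conjTranspose hq2
  rw [conjTranspose_add, hRh, conjTranspose_sub, conjTranspose_conjTranspose, conjTranspose_zero]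
    at h1
  have h2 : (2 : ℝ) • R = 0 := by
    rw [two_smul]
    calc R + R = (R + (S - Sᴴ)) + (R + (Sᴴ - S)) := by abel
      _ = 0 := by rw [hq2, h1, add_zero]
  have h3 : R = 0 := by simpa using h2
  rw [hR, sub_eq_zero] at h3
  exact h3

end normed

end MH

namespace MH
variable {n : ℕ}

lemma key_conj (t : ℝ) {U : Mat n} (b : Fin n → ℝ) (hU : Uᴴ * U = 1) :
    1 + ((2 * t : ℝ) : ℂ) • (U * Et t b * Uᴴ)
      = U * dg (fun i => Real.exp (2 * t * b i)) * Uᴴ := by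
  rw [← one_add_Et, mul_add, add_mul, mul_one, uu hU]
  simp

lemma sum_of_sol {t : ℝ} {a b c : Fin n → ℝ} (h : Sol t a b c) :
    ∑ i, a i + ∑ i, b i = ∑ i, c i := by
  obtain ⟨U, V, hU, hV, h⟩ := h
  by_cases ht : t = 0
  · subst ht
    have e0 : ∀ x : Fin n → ℝ, Et 0 x = dg x := fun x => by simp [Et, ee_zero]
    have p0 : Pt 0 a = 1 := by rw [Pt, ← dg_one]; simp
    have h1 := congrArg (fun X => (Matrix.trace X).re) h
    simpa only [trace_add, trace_conj hV, Hm, e0, p0, one_mul, mul_one, trace_conj hU, dg_trace,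
      Complex.add_re, Complex.ofReal_re] using h1
  · have h1 := congrArg (fun X : Mat n => 1 + ((2 * t : ℝ) : ℂ) • X) h
    beta_reduce at h1
    rw [key_conj t c hV, one_add_Hm, key_conj t b hU] at h1
    have h2 := congrArg Matrix.det h1
    rw [det_conj hV, det_mul, det_mul, det_conj hU, Pt, dg_det, dg_det, dg_det,
      ← Real.exp_sum, ← Real.exp_sum, ← Real.exp_sum,
      ← Complex.ofReal_mul, ← Complex.ofReal_mul,
      ← Real.exp_add, ← Real.exp_add] at h2
    have h3 := Real.exp_injective (Complex.ofReal_injective h2)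
    rw [← Finset.mul_sum, ← Finset.mul_sum, ← Finset.mul_sum] at h3
    have h4 : 2 * t * (∑ i, a i + ∑ i, b i) = 2 * t * ∑ i, c i := by linarith
    exact mul_left_cancel₀ (by simpa using ht) h4

def Generic (a b c : Fin n → ℝ) : Prop :=
  Function.Injective c ∧ ∀ I J K : Finset (Fin n), I.card = K.card → J.card = K.card → K.Nonempty →
      K ≠ Finset.univ → ∑ i ∈ I, a i + ∑ j ∈ J, b j ≠ ∑ k ∈ K, c k

theorem sol_clopen {a b c : Fin n → ℝ} (ha : Function.Injective a)
    (hb : Function.Injective b) (hg : Generic a b c) {t0 : ℝ} (h0 : Sol t0 a b c) (t1 : ℝ) :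
    Sol t1 a b c := by
  have hs := sum_of_sol h0
  have hcl : IsClosed {t : ℝ | Sol t a b c} :=
    isClosed_sol.preimage (by fun_prop : Continuous fun t : ℝ => (t, a, b, c))
  have hop : IsOpen {t : ℝ | Sol t a b c} := by
    rw [isOpen_iff_mem_nhds]
    rintro t ⟨U, V, hU, hV, hE⟩
    have h1 := open_lemma hU hV hE (irr_of_generic ha hb hg.1 hg.2 hU hV hE)
    have h2 : Filter.Tendsto (fun t : ℝ => (t, c)) (nhds t) (nhds (t, c)) :=
      (by fun_prop : Continuous fun t : ℝ => (t, c)).tendsto t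
    filter_upwards [h2.eventually h1] with s hs'
    exact hs' hs
  have := IsClopen.eq_univ ⟨hcl, hop⟩ ⟨t0, h0⟩
  exact Set.eq_univ_iff_forall.mp this t1

lemma affine_ne {u v : ℝ} (h : u ≠ 0 ∨ v ≠ 0) : ∀ᶠ e : ℝ in nhdsWithin 0 {0}ᶜ, u + e * v ≠ 0 := by
  by_cases hu : u = 0
  · have hv : v ≠ 0 := by tauto
    filter_upwards [self_mem_nhdsWithin] with e he
    rw [hu, zero_add]
    exact mul_ne_zero he hv
  · apply Filter.Eventually.filter_mono nhdsWithin_le_nhds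
    have : ContinuousAt (fun e : ℝ => u + e * v) 0 := by fun_prop
    exact this.eventually_ne (by simpa using hu)

theorem lemmaA (hn : 0 < n) {a b c : Fin n → ℝ} (ha : Function.Injective a)
    (hb : Function.Injective b) (hc : Function.Injective c) {t0 : ℝ} {U V : Mat n}
    (hU : Uᴴ * U = 1) (hV : Vᴴ * V = 1) (hE : Hm t0 a (U * Et t0 b * Uᴴ) = V * Et t0 c * Vᴴ)
    (hirr : Irr a (U * Et t0 b * Uᴴ)) (t1 : ℝ) : Sol t1 a b c := by
  have hs := sum_of_sol ⟨U, V, hU, hV, hE⟩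
  let w : Fin n → ℝ := fun i => 1 - if i = ⟨0, hn⟩ then (n : ℝ) else 0
  have hwK : ∀ K : Finset (Fin n), ∑ i ∈ K, w i = K.card - if ⟨0, hn⟩ ∈ K then (n : ℝ) else 0 := by
    intro K
    simp [w, Finset.sum_sub_distrib]
  have hw1 : ∑ i, w i = 0 := by rw [hwK]; simp
  have hw2 : ∀ K : Finset (Fin n), K.Nonempty → K ≠ Finset.univ → ∑ i ∈ K, w i ≠ 0 := by
    intro K h1 h2
    rw [hwK]
    split_ifs with h
    · have : K.card ≠ n := by
        intro h3; apply h2; rw [← Finset.card_eq_iff_eq_univ]; simpa using h3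
      rw [sub_ne_zero]; exact_mod_cast this
    · rw [sub_zero]; exact_mod_cast h1.card_pos.ne'
  let f : ℝ → Fin n → ℝ := fun e i => c i + e * w i
  have hfc : Continuous f := by fun_prop
  have hf0 : f 0 = c := by funext i; simp [f]
  have hsum : ∀ e, ∑ i, f e i = ∑ i, c i := by
    intro e; simp only [f]; rw [Finset.sum_add_distrib, ← Finset.mul_sum, hw1]; simp
  have e1 : ∀ᶠ e in nhdsWithin (0 : ℝ) {0}ᶜ, Function.Injective (f e) := by
    have : ∀ i j : Fin n, ∀ᶠ e in nhdsWithin (0 : ℝ) {0}ᶜ, i ≠ j → f e i ≠ f e j := by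
      intro i j
      by_cases hij : i = j
      · simp [hij]
      · filter_upwards [affine_ne (u := c i - c j) (v := w i - w j)
          (Or.inl (sub_ne_zero.mpr fun h => hij (hc h)))] with e he _ h
        apply he; simp only [f] at h; linarith
    have h2 := (Filter.eventually_all.mpr fun i => Filter.eventually_all.mpr (this i))
    filter_upwards [h2] with e he i j hij
    by_contra h
    exact he i j h hij
  have e2 : ∀ᶠ e in nhdsWithin (0 : ℝ) {0}ᶜ, ∀ I J K : Finset (Fin n), I.card = K.card →
      J.card = K.card → K.Nonempty →
      K ≠ Finset.univ → ∑ i ∈ I, a i + ∑ j ∈ J, b j ≠ ∑ k ∈ K, f e k := by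
    refine Filter.eventually_all.mpr fun I => Filter.eventually_all.mpr fun J =>
      Filter.eventually_all.mpr fun K => ?_
    by_cases hK : K.Nonempty ∧ K ≠ Finset.univ
    · filter_upwards [affine_ne (u := ∑ k ∈ K, c k - (∑ i ∈ I, a i + ∑ j ∈ J, b j))
        (v := ∑ k ∈ K, w k) (Or.inr (hw2 K hK.1 hK.2))] with e he _ _ _ _ h
      apply he
      simp only [f] at h
      rw [Finset.sum_add_distrib, ← Finset.mul_sum] at h
      linarith
    · exact Filter.Eventually.of_forall fun e _ _ h1 h2 => absurd ⟨h1, h2⟩ hK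
  have e3 : ∀ᶠ e in nhdsWithin (0 : ℝ) {0}ᶜ, Sol t0 a b (f e) := by
    apply Filter.Eventually.filter_mono nhdsWithin_le_nhds
    have h1 := open_lemma hU hV hE hirr
    have h2 : Filter.Tendsto (fun e : ℝ => (t0, f e)) (nhds 0) (nhds (t0, c)) := by
      have : Continuous fun e : ℝ => (t0, f e) := by fun_prop
      simpa [hf0] using this.tendsto 0
    filter_upwards [h2.eventually h1] with e he
    exact he (by rw [hsum, hs])
  have e4 : ∀ᶠ e in nhdsWithin (0 : ℝ) {0}ᶜ, Sol t1 a b (f e) := by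
    filter_upwards [e1, e2, e3] with e h1 h2 h3
    exact sol_clopen ha hb ⟨h1, h2⟩ h3 t1
  have hcl : IsClosed {e : ℝ | Sol t1 a b (f e)} :=
    isClosed_sol.preimage (by fun_prop : Continuous fun e : ℝ => (t1, a, b, f e))
  have := hcl.mem_of_tendsto (b := nhdsWithin (0 : ℝ) {0}ᶜ) (f := id) (x := 0)
    (Filter.tendsto_id.mono_left nhdsWithin_le_nhds) e4
  simpa [hf0] using this

end MH

namespace MH
variable {n : ℕ}

/-- Krylov matrix -/
def kry {R : Type*} [CommRing R] (o : Fin n) (X : Matrix (Fin n) (Fin n) R) :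
    Matrix (Fin n) (Fin n) R :=
  Matrix.of fun i j => (X ^ (j : ℕ)) i o

lemma conj_pow {U D : Mat n} (hU : Uᴴ * U = 1) (k : ℕ) : (U * D * Uᴴ) ^ k = U * D ^ k * Uᴴ := by
  induction k with
  | zero => simp [uu hU]
  | succ k ih =>
    rw [pow_succ, ih, pow_succ]
    calc U * D ^ k * Uᴴ * (U * D * Uᴴ) = U * D ^ k * (Uᴴ * U) * D * Uᴴ := by simp only [mul_assoc]
      _ = _ := by rw [hU]; simp only [mul_assoc, one_mul, mul_one]

lemma kry_inj (o : Fin n) {U : Mat n} {x : Fin n → ℝ} (hU : Uᴴ * U = 1)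
    (h : (kry o (U * dg x * Uᴴ)).det ≠ 0) : Function.Injective x := by
  have h1 : kry o (U * dg x * Uᴴ) = U * diagonal (fun k => star (U o k)) *
      vandermonde (fun k => (x k : ℂ)) := by
    ext i j
    simp only [kry, of_apply, conj_pow hU, dg, diagonal_pow]
    rw [mul_apply, mul_apply]
    refine Finset.sum_congr rfl fun k _ => ?_
    rw [mul_diagonal, mul_diagonal, conjTranspose_apply, vandermonde_apply]
    simp only [Pi.pow_apply]
    ring
  rw [h1, det_mul] at h
  have h2 := det_vandermonde_ne_zero_iff.mp (right_ne_zero_of_mul h)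
  intro i j hij
  exact h2 (by simp [hij])

lemma kry_irr (o : Fin n) {a : Fin n → ℝ} (ha : Function.Injective a) {X : Mat n}
    (h : (kry o X).det ≠ 0) : Irr a X := by
  intro Z hZa hZX
  have hZd := dg_comm_diag ha hZa
  refine ⟨Z o o, ?_⟩
  have h1 : (Z - Z o o • (1 : Mat n)) * kry o X = 0 := by
    rw [sub_mul, sub_eq_zero]
    ext i j
    have h2 : Z * X ^ (j : ℕ) = X ^ (j : ℕ) * Z := (Commute.pow_right hZX _)
    have h3 := congrFun (congrFun h2 i) o
    rw [hZd, diagonal_mul, mul_diagonal] at h3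
    rw [hZd, diagonal_mul]
    simp only [kry, of_apply, smul_mul, one_mul, Matrix.smul_apply, smul_eq_mul, diagonal_apply_eq]
    rw [h3, mul_comm]
  have hu : IsUnit (kry o X) := (isUnit_iff_isUnit_det _).mpr (isUnit_iff_ne_zero.mpr h)
  have := (hu.mul_left_eq_zero).mp h1
  exact sub_eq_zero.mp this

/-- Hessenberg with nonzero subdiagonal -/
def Hess (Y : Mat n) : Prop :=
  (∀ i j : Fin n, (j : ℕ) + 1 < i → Y i j = 0) ∧ ∀ i j : Fin n, (j : ℕ) + 1 = i → Y i j ≠ 0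

lemma kry_hess (hn : 0 < n) {Y : Mat n} (hY : Hess Y) : (kry ⟨0, hn⟩ Y).det ≠ 0 := by
  have h : ∀ j : ℕ, (∀ i : Fin n, j < i → (Y ^ j) i ⟨0, hn⟩ = 0) ∧
      ∀ i : Fin n, (i : ℕ) = j → (Y ^ j) i ⟨0, hn⟩ ≠ 0 := by
    intro j
    induction j with
    | zero =>
      refine ⟨fun i hi => ?_, fun i hi => ?_⟩
      · rw [pow_zero, one_apply_ne]; intro h; rw [h] at hi; simp at hi
      · have : i = ⟨0, hn⟩ := Fin.ext hi
        rw [this]; simp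
    | succ j ih =>
      refine ⟨fun i hi => ?_, fun i hi => ?_⟩
      · rw [pow_succ', mul_apply]
        refine Finset.sum_eq_zero fun k _ => ?_
        by_cases hk : j < k
        · rw [ih.1 k hk, mul_zero]
        · rw [hY.1 i k (by omega), zero_mul]
      · rw [pow_succ', mul_apply]
        have hj : j < n := by omega
        rw [Finset.sum_eq_single (⟨j, hj⟩ : Fin n)]
        · exact mul_ne_zero (hY.2 _ _ hi.symm) (ih.2 _ rfl)
        · intro k _ hk
          by_cases hk1 : j < k
          · rw [ih.1 k hk1, mul_zero]
          · have : (k : ℕ) ≠ j := fun h => hk (Fin.ext h)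
            rw [hY.1 i k (by omega), zero_mul]
        · simp
  rw [det_of_isUpperTriangular]
  · exact Finset.prod_ne_zero_iff.mpr fun i _ => (h i).2 i rfl
  · intro i j hij
    exact (h j).1 i hij

lemma kry_smul (o : Fin n) (s : ℂ) (hs : s ≠ 0) {X : Mat n} (h : (kry o X).det ≠ 0) :
    (kry o (s • X)).det ≠ 0 := by
  have h1 : kry o (s • X) = kry o X * diagonal (fun j : Fin n => s ^ (j : ℕ)) := by
    ext i j
    simp [kry, smul_pow, mul_comm]
  rw [h1, det_mul, det_diagonal]
  exact mul_ne_zero h (Finset.prod_ne_zero_iff.mpr fun i _ => pow_ne_zero _ hs)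

lemma kry_eventually (hn : 0 < n) {Y : Mat n} (hY : Hess Y) (B : Mat n) :
    ∀ᶠ σ : ℝ in Filter.atTop, (kry ⟨0, hn⟩ (B + ((σ⁻¹ : ℝ) : ℂ) • Y)).det ≠ 0 := by
  let M : Matrix (Fin n) (Fin n) (Polynomial ℂ) :=
    Y.map Polynomial.C + (Polynomial.X : Polynomial ℂ) • B.map Polynomial.C
  let p : Polynomial ℂ := (kry ⟨0, hn⟩ M).det
  have hp : ∀ z : ℂ, p.eval z = (kry ⟨0, hn⟩ (Y + z • B)).det := by
    intro z
    have h1 := RingHom.map_det (Polynomial.evalRingHom z) (kry ⟨0, hn⟩ M)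
    rw [Polynomial.coe_evalRingHom] at h1
    rw [h1]
    congr 1
    ext i j
    have h2 : (Polynomial.evalRingHom z).mapMatrix M = Y + z • B := by
      ext i j
      simp [M]
      exact mul_comm _ _
    rw [← h2]
    have h3 := map_pow (Polynomial.evalRingHom z).mapMatrix M (j : ℕ)
    have h4 := congrFun (congrFun h3 i) ⟨0, hn⟩
    exact h4
  have hp0 : p ≠ 0 := by
    intro h
    have := hp 0
    rw [h] at this
    simp only [Polynomial.eval_zero, zero_smul, add_zero] at this
    exact kry_hess hn hY this.symm
  have hfin : {σ : ℝ | p.IsRoot (σ : ℂ)}.Finite :=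
    (Polynomial.finite_setOfPred_isRoot hp0).preimage Complex.ofReal_injective.injOn
  have h1 := Filter.atTop_le_cofinite (α := ℝ) hfin.compl_mem_cofinite
  filter_upwards [h1, Filter.eventually_gt_atTop 0] with σ hσ hσ0
  have h2 : (kry ⟨0, hn⟩ (Y + (σ : ℂ) • B)).det ≠ 0 := by
    rw [← hp]; exact hσ
  have hσc : (σ : ℂ) ≠ 0 := by exact_mod_cast hσ0.ne'
  have h3 := kry_smul _ (σ : ℂ)⁻¹ (inv_ne_zero hσc) h2
  rw [smul_add, smul_smul, inv_mul_cancel₀ hσc, one_smul, add_comm] at h3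
  rw [Complex.ofReal_inv]
  exact h3

lemma hess_conj {Y : Mat n} (hY : Hess Y) (t : ℝ) (a : Fin n → ℝ) : Hess (Pt t a * Y * Pt t a) := by
  refine ⟨fun i j h => ?_, fun i j h => ?_⟩
  · simp [Pt, dg, hY.1 i j h]
  · simp [Pt, dg, hY.2 i j h, Complex.exp_ne_zero]

/-- bidiagonal matrix -/
def LL (n : ℕ) : Mat n := Matrix.of fun i j => if (i : ℕ) = j ∨ (i : ℕ) = j + 1 then 1 else 0

lemma hess_LL : Hess (LL n * (LL n)ᴴ) := by
  refine ⟨fun i j h => ?_, fun i j h => ?_⟩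
  · rw [mul_apply]
    refine Finset.sum_eq_zero fun k _ => ?_
    simp only [LL, conjTranspose_apply, of_apply]
    split_ifs with h1 h2 <;> first | (exfalso; omega) | simp
  · rw [mul_apply, Finset.sum_eq_single j]
    · simp [LL, conjTranspose_apply, of_apply, h.symm]
    · intro k _ hk
      have : (k : ℕ) ≠ j := fun h => hk (Fin.ext h)
      simp only [LL, conjTranspose_apply, of_apply]
      split_ifs with h1 h2 <;> first | (exfalso; omega) | simp
    · simp

lemma Hm_add (t : ℝ) (a : Fin n → ℝ) (B Y : Mat n) (z : ℂ) :
    Hm t a (B + z • Y) = Hm t a B + z • (Pt t a * Y * Pt t a) := by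
  simp only [Hm, mul_add, add_mul, add_assoc, Algebra.mul_smul_comm, Algebra.smul_mul_assoc]

open scoped ComplexOrder in
/-- Hermitian with positive `1+2tX` is of the form `U Et t b Uᴴ`. -/
lemma exists_rep {t : ℝ} {X : Mat n} (hX : X.IsHermitian)
    (hp : (1 + ((2 * t : ℝ) : ℂ) • X).PosDef) :
    ∃ (U : Mat n) (b : Fin n → ℝ), Uᴴ * U = 1 ∧ X = U * Et t b * Uᴴ := by
  let U : Mat n := hX.eigenvectorUnitary
  have hU : Uᴴ * U = 1 := by
    have := (Unitary.mem_iff.mp hX.eigenvectorUnitary.2).1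
    exact this
  have hsp : X = U * dg hX.eigenvalues * Uᴴ := by
    have := hX.spectral_theorem
    rw [Unitary.conjStarAlgAut_apply] at this
    exact this
  have h1 : (Uᴴ * (1 + ((2 * t : ℝ) : ℂ) • X) * U) = dg (fun i => 1 + (2 * t) * hX.eigenvalues i) := by
    rw [← dg_add (fun _ => 1) (fun i => 2 * t * hX.eigenvalues i), dg_one, ← dg_smul]
    conv_lhs => rw [hsp]
    rw [mul_add, add_mul, mul_one, hU, Algebra.mul_smul_comm, Algebra.smul_mul_assoc]
    congr 2
    calc Uᴴ * (U * dg hX.eigenvalues * Uᴴ) * U = (Uᴴ * U) * dg hX.eigenvalues * (Uᴴ * U) := by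
          simp only [mul_assoc]
      _ = _ := by rw [hU, one_mul, mul_one]
  have h2 : (dg (fun i => 1 + (2 * t) * hX.eigenvalues i)).PosDef := by
    rw [← h1]
    refine hp.conjTranspose_mul_mul_same ?_
    exact Matrix.mulVec_injective_of_isUnit (IsUnit.of_mul_eq_one _ (uu hU))
  have h3 : ∀ i, 0 < 1 + (2 * t) * hX.eigenvalues i := by
    intro i
    have := h2.diag_pos (i := i)
    simp only [dg, diagonal_apply_eq] at this
    exact_mod_cast this
  refine ⟨U, fun i => ll t (hX.eigenvalues i), hU, ?_⟩
  conv_lhs => rw [hsp]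
  congr 2
  rw [Et]
  congr 1
  funext i
  rw [ee_ll _ _ (h3 i)]

end MH

namespace MH
variable {n : ℕ}

open Filter Topology

lemma ll_ee (t x : ℝ) : ll t (ee t x) = x := by
  have h : 0 < 1 + 2 * t * ee t x := by rw [ee_exp]; exact Real.exp_pos _
  exact ee_inj t (ee_ll t _ h)

lemma unit_row_ne {W : Mat n} (hW : W * Wᴴ = 1) (i : Fin n) : ∃ j, W i j ≠ 0 := by
  by_contra h
  push Not at h
  have h1 := congrFun (congrFun hW i) i
  rw [mul_apply] at h1
  simp [h] at h1

lemma tendsto_rep {t : ℝ} {Uk : ℕ → Mat n} {bk : ℕ → Fin n → ℝ} {U' U : Mat n} {b : Fin n → ℝ}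
    (hUk : ∀ k, (Uk k)ᴴ * Uk k = 1) (hU' : U'ᴴ * U' = 1) (hU : Uᴴ * U = 1)
    (hlim : Tendsto Uk atTop (𝓝 U'))
    (hX : Tendsto (fun k => Uk k * Et t (bk k) * (Uk k)ᴴ) atTop (𝓝 (U * Et t b * Uᴴ))) :
    ∃ b'' : Fin n → ℝ, Tendsto bk atTop (𝓝 b'') ∧ U * Et t b * Uᴴ = U' * Et t b'' * U'ᴴ := by
  have h1 : Tendsto (fun k => Et t (bk k)) atTop (𝓝 (U'ᴴ * (U * Et t b * Uᴴ) * U')) := by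
    have hc : Continuous (fun p : Mat n × Mat n => p.1ᴴ * p.2 * p.1) := by fun_prop
    have h2 := (hc.tendsto (U', U * Et t b * Uᴴ)).comp (hlim.prodMk_nhds hX)
    refine h2.congr fun k => ?_
    simp only [Function.comp]
    calc (Uk k)ᴴ * (Uk k * Et t (bk k) * (Uk k)ᴴ) * Uk k
        = ((Uk k)ᴴ * Uk k) * Et t (bk k) * ((Uk k)ᴴ * Uk k) := by simp only [mul_assoc]
      _ = _ := by rw [hUk, one_mul, mul_one]
  set D := U'ᴴ * (U * Et t b * Uᴴ) * U' with hD
  have hent : ∀ i j, Tendsto (fun k => Et t (bk k) i j) atTop (𝓝 (D i j)) := fun i j =>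
    ((continuous_id.matrix_elem i j).tendsto D).comp h1
  have hDd : D = dg (fun i => (D i i).re) := by
    ext i j
    by_cases hij : i = j
    · subst hij
      have h3 : Tendsto (fun k => ((Et t (bk k) i i).re : ℂ)) atTop (𝓝 ((D i i).re : ℂ)) :=
        ((Complex.continuous_ofReal.comp Complex.continuous_re).tendsto _).comp (hent i i)
      have h4 : ∀ k, ((Et t (bk k) i i).re : ℂ) = Et t (bk k) i i := by
        intro k; simp [Et, dg]
      simp only [h4] at h3
      have := tendsto_nhds_unique (hent i i) h3
      simpa [dg] using this
    · have h3 := hent i j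
      have h4 : ∀ k, Et t (bk k) i j = 0 := fun k => by simp [Et, dg, hij]
      simp only [h4] at h3
      have := tendsto_nhds_unique h3 tendsto_const_nhds
      simp [dg, hij, this]
  set β : Fin n → ℝ := fun i => (D i i).re with hβ
  set W := U'ᴴ * U with hW
  have hWW : W * Wᴴ = 1 := by
    rw [hW, conjTranspose_mul, conjTranspose_conjTranspose]
    calc U'ᴴ * U * (Uᴴ * U') = U'ᴴ * (U * Uᴴ) * U' := by simp only [mul_assoc]
      _ = 1 := by rw [uu hU, mul_one, hU']
  have hWD : W * Et t b = dg β * W := by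
    rw [← hDd, hD, hW]
    calc U'ᴴ * U * Et t b = U'ᴴ * U * Et t b * (Uᴴ * U) := by rw [hU, mul_one]
      _ = U'ᴴ * (U * Et t b * Uᴴ) * (1 : Mat n) * U := by simp only [mul_assoc, one_mul]
      _ = U'ᴴ * (U * Et t b * Uᴴ) * (U' * U'ᴴ) * U := by rw [uu hU']
      _ = _ := by simp only [mul_assoc]
  have hex : ∀ i, ∃ j, β i = ee t (b j) := by
    intro i
    obtain ⟨j, hj⟩ := unit_row_ne hWW i
    refine ⟨j, ?_⟩
    have h3 := congrFun (congrFun hWD i) j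
    simp only [Et, dg, mul_diagonal, diagonal_mul] at h3
    rw [mul_comm] at h3
    have := mul_right_cancel₀ hj h3
    exact_mod_cast this.symm
  choose τ hτ using hex
  refine ⟨fun i => b (τ i), ?_, ?_⟩
  · rw [tendsto_pi_nhds]
    intro i
    have h3 : Tendsto (fun k => (Et t (bk k) i i).re) atTop (𝓝 (β i)) :=
      (Complex.continuous_re.tendsto _).comp (hent i i)
    have h4 : ∀ k, (Et t (bk k) i i).re = ee t (bk k i) := fun k => by simp [Et, dg]
    simp only [h4] at h3
    have hpos : 0 < 1 + 2 * t * β i := by rw [hτ, ee_exp]; exact Real.exp_pos _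
    have h5 := (ll_continuousAt t (β i) hpos).tendsto.comp h3
    rw [hτ i, ll_ee] at h5
    refine h5.congr fun k => ?_
    simp [ll_ee]
  · have h3 : Et t (fun i => b (τ i)) = D := by
      rw [hDd, Et]; congr 1; funext i; rw [hτ]
    rw [h3, hD]
    calc U * Et t b * Uᴴ = (U' * U'ᴴ) * (U * Et t b * Uᴴ) * (U' * U'ᴴ) := by
          rw [uu hU', one_mul, mul_one]
      _ = _ := by simp only [mul_assoc]

lemma rep_transfer {t0 : ℝ} {U U' : Mat n} {b b'' : Fin n → ℝ} (hU : Uᴴ * U = 1)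
    (hU' : U'ᴴ * U' = 1) (h : U * Et t0 b * Uᴴ = U' * Et t0 b'' * U'ᴴ) (t1 : ℝ) {U1 : Mat n}
    (hU1 : U1ᴴ * U1 = 1) : ∃ U2 : Mat n, U2ᴴ * U2 = 1 ∧ U1 * Et t1 b'' * U1ᴴ = U2 * Et t1 b * U2ᴴ := by
  set W := U'ᴴ * U with hW
  have hWW : W * Wᴴ = 1 := by
    rw [hW, conjTranspose_mul, conjTranspose_conjTranspose]
    calc U'ᴴ * U * (Uᴴ * U') = U'ᴴ * (U * Uᴴ) * U' := by simp only [mul_assoc]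
      _ = 1 := by rw [uu hU, mul_one, hU']
  have hWW' : Wᴴ * W = 1 := mul_eq_one_comm.mp hWW
  have h1 : W * Et t0 b = Et t0 b'' * W := by
    calc U'ᴴ * U * Et t0 b = U'ᴴ * U * Et t0 b * (Uᴴ * U) := by rw [hU, mul_one]
      _ = U'ᴴ * (U * Et t0 b * Uᴴ) * U := by simp only [mul_assoc]
      _ = (U'ᴴ * U') * Et t0 b'' * U'ᴴ * U := by rw [h]; simp only [mul_assoc]
      _ = _ := by rw [hU', one_mul, hW, mul_assoc]
  have h2 : W * Et t1 b = Et t1 b'' * W :=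
    dg_transfer h1 _ _ (fun i j hij => by rw [ee_inj t0 hij])
  refine ⟨U1 * W, ?_, ?_⟩
  · rw [conjTranspose_mul]
    calc Wᴴ * U1ᴴ * (U1 * W) = Wᴴ * (U1ᴴ * U1) * W := by simp only [mul_assoc]
      _ = 1 := by rw [hU1, mul_one, hWW']
  · rw [conjTranspose_mul]
    calc U1 * Et t1 b'' * U1ᴴ = U1 * Et t1 b'' * (W * Wᴴ) * U1ᴴ := by rw [hWW, mul_one]
      _ = U1 * (Et t1 b'' * W) * Wᴴ * U1ᴴ := by simp only [mul_assoc]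
      _ = U1 * (W * Et t1 b) * Wᴴ * U1ᴴ := by rw [h2]
      _ = _ := by simp only [mul_assoc]

theorem limit_lemma {t0 t1 : ℝ} {a b c : Fin n → ℝ} {U V : Mat n} (hU : Uᴴ * U = 1)
    (hV : Vᴴ * V = 1) (hE : Hm t0 a (U * Et t0 b * Uᴴ) = V * Et t0 c * Vᴴ)
    {ak bk ck : ℕ → Fin n → ℝ} {Uk Vk : ℕ → Mat n}
    (hUk : ∀ k, (Uk k)ᴴ * Uk k = 1) (hVk : ∀ k, (Vk k)ᴴ * Vk k = 1)
    (hEk : ∀ k, Hm t0 (ak k) (Uk k * Et t0 (bk k) * (Uk k)ᴴ) = Vk k * Et t0 (ck k) * (Vk k)ᴴ)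
    (hs : ∀ k, Sol t1 (ak k) (bk k) (ck k))
    (ha : Tendsto ak atTop (𝓝 a))
    (hB : Tendsto (fun k => Uk k * Et t0 (bk k) * (Uk k)ᴴ) atTop (𝓝 (U * Et t0 b * Uᴴ))) :
    Sol t1 a b c := by
  have hH : Tendsto (fun k => Vk k * Et t0 (ck k) * (Vk k)ᴴ) atTop (𝓝 (V * Et t0 c * Vᴴ)) := by
    rw [← hE]
    have h2 := (continuous_Hm.tendsto (t0, a, U * Et t0 b * Uᴴ)).comp
      ((tendsto_const_nhds (x := t0)).prodMk_nhds (ha.prodMk_nhds hB))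
    exact h2.congr fun k => hEk k
  have hfc : FirstCountableTopology (Mat n) :=
    inferInstanceAs (FirstCountableTopology (Fin n → Fin n → ℂ))
  obtain ⟨⟨U', V'⟩, ⟨hU', hV'⟩, φ, hφ, hlim⟩ :=
    ((isCompact_unitary (n := n)).prod (isCompact_unitary (n := n))).tendsto_subseq
      (x := fun k => (Uk k, Vk k)) (fun k => ⟨hUk k, hVk k⟩)
  have hlU : Tendsto (fun k => Uk (φ k)) atTop (𝓝 U') := (continuous_fst.tendsto _).comp hlim
  have hlV : Tendsto (fun k => Vk (φ k)) atTop (𝓝 V') := (continuous_snd.tendsto _).comp hlim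
  obtain ⟨b'', hb, hbE⟩ := tendsto_rep (fun k => hUk (φ k)) hU' hU hlU (hB.comp hφ.tendsto_atTop)
  obtain ⟨c'', hc, hcE⟩ := tendsto_rep (fun k => hVk (φ k)) hV' hV hlV (hH.comp hφ.tendsto_atTop)
  have h1 : Sol t1 a b'' c'' := by
    have := isClosed_sol.mem_of_tendsto (f := fun k => (t1, ak (φ k), bk (φ k), ck (φ k)))
      (b := atTop) (x := (t1, a, b'', c''))
      ((tendsto_const_nhds (x := t1)).prodMk_nhds
        ((ha.comp hφ.tendsto_atTop).prodMk_nhds (hb.prodMk_nhds hc)))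
      (Eventually.of_forall fun k => hs (φ k))
    exact this
  obtain ⟨U1, V1, hU1, hV1, h⟩ := h1
  obtain ⟨U2, hU2, e2⟩ := rep_transfer hU hU' hbE t1 hU1
  obtain ⟨V2, hV2, e3⟩ := rep_transfer hV hV' hcE t1 hV1
  exact ⟨U2, V2, hU2, hV2, by rw [← e2, ← e3, h]⟩

open scoped ComplexOrder in
theorem sol_transfer (hn : 0 < n) {t0 : ℝ} (ht0 : 0 ≤ t0) (t1 : ℝ) {a b c : Fin n → ℝ}
    (h0 : Sol t0 a b c) : Sol t1 a b c := by
  obtain ⟨U, V, hU, hV, hE⟩ := h0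
  set B := U * Et t0 b * Uᴴ with hB
  set Y : Mat n := LL n * (LL n)ᴴ with hY
  have hYp : Y.PosSemidef := posSemidef_self_mul_conjTranspose _
  have hBh : B.IsHermitian := by
    rw [Matrix.IsHermitian, hB, conjTranspose_mul, conjTranspose_mul, conjTranspose_conjTranspose,
      Et, dg_conjTranspose, mul_assoc]
  have hBp : (1 + ((2 * t0 : ℝ) : ℂ) • B).PosDef := by
    rw [hB, key_conj t0 b hU]
    have h1 : (dg (fun i => Real.exp (2 * t0 * b i)) : Mat n).PosDef := by
      rw [dg, posDef_diagonal_iff]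
      intro i
      exact_mod_cast Real.exp_pos _
    refine h1.mul_mul_conjTranspose_same ?_
    exact Matrix.vecMul_injective_of_isUnit (IsUnit.of_mul_eq_one _ (uu hU))
  -- injective perturbation of `a`
  let f : ℝ → Fin n → ℝ := fun e i => a i + e * (i : ℕ)
  have hfi : ∀ᶠ e in 𝓝[≠] (0 : ℝ), Function.Injective (f e) := by
    have : ∀ i j : Fin n, ∀ᶠ e in 𝓝[≠] (0 : ℝ), i ≠ j → f e i ≠ f e j := by
      intro i j
      by_cases hij : i = j
      · simp [hij]
      · have hne : ((i : ℕ) : ℝ) - ((j : ℕ) : ℝ) ≠ 0 := by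
          rw [sub_ne_zero]; intro h; exact hij (Fin.ext (by exact_mod_cast h))
        filter_upwards [affine_ne (u := a i - a j) (v := ((i : ℕ) : ℝ) - ((j : ℕ) : ℝ))
          (Or.inr hne)] with e he _ h
        apply he; simp only [f] at h; linarith
    have h2 := (Filter.eventually_all.mpr fun i => Filter.eventually_all.mpr (this i))
    filter_upwards [h2] with e he i j hij
    by_contra h
    exact he i j h hij
  have hstep : ∀ k : ℕ, ∃ (e σ : ℝ), |e| < 1 / ((k : ℝ) + 1) ∧ (k : ℝ) + 1 < σ ∧
      Function.Injective (f e) ∧ (kry ⟨0, hn⟩ (B + ((σ⁻¹ : ℝ) : ℂ) • Y)).det ≠ 0 ∧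
      (kry ⟨0, hn⟩ (Hm t0 (f e) (B + ((σ⁻¹ : ℝ) : ℂ) • Y))).det ≠ 0 := by
    intro k
    have hb : ∀ᶠ e in 𝓝[≠] (0 : ℝ), |e| < 1 / ((k : ℝ) + 1) := by
      apply Filter.Eventually.filter_mono nhdsWithin_le_nhds
      have : Metric.ball (0 : ℝ) (1 / ((k : ℝ) + 1)) ∈ 𝓝 (0 : ℝ) :=
        Metric.ball_mem_nhds _ (by positivity)
      filter_upwards [this] with e he
      simpa using he
    obtain ⟨e, he1, he2⟩ := (hb.and hfi).exists
    obtain ⟨σ, h1, h2, h3⟩ := ((kry_eventually hn (hess_LL (n := n)) B).and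
      ((kry_eventually hn (hess_conj (hess_LL (n := n)) t0 (f e)) (Hm t0 (f e) B)).and
        (eventually_gt_atTop ((k : ℝ) + 1)))).exists
    exact ⟨e, σ, he1, h3, he2, h1, by rw [Hm_add]; exact h2⟩
  choose e σ he hσ hinj hk1 hk2 using hstep
  have hσ0 : ∀ k, 0 < σ k := fun k => lt_trans (by positivity) (hσ k)
  let Bk : ℕ → Mat n := fun k => B + (((σ k)⁻¹ : ℝ) : ℂ) • Y
  have hBkh : ∀ k, (Bk k).IsHermitian := by
    intro k
    refine hBh.add ?_
    rw [Matrix.IsHermitian, conjTranspose_smul, hYp.isHermitian]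
    simp
  have hBkp : ∀ k, (1 + ((2 * t0 : ℝ) : ℂ) • Bk k).PosDef := by
    intro k
    have h1 : 1 + ((2 * t0 : ℝ) : ℂ) • Bk k
        = (1 + ((2 * t0 : ℝ) : ℂ) • B) + ((2 * t0 * (σ k)⁻¹ : ℝ) : ℂ) • Y := by
      simp only [Bk, smul_add, smul_smul, add_assoc]
      push_cast
      rfl
    rw [h1]
    refine hBp.add_posSemidef (hYp.smul ?_)
    have : 0 ≤ 2 * t0 * (σ k)⁻¹ := by have := hσ0 k; positivity
    exact_mod_cast this
  have hHkp : ∀ k, (1 + ((2 * t0 : ℝ) : ℂ) • Hm t0 (f (e k)) (Bk k)).PosDef := by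
    intro k
    rw [one_add_Hm]
    have hP : (Pt t0 (f (e k)))ᴴ = Pt t0 (f (e k)) := dg_conjTranspose _
    have h2 := (hBkp k).mul_mul_conjTranspose_same (B := Pt t0 (f (e k)))
      (Matrix.vecMul_injective_of_isUnit (IsUnit.of_mul_eq_one _ (Pt_mul_Pi t0 (f (e k)))))
    rw [hP] at h2
    exact h2
  have hrB := fun k => exists_rep (hBkh k) (hBkp k)
  have hrH := fun k => exists_rep (Hm_isHermitian t0 (f (e k)) (hBkh k)) (hHkp k)
  choose Uk bk hUk hUE using hrB
  choose Vk ck hVk hVE using hrH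
  have hEk : ∀ k, Hm t0 (f (e k)) (Uk k * Et t0 (bk k) * (Uk k)ᴴ) = Vk k * Et t0 (ck k) * (Vk k)ᴴ := by
    intro k
    rw [← hUE, ← hVE]
  have he0 : Tendsto e atTop (𝓝 0) := by
    refine squeeze_zero_norm (fun k => ?_) (tendsto_one_div_add_atTop_nhds_zero_nat (𝕜 := ℝ))
    exact (he k).le
  have hσt : Tendsto (fun k => (σ k)⁻¹) atTop (𝓝 0) := by
    refine squeeze_zero_norm (fun k => ?_) (tendsto_one_div_add_atTop_nhds_zero_nat (𝕜 := ℝ))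
    rw [Real.norm_of_nonneg (inv_nonneg.mpr (hσ0 k).le), one_div]
    exact inv_anti₀ (by positivity) (hσ k).le
  refine limit_lemma (t0 := t0) (ak := fun k => f (e k)) hU hV hE hUk hVk hEk ?_ ?_ ?_
  · intro k
    have hbi : Function.Injective (bk k) := by
      have h1 := hk1 k
      change (kry ⟨0, hn⟩ (Bk k)).det ≠ 0 at h1
      rw [hUE k] at h1
      have h2 := kry_inj _ (hUk k) h1
      intro i j hij
      exact h2 (by simp [hij])
    have hci : Function.Injective (ck k) := by
      have h1 := hk2 k
      change (kry ⟨0, hn⟩ (Hm t0 (f (e k)) (Bk k))).det ≠ 0 at h1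
      rw [hVE k] at h1
      have h2 := kry_inj _ (hVk k) h1
      intro i j hij
      exact h2 (by simp [hij])
    refine lemmaA hn (hinj k) hbi hci (hUk k) (hVk k) (hEk k) ?_ t1
    rw [← hUE]
    exact kry_irr _ (hinj k) (hk1 k)
  · have hfc : Continuous f := by fun_prop
    have hf0 : f 0 = a := by funext i; simp [f]
    rw [← hf0]
    exact (hfc.tendsto 0).comp he0
  · have h1 : Tendsto Bk atTop (𝓝 B) := by
      have hc : Continuous (fun s : ℝ => B + (s : ℂ) • Y) := by fun_prop
      have := (hc.tendsto 0).comp hσt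
      have h0 : B + ((0 : ℝ) : ℂ) • Y = B := by simp
      rw [h0] at this
      exact this
    refine h1.congr fun k => hUE k

end MH

namespace MH
variable {n : ℕ}

lemma unit_mul {U V : Mat n} (hU : Uᴴ * U = 1) (hV : Vᴴ * V = 1) : (U * V)ᴴ * (U * V) = 1 := by
  rw [conjTranspose_mul]
  calc Vᴴ * Uᴴ * (U * V) = Vᴴ * (Uᴴ * U) * V := by simp only [mul_assoc]
    _ = 1 := by rw [hU, mul_one, hV]

lemma unit_ct {U : Mat n} (hU : Uᴴ * U = 1) : Uᴴᴴ * Uᴴ = 1 := by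
  rw [conjTranspose_conjTranspose]; exact uu hU

lemma conj_conj' (Q U X : Mat n) : Q * (U * X * Uᴴ) * Qᴴ = (Q * U) * X * (Q * U)ᴴ := by
  rw [conjTranspose_mul]; simp only [mul_assoc]

lemma eigsDesc_antitone {K : Mat n} (hK : K.IsHermitian) : Antitone (eigsDesc hK) := by
  intro i j hij
  exact Tuple.monotone_sort hK.eigenvalues (Fin.rev_le_rev.mpr hij)

lemma eigs_spec {K : Mat n} (hK : K.IsHermitian) :
    ∃ W : Mat n, Wᴴ * W = 1 ∧ K = W * dg (eigsDesc hK) * Wᴴ := by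
  let U : Mat n := hK.eigenvectorUnitary
  have hU : Uᴴ * U = 1 := (Unitary.mem_iff.mp hK.eigenvectorUnitary.2).1
  have hsp : K = U * dg hK.eigenvalues * Uᴴ := by
    have := hK.spectral_theorem
    rw [Unitary.conjStarAlgAut_apply] at this
    exact this
  let π : Equiv.Perm (Fin n) := Fin.revPerm.trans (Tuple.sort hK.eigenvalues)
  have hπ : ∀ i, eigsDesc hK i = hK.eigenvalues (π i) := fun i => rfl
  let W : Mat n := U.submatrix id π
  have h1 : W * Wᴴ = 1 := by
    rw [← uu hU]
    ext i j
    simp only [mul_apply, W, submatrix_apply, conjTranspose_apply, id]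
    exact Equiv.sum_comp π (fun k => U i k * star (U j k))
  refine ⟨W, mul_eq_one_comm.mp h1, ?_⟩
  conv_lhs => rw [hsp]
  ext i j
  rw [mul_apply, mul_apply]
  simp only [dg, mul_diagonal, W, submatrix_apply, conjTranspose_apply, id, hπ]
  exact (Equiv.sum_comp π (fun k => U i k * (hK.eigenvalues k : ℂ) * star (U j k))).symm

lemma charpoly_conj {U X : Mat n} (hU : Uᴴ * U = 1) : (U * X * Uᴴ).charpoly = X.charpoly := by
  rw [Matrix.charpoly_mul_comm, ← mul_assoc, hU, one_mul]

lemma charpoly_roots_dg (x : Fin n → ℝ) :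
    (dg x).charpoly.roots = Finset.univ.val.map (fun i => (x i : ℂ)) := by
  rw [dg, charpoly_diagonal, Polynomial.roots_prod]
  · simp
  · exact Finset.prod_ne_zero_iff.mpr fun i _ => Polynomial.X_sub_C_ne_zero _

lemma antitone_unique {x y : Fin n → ℝ} (hx : Antitone x) (hy : Antitone y) {U V : Mat n}
    (hU : Uᴴ * U = 1) (hV : Vᴴ * V = 1) (h : U * dg x * Uᴴ = V * dg y * Vᴴ) : x = y := by
  have h1 := congrArg (fun X : Mat n => X.charpoly.roots) h
  simp only [charpoly_conj hU, charpoly_conj hV, charpoly_roots_dg] at h1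
  have h2 : Finset.univ.val.map x = Finset.univ.val.map y := by
    apply Multiset.map_injective Complex.ofReal_injective
    rw [Multiset.map_map, Multiset.map_map]
    exact h1
  rw [Fin.univ_val_map, Fin.univ_val_map, Multiset.coe_eq_coe] at h2
  exact List.ofFn_injective
    (List.Perm.eq_of_pairwise' hx.sortedGE_ofFn.pairwise hy.sortedGE_ofFn.pairwise h2)

/-- partial sums -/
def ps (a : Fin n → ℝ) : Fin n → ℝ := fun i => ∑ j ∈ Finset.Iic i, a j

lemma lMap_of_rep {K : Mat n} (hK : K.IsHermitian) {a : Fin n → ℝ} (ha : Antitone a) {W : Mat n}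
    (hW : Wᴴ * W = 1) (h : K = W * dg a * Wᴴ) : lMap hK = ps a := by
  obtain ⟨U, hU, h1⟩ := eigs_spec hK
  have := antitone_unique (eigsDesc_antitone hK) ha hU hW (by rw [← h1, ← h])
  funext i
  simp only [lMap, ps, this]

lemma lB_of_rep {A : Mat n} {a : Fin n → ℝ} (ha : Antitone a) {W : Mat n}
    (hW : Wᴴ * W = 1) (h : A * Aᴴ = W * dg (fun i => Real.exp (2 * 1 * a i)) * Wᴴ) :
    lB A = ps a := by
  have hK := Matrix.isHermitian_mul_conjTranspose_self A
  obtain ⟨U, hU, h1⟩ := eigs_spec hK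
  have ha' : Antitone (fun i => Real.exp (2 * 1 * a i)) := fun i j hij =>
    Real.exp_le_exp.mpr (by have := ha hij; linarith)
  have := antitone_unique (eigsDesc_antitone hK) ha' hU hW (by rw [← h1, ← h])
  funext i
  simp only [lB, ps, this, Real.log_exp]
  rw [← Finset.mul_sum]; ring

open scoped ComplexOrder in
lemma exists_rep_B {A : Mat n} (hA : IsUnit A) : ∃ (W : Mat n) (a : Fin n → ℝ), Antitone a ∧
    Wᴴ * W = 1 ∧ A * Aᴴ = W * dg (fun i => Real.exp (2 * 1 * a i)) * Wᴴ := by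
  have hK := Matrix.isHermitian_mul_conjTranspose_self A
  have hp : (A * Aᴴ).PosDef := PosDef.mul_conjTranspose_self A (vecMul_injective_of_isUnit hA)
  have hpos : ∀ i, 0 < eigsDesc hK i := fun i => hp.eigenvalues_pos _
  obtain ⟨U, hU, h1⟩ := eigs_spec hK
  refine ⟨U, fun i => (1 / 2) * Real.log (eigsDesc hK i), ?_, hU, ?_⟩
  · intro i j hij
    have := Real.log_le_log (hpos j) (eigsDesc_antitone hK hij)
    simp only
    linarith
  · conv_lhs => rw [h1]
    congr 3
    funext i
    rw [show 2 * 1 * (1 / 2 * Real.log (eigsDesc hK i)) = Real.log (eigsDesc hK i) by ring,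
      Real.exp_log (hpos i)]

lemma utp_isUnit {A : Mat n} (hA : A ∈ UpperTriPos n) : IsUnit A := by
  rw [isUnit_iff_isUnit_det, isUnit_iff_ne_zero, det_of_isUpperTriangular]
  · refine Finset.prod_ne_zero_iff.mpr fun i _ h => ?_
    have := (hA.2 i).1
    rw [h] at this
    simp at this
  · intro i j hij
    exact hA.1 i j hij

lemma qr {G : Mat n} (hG : IsUnit G) : ∃ Q R : Mat n, Qᴴ * Q = 1 ∧ R ∈ UpperTriPos n ∧ G = Q * R := by
  let f : Fin n → EuclideanSpace ℂ (Fin n) := fun j => WithLp.toLp 2 (fun i => G i j)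
  have hf : Module.finrank ℂ (EuclideanSpace ℂ (Fin n)) = Fintype.card (Fin n) := by simp
  let q := InnerProductSpace.gramSchmidtOrthonormalBasis hf f
  let Q : Mat n := Matrix.of fun i j => q j i
  have hQ : Qᴴ * Q = 1 := by
    ext i j
    have h1 := orthonormal_iff_ite.mp q.orthonormal i j
    rw [one_apply, ← h1, mul_apply, PiLp.inner_apply]
    refine Finset.sum_congr rfl fun k _ => ?_
    simp [Q, mul_comm]
  let R := Qᴴ * G
  have hGR : G = Q * R := by simp only [R]; rw [← mul_assoc, uu hQ, one_mul]
  have hR0 : ∀ i j : Fin n, j < i → R i j = 0 := by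
    intro i j hij
    have h1 := InnerProductSpace.gramSchmidtOrthonormalBasis_inv_triangular hf f hij
    rw [← h1, PiLp.inner_apply]
    simp only [R]
    rw [mul_apply]
    refine Finset.sum_congr rfl fun k _ => ?_
    simp [Q, q, f, mul_comm]
  have hRd : ∀ i, R i i ≠ 0 := by
    have hu : R.det ≠ 0 := by
      intro h
      have h2 := (isUnit_iff_isUnit_det _).mp hG
      rw [hGR, det_mul, h, mul_zero] at h2
      simp at h2
    rw [det_of_isUpperTriangular (fun i j hij => hR0 i j hij)] at hu
    exact fun i => Finset.prod_ne_zero_iff.mp hu i (Finset.mem_univ i)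
  let s : Fin n → ℂ := fun i => R i i / (‖R i i‖ : ℂ)
  have hs : ∀ i, star (s i) * s i = 1 := by
    intro i
    have h0 : (‖R i i‖ : ℂ) ≠ 0 := by exact_mod_cast norm_ne_zero_iff.mpr (hRd i)
    have h1 : star (R i i) * R i i = (‖R i i‖ : ℂ) ^ 2 := Complex.conj_mul' _
    simp only [s, star_div₀]
    rw [div_mul_div_comm, h1]
    simp only [Complex.star_def, Complex.conj_ofReal]
    field_simp
  have hs2 : ∀ i, star (s i) * R i i = (‖R i i‖ : ℂ) := by
    intro i
    have h0 : (‖R i i‖ : ℂ) ≠ 0 := by exact_mod_cast norm_ne_zero_iff.mpr (hRd i)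
    have h1 : star (R i i) * R i i = (‖R i i‖ : ℂ) ^ 2 := Complex.conj_mul' _
    simp only [s, star_div₀]
    rw [div_mul_eq_mul_div, h1]
    simp only [Complex.star_def, Complex.conj_ofReal]
    field_simp
  have hS : (diagonal s)ᴴ * diagonal s = 1 := by
    rw [diagonal_conjTranspose, diagonal_mul_diagonal, ← diagonal_one]
    congr 1; funext i; exact hs i
  refine ⟨Q * diagonal s, (diagonal s)ᴴ * R, unit_mul hQ hS, ⟨?_, ?_⟩, ?_⟩
  · intro i j hij
    rw [diagonal_conjTranspose, diagonal_mul, hR0 i j hij, mul_zero]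
  · intro i
    rw [diagonal_conjTranspose, diagonal_mul, Pi.star_apply, hs2]
    simpa using hRd i
  · calc G = Q * R := hGR
      _ = Q * (diagonal s * (diagonal s)ᴴ) * R := by rw [uu hS, mul_one]
      _ = _ := by simp only [mul_assoc]

lemma sol_zero_iff {a b c : Fin n → ℝ} : Sol 0 a b c ↔ ∃ U V : Mat n, Uᴴ * U = 1 ∧ Vᴴ * V = 1 ∧
    dg a + U * dg b * Uᴴ = V * dg c * Vᴴ := by
  have e0 : ∀ x : Fin n → ℝ, Et 0 x = dg x := fun x => by simp [Et, ee_zero]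
  have p0 : Pt 0 a = 1 := by rw [Pt, ← dg_one]; simp
  simp only [Sol, Hm, e0, p0, one_mul, mul_one]

lemma sol_one_iff {a b c : Fin n → ℝ} : Sol 1 a b c ↔ ∃ U V : Mat n, Uᴴ * U = 1 ∧ Vᴴ * V = 1 ∧
    Pt 1 a * (U * dg (fun i => Real.exp (2 * 1 * b i)) * Uᴴ) * Pt 1 a
      = V * dg (fun i => Real.exp (2 * 1 * c i)) * Vᴴ := by
  constructor
  · rintro ⟨U, V, hU, hV, h⟩
    refine ⟨U, V, hU, hV, ?_⟩
    rw [← key_conj 1 b hU, ← key_conj 1 c hV, ← one_add_Hm, h]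
  · rintro ⟨U, V, hU, hV, h⟩
    refine ⟨U, V, hU, hV, ?_⟩
    rw [← key_conj 1 b hU, ← key_conj 1 c hV, ← one_add_Hm] at h
    have h1 := add_left_cancel h
    exact smul_right_injective _ (by norm_num : ((2 * 1 : ℝ) : ℂ) ≠ 0) h1

lemma Pt_one_sq (a : Fin n → ℝ) : Pt 1 a * Pt 1 a = dg (fun i => Real.exp (2 * 1 * a i)) := by
  rw [Pt_sq, one_add_Et]

lemma Pt_ct (t : ℝ) (a : Fin n → ℝ) : (Pt t a)ᴴ = Pt t a := dg_conjTranspose _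

lemma Pi_ct (t : ℝ) (a : Fin n → ℝ) : (Pi' t a)ᴴ = Pi' t a := dg_conjTranspose _

lemma mul_to_add (hn : 0 < n) {A C : Mat n} (hA : A ∈ UpperTriPos n) (hC : C ∈ UpperTriPos n) :
    ∃ (K₁ K₂ : Mat n) (h₁ : K₁.IsHermitian) (h₂ : K₂.IsHermitian),
      lMap h₁ = lB A ∧ lMap h₂ = lB C ∧ lMap (h₁.add h₂) = lB (A * C) := by
  have hAu := utp_isUnit hA
  have hCu := utp_isUnit hC
  obtain ⟨W1, a, ha, hW1, eA⟩ := exists_rep_B hAu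
  obtain ⟨W2, b, hb, hW2, eC⟩ := exists_rep_B hCu
  obtain ⟨W3, c, hc, hW3, eAC⟩ := exists_rep_B (hAu.mul hCu)
  set Q : Mat n := Pi' 1 a * W1ᴴ * A with hQdef
  have hQQ : Q * Qᴴ = 1 := by
    rw [hQdef, conjTranspose_mul, conjTranspose_mul, conjTranspose_conjTranspose, Pi_ct]
    calc Pi' 1 a * W1ᴴ * A * (Aᴴ * (W1 * Pi' 1 a)) = Pi' 1 a * W1ᴴ * (A * Aᴴ) * (W1 * Pi' 1 a) := by
          simp only [mul_assoc]
      _ = Pi' 1 a * (W1ᴴ * W1) * (Pt 1 a * Pt 1 a) * (W1ᴴ * W1) * Pi' 1 a := by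
          rw [eA, Pt_one_sq]; simp only [mul_assoc]
      _ = (Pi' 1 a * Pt 1 a) * (Pt 1 a * Pi' 1 a) := by
          rw [hW1]; simp only [mul_one, mul_assoc]
      _ = 1 := by rw [Pi_mul_Pt, Pt_mul_Pi, one_mul]
  have hQ : Qᴴ * Q = 1 := mul_eq_one_comm.mp hQQ
  have hAQ : A = W1 * Pt 1 a * Q := by
    rw [hQdef]
    calc A = (W1 * W1ᴴ) * A := by rw [uu hW1, one_mul]
      _ = W1 * (1 : Mat n) * W1ᴴ * A := by simp only [mul_one]
      _ = W1 * (Pt 1 a * Pi' 1 a) * W1ᴴ * A := by rw [Pt_mul_Pi]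
      _ = _ := by simp only [mul_assoc]
  clear_value Q
  have hsol : Sol 1 a b c := by
    rw [sol_one_iff]
    refine ⟨Q * W2, W1ᴴ * W3, unit_mul hQ hW2, unit_mul (unit_ct hW1) hW3, ?_⟩
    have h1 : A * C * (A * C)ᴴ = W1 * Pt 1 a * (Q * (C * Cᴴ) * Qᴴ) * Pt 1 a * W1ᴴ := by
      rw [conjTranspose_mul]
      have hAct : Aᴴ = Qᴴ * (Pt 1 a * W1ᴴ) := by
        conv_lhs => rw [hAQ]
        rw [conjTranspose_mul, conjTranspose_mul, Pt_ct]
      rw [hAct]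
      conv_lhs => rw [hAQ]
      simp only [mul_assoc]
    rw [eAC, eC, conj_conj'] at h1
    rw [← conj_conj' W1ᴴ, h1, conjTranspose_conjTranspose]
    set M := Q * W2 * dg (fun i => Real.exp (2 * 1 * b i)) * (Q * W2)ᴴ
    calc Pt 1 a * M * Pt 1 a = (W1ᴴ * W1) * Pt 1 a * M * Pt 1 a * (W1ᴴ * W1) := by
          rw [hW1, one_mul, mul_one]
      _ = _ := by simp only [mul_assoc]
  have h0 := sol_transfer hn zero_le_one 0 hsol
  rw [sol_zero_iff] at h0
  obtain ⟨U, V, hU, hV, h⟩ := h0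
  have hh : (U * dg b * Uᴴ).IsHermitian := by
    rw [Matrix.IsHermitian, conjTranspose_mul, conjTranspose_mul, conjTranspose_conjTranspose,
      dg_conjTranspose, mul_assoc]
  refine ⟨dg a, U * dg b * Uᴴ, dg_isHermitian a, hh, ?_, ?_, ?_⟩
  · rw [lB_of_rep ha hW1 eA]
    exact lMap_of_rep _ ha (W := 1) (by simp) (by simp)
  · rw [lB_of_rep hb hW2 eC]
    exact lMap_of_rep _ hb hU rfl
  · rw [lB_of_rep hc hW3 eAC]
    exact lMap_of_rep _ hc hV h

lemma add_to_mul (hn : 0 < n) {K₁ K₂ : Mat n} (h₁ : K₁.IsHermitian) (h₂ : K₂.IsHermitian) :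
    ∃ A C : Mat n, A ∈ UpperTriPos n ∧ C ∈ UpperTriPos n ∧
      lB A = lMap h₁ ∧ lB C = lMap h₂ ∧ lB (A * C) = lMap (h₁.add h₂) := by
  obtain ⟨W1, hW1, e1⟩ := eigs_spec h₁
  obtain ⟨W2, hW2, e2⟩ := eigs_spec h₂
  obtain ⟨W3, hW3, e3⟩ := eigs_spec (h₁.add h₂)
  have ha := eigsDesc_antitone h₁
  have hb := eigsDesc_antitone h₂
  have hc := eigsDesc_antitone (h₁.add h₂)
  rw [lMap_of_rep h₁ ha hW1 e1, lMap_of_rep h₂ hb hW2 e2, lMap_of_rep (h₁.add h₂) hc hW3 e3]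
  set a := eigsDesc h₁
  set b := eigsDesc h₂
  set c := eigsDesc (h₁.add h₂)
  have hsol : Sol 0 a b c := by
    rw [sol_zero_iff]
    refine ⟨W1ᴴ * W2, W1ᴴ * W3, unit_mul (unit_ct hW1) hW2, unit_mul (unit_ct hW1) hW3, ?_⟩
    rw [← conj_conj', ← conj_conj', ← e2, ← e3, conjTranspose_conjTranspose, mul_add, add_mul]
    congr 1
    calc dg a = (W1ᴴ * W1) * dg a * (W1ᴴ * W1) := by rw [hW1, one_mul, mul_one]
      _ = W1ᴴ * (W1 * dg a * W1ᴴ) * W1 := by simp only [mul_assoc]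
      _ = _ := by rw [← e1]
  have h1 := sol_transfer hn le_rfl 1 hsol
  rw [sol_one_iff] at h1
  obtain ⟨U, V, hU, hV, h⟩ := h1
  have hPu : ∀ x : Fin n → ℝ, IsUnit (Pt 1 x) := fun x => IsUnit.of_mul_eq_one _ (Pt_mul_Pi 1 x)
  have hUu : ∀ {X : Mat n}, Xᴴ * X = 1 → IsUnit X := fun hX => IsUnit.of_mul_eq_one _ (uu hX)
  obtain ⟨Q, C, hQ, hC, eC⟩ := qr ((hUu hU).mul (hPu b))
  obtain ⟨Q', A, hQ', hA, eA⟩ := qr ((hPu a).mul (hUu hQ))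
  have eC' : C = Qᴴ * (U * Pt 1 b) := by rw [eC, ← mul_assoc, hQ, one_mul]
  have eA' : A = Q'ᴴ * (Pt 1 a * Q) := by rw [eA, ← mul_assoc, hQ', one_mul]
  refine ⟨A, C, hA, hC, ?_, ?_, ?_⟩
  · refine lB_of_rep ha (unit_ct hQ') ?_
    rw [← Pt_one_sq, eA', conjTranspose_mul, conjTranspose_mul, Pt_ct, conjTranspose_conjTranspose]
    calc Q'ᴴ * (Pt 1 a * Q) * (Qᴴ * Pt 1 a * Q') = Q'ᴴ * (Pt 1 a * (Q * Qᴴ) * Pt 1 a) * Q' := by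
          simp only [mul_assoc]
      _ = _ := by rw [uu hQ, mul_one]
  · refine lB_of_rep hb (unit_mul (unit_ct hQ) hU) ?_
    rw [← Pt_one_sq, eC']
    simp only [conjTranspose_mul, Pt_ct, mul_assoc]
  · refine lB_of_rep hc (unit_mul (unit_ct hQ') hV) ?_
    rw [← conj_conj', ← h, ← Pt_one_sq]
    have hAC : A * C = Q'ᴴ * (Pt 1 a * U * Pt 1 b) := by
      rw [eA', eC']
      calc Q'ᴴ * (Pt 1 a * Q) * (Qᴴ * (U * Pt 1 b)) = Q'ᴴ * (Pt 1 a * (Q * Qᴴ) * U * Pt 1 b) := by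
            simp only [mul_assoc]
        _ = _ := by rw [uu hQ, mul_one]
    rw [hAC]
    simp only [conjTranspose_mul, Pt_ct, mul_assoc]

end MH

/-- For fixed spectra data `r, s`, the multiplicative Horn polytope
`{lB(AC) : A, C ∈ B, lB A = r, lB C = s}` coincides with the additive Horn polytope
`{l(K₁ + K₂) : K₁, K₂ Hermitian, l K₁ = r, l K₂ = s}`. -/
theorem multiplicative_horn_polytope_eq_additive (n : ℕ) (hn : 0 < n)
    (r s : Fin n → ℝ) :
    {t : Fin n → ℝ | ∃ A C : Matrix (Fin n) (Fin n) ℂ,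
        A ∈ UpperTriPos n ∧ C ∈ UpperTriPos n ∧ lB A = r ∧ lB C = s ∧ lB (A * C) = t} =
      {t : Fin n → ℝ | ∃ (K₁ K₂ : Matrix (Fin n) (Fin n) ℂ)
          (h₁ : K₁.IsHermitian) (h₂ : K₂.IsHermitian),
        lMap h₁ = r ∧ lMap h₂ = s ∧ lMap (h₁.add h₂) = t} := by
  ext t
  constructor
  · rintro ⟨A, C, hA, hC, rfl, rfl, rfl⟩
    exact MH.mul_to_add hn hA hC
  · rintro ⟨K₁, K₂, h₁, h₂, rfl, rfl, rfl⟩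
    exact MH.add_to_mul hn h₁ h₂
end
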